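/- Let (q_n)_{n≥1} be a sequence of positive reals such that the limit β = lim_{n→∞} n(1−q_n) exists in ℝ. Then for every ε > 0, μ_{n,q_n}({π ∈ S_n : |n^{−1/2} ℓ(π) − 𝓛(β)| < ε}) → 1 as n → ∞. -/

import Mathlib

open Filter

/-- Number of inversions of a permutation of `Fin n`. -/
def inversions {n : ℕ} (π : Equiv.Perm (Fin n)) : ℕ :=
  (Finset.univ.filter (fun p : Fin n × Fin n => p.1 < p.2 ∧ π p.2 < π p.1)).card

/-- Length of the longest increasing subsequence of a permutation of `Fin n`. -/
def lisLength {n : ℕ} (π : Equiv.Perm (Fin n)) : ℕ :=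
  Finset.univ.powerset.sup fun s : Finset (Fin n) =>
    if ∀ i ∈ s, ∀ j ∈ s, i < j → π i < π j then s.card else 0

/-- The Mallows(n,q) probability of a set of permutations: each permutation `π` has
probability proportional to `q ^ inversions π`. -/
noncomputable def mallowsProb (n : ℕ) (q : ℝ) (A : Set (Equiv.Perm (Fin n))) : ℝ :=
  (∑ π : Equiv.Perm (Fin n), A.indicator (fun π => q ^ inversions π) π) /
    (∑ π : Equiv.Perm (Fin n), q ^ inversions π)

/-- The limit function 𝓛(β). -/
noncomputable def calL (β : ℝ) : ℝ :=
  if 0 < β then 2 / Real.sqrt β * Real.arsinh (Real.sqrt (Real.exp β - 1))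
  else if β < 0 then 2 / Real.sqrt |β| * Real.arcsin (Real.sqrt (1 - Real.exp β))
  else 2

open Filter

namespace ML

/-- Expectation over a random subset of `S`, each `x` included independently with weight `P x`. -/
noncomputable def Ex {α : Type*} [DecidableEq α] (P : α → ℝ) (S : Finset α)
    (f : Finset α → ℝ) : ℝ :=
  ∑ T ∈ S.powerset, ((∏ x ∈ T, P x) * ∏ x ∈ S \ T, (1 - P x)) * f T

section ExBasics
variable {α : Type*} [DecidableEq α]

theorem Ex_empty (P : α → ℝ) (f : Finset α → ℝ) : Ex P ∅ f = f ∅ := by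
  simp [Ex]

theorem Ex_insert (P : α → ℝ) (S : Finset α) (x : α) (hx : x ∉ S) (f : Finset α → ℝ) :
    Ex P (insert x S) f
      = P x * Ex P S (fun T => f (insert x T)) + (1 - P x) * Ex P S f := by
  unfold Ex
  rw [Finset.sum_powerset_insert hx, add_comm, Finset.mul_sum, Finset.mul_sum]
  congr 1
  · refine Finset.sum_congr rfl fun T hT => ?_
    have hT' := Finset.mem_powerset.1 hT
    have hxT : x ∉ T := fun h => hx (hT' h)
    rw [Finset.prod_insert hxT]
    have : insert x S \ insert x T = S \ T := by
      ext y; simp only [Finset.mem_sdiff, Finset.mem_insert]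
      constructor
      · rintro ⟨h1, h2⟩; push Not at h2; exact ⟨h1.resolve_left h2.1, h2.2⟩
      · rintro ⟨h1, h2⟩; refine ⟨Or.inr h1, ?_⟩; push Not; exact ⟨fun h => hx (h ▸ h1), h2⟩
    rw [this]; ring
  · refine Finset.sum_congr rfl fun T hT => ?_
    have hT' := Finset.mem_powerset.1 hT
    have hxT : x ∉ T := fun h => hx (hT' h)
    rw [Finset.insert_sdiff_of_notMem _ hxT, Finset.prod_insert (by simp [hx])]
    ring

theorem Ex_congr (P : α → ℝ) (S : Finset α) {f g : Finset α → ℝ} (h : ∀ T, T ⊆ S → f T = g T) :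
    Ex P S f = Ex P S g := by
  unfold Ex
  exact Finset.sum_congr rfl fun T hT => by rw [h T (Finset.mem_powerset.1 hT)]

theorem Ex_congrP {P Q : α → ℝ} (S : Finset α) (f : Finset α → ℝ) (h : ∀ x ∈ S, P x = Q x) :
    Ex P S f = Ex Q S f := by
  unfold Ex
  refine Finset.sum_congr rfl fun T hT => ?_
  have hT' := Finset.mem_powerset.1 hT
  rw [Finset.prod_congr rfl fun x hx => h x (hT' hx),
    Finset.prod_congr (s₁ := S \ T) rfl fun x hx => by rw [h x (Finset.mem_sdiff.1 hx).1]]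

theorem Ex_add (P : α → ℝ) (S : Finset α) (f g : Finset α → ℝ) :
    Ex P S (fun T => f T + g T) = Ex P S f + Ex P S g := by
  unfold Ex; rw [← Finset.sum_add_distrib]; exact Finset.sum_congr rfl fun T _ => by ring

theorem Ex_mul (P : α → ℝ) (S : Finset α) (c : ℝ) (f : Finset α → ℝ) :
    Ex P S (fun T => c * f T) = c * Ex P S f := by
  unfold Ex; rw [Finset.mul_sum]; exact Finset.sum_congr rfl fun T _ => by ring

theorem Ex_sub (P : α → ℝ) (S : Finset α) (f g : Finset α → ℝ) :
    Ex P S (fun T => f T - g T) = Ex P S f - Ex P S g := by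
  unfold Ex; rw [← Finset.sum_sub_distrib]; exact Finset.sum_congr rfl fun T _ => by ring

theorem Ex_sum {ι : Type*} (P : α → ℝ) (S : Finset α) (I : Finset ι) (f : ι → Finset α → ℝ) :
    Ex P S (fun T => ∑ i ∈ I, f i T) = ∑ i ∈ I, Ex P S (f i) := by
  unfold Ex
  rw [Finset.sum_comm]
  exact Finset.sum_congr rfl fun T _ => by rw [Finset.mul_sum]

theorem Ex_const (P : α → ℝ) (S : Finset α) (c : ℝ) : Ex P S (fun _ => c) = c := by
  induction S using Finset.induction_on with
  | empty => exact Ex_empty _ _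
  | insert x S hx ih => rw [Ex_insert P S x hx, ih]; ring

theorem Ex_mono (P : α → ℝ) (S : Finset α) (hP : ∀ x ∈ S, 0 ≤ P x ∧ P x ≤ 1)
    {f g : Finset α → ℝ} (h : ∀ T, T ⊆ S → f T ≤ g T) : Ex P S f ≤ Ex P S g := by
  unfold Ex
  refine Finset.sum_le_sum fun T hT => ?_
  have hT' := Finset.mem_powerset.1 hT
  refine mul_le_mul_of_nonneg_left (h T hT') (mul_nonneg ?_ ?_)
  · exact Finset.prod_nonneg fun x hx => (hP x (hT' hx)).1
  · exact Finset.prod_nonneg fun x hx => by linarith [(hP x (Finset.mem_sdiff.1 hx).1).2]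

theorem Ex_nonneg (P : α → ℝ) (S : Finset α) (hP : ∀ x ∈ S, 0 ≤ P x ∧ P x ≤ 1)
    {f : Finset α → ℝ} (h : ∀ T, T ⊆ S → 0 ≤ f T) : 0 ≤ Ex P S f := by
  rw [← Ex_const P S 0]; exact Ex_mono P S hP h

theorem Ex_union (P : α → ℝ) (S₁ S₂ : Finset α) (hd : Disjoint S₁ S₂) (f : Finset α → ℝ) :
    Ex P (S₁ ∪ S₂) f = Ex P S₁ (fun T₁ => Ex P S₂ (fun T₂ => f (T₁ ∪ T₂))) := by
  induction S₁ using Finset.induction_on generalizing f with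
  | empty => simp [Ex_empty]
  | insert x S hx ih =>
    rw [Finset.disjoint_insert_left] at hd
    rw [Finset.insert_union, Ex_insert P _ x (by simp [hx, hd.1]), Ex_insert P S x hx,
      ih hd.2, ih hd.2]
    simp only [Finset.insert_union]

theorem Ex_inter (P : α → ℝ) (S A : Finset α) (hA : A ⊆ S) (f : Finset α → ℝ) :
    Ex P S (fun T => f (T ∩ A)) = Ex P A f := by
  conv_lhs => rw [← Finset.union_sdiff_of_subset hA]
  rw [Ex_union P _ _ Finset.disjoint_sdiff]
  refine Ex_congr P A fun T hT => ?_
  rw [← Ex_const P (S \ A) (f T)]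
  refine Ex_congr P _ fun T' hT' => ?_
  congr 1
  ext y
  simp only [Finset.mem_inter, Finset.mem_union]
  constructor
  · rintro ⟨h | h, h2⟩
    · exact h
    · exact absurd h2 (Finset.mem_sdiff.1 (hT' h)).2
  · exact fun h => ⟨Or.inl h, hT h⟩

theorem Ex_image {β : Type*} [DecidableEq β] (P : β → ℝ) (S : Finset α) (e : α → β)
    (he : Set.InjOn e S) (f : Finset β → ℝ) :
    Ex P (S.image e) f = Ex (P ∘ e) S (fun T => f (T.image e)) := by
  induction S using Finset.induction_on generalizing f with
  | empty => simp [Ex_empty]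
  | insert x S hx ih =>
    have h1 : Set.InjOn e S := he.mono (by simp)
    have h2 : e x ∉ S.image e := by
      intro h
      obtain ⟨y, hy, hxy⟩ := Finset.mem_image.1 h
      have := he (by simp [hy]) (by simp) hxy
      exact hx (this ▸ hy)
    rw [Finset.image_insert, Ex_insert P _ _ h2, Ex_insert _ S x hx, ih h1, ih h1]
    simp only [Finset.image_insert, Function.comp]

theorem Ex_subset (P : α → ℝ) (S X : Finset α) (hX : X ⊆ S) :
    Ex P S (fun T => if X ⊆ T then 1 else 0) = ∏ x ∈ X, P x := by
  have h1 : Ex P S (fun T => if X ⊆ T then (1:ℝ) else 0)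
      = Ex P X (fun T => if X ⊆ T then 1 else 0) := by
    rw [← Ex_inter P S X hX]
    refine Ex_congr P S fun T _ => ?_
    show (if X ⊆ T then (1:ℝ) else 0) = if X ⊆ T ∩ X then 1 else 0
    by_cases h : X ⊆ T <;> simp [h, Finset.subset_inter_iff]
  rw [h1]
  unfold Ex
  rw [Finset.sum_eq_single X]
  · simp
  · intro T hT hne
    have : ¬ X ⊆ T := fun h => hne (Finset.Subset.antisymm (Finset.mem_powerset.1 hT) h)
    simp [this]
  · intro h; simp at h

theorem Ex_card (P : α → ℝ) (S : Finset α) :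
    Ex P S (fun T => (T.card : ℝ) - ∑ x ∈ S, P x) = 0 := by
  induction S using Finset.induction_on with
  | empty => simp [Ex_empty]
  | insert x S hx ih =>
    rw [Ex_insert P S x hx, Finset.sum_insert hx]
    have h1 : Ex P S (fun T => ((insert x T).card : ℝ) - (P x + ∑ x ∈ S, P x))
        = Ex P S (fun T => ((T.card : ℝ) - ∑ x ∈ S, P x) + (1 - P x)) := by
      refine Ex_congr P S fun T hT => ?_
      rw [Finset.card_insert_of_notMem fun h => hx (hT h)]; push_cast; ring
    have h2 : Ex P S (fun T => (T.card : ℝ) - (P x + ∑ x ∈ S, P x))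
        = Ex P S (fun T => ((T.card : ℝ) - ∑ x ∈ S, P x) + (- P x)) := by
      refine Ex_congr P S fun T hT => ?_
      ring
    rw [h1, h2, Ex_add, Ex_add, ih, Ex_const, Ex_const]; ring

theorem Ex_card_sq (P : α → ℝ) (S : Finset α) :
    Ex P S (fun T => ((T.card : ℝ) - ∑ x ∈ S, P x) ^ 2) = ∑ x ∈ S, P x * (1 - P x) := by
  induction S using Finset.induction_on with
  | empty => simp [Ex_empty]
  | insert x S hx ih =>
    rw [Ex_insert P S x hx, Finset.sum_insert hx, Finset.sum_insert hx]
    have h1 : Ex P S (fun T => (((insert x T).card : ℝ) - (P x + ∑ x ∈ S, P x)) ^ 2)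
        = Ex P S (fun T => ((T.card : ℝ) - ∑ x ∈ S, P x) ^ 2
          + (2 * (1 - P x) * ((T.card : ℝ) - ∑ x ∈ S, P x) + (1 - P x) ^ 2)) := by
      refine Ex_congr P S fun T hT => ?_
      rw [Finset.card_insert_of_notMem fun h => hx (hT h)]; push_cast; ring
    have h2 : Ex P S (fun T => ((T.card : ℝ) - (P x + ∑ x ∈ S, P x)) ^ 2)
        = Ex P S (fun T => ((T.card : ℝ) - ∑ x ∈ S, P x) ^ 2
          + ((-2 * P x) * ((T.card : ℝ) - ∑ x ∈ S, P x) + (P x) ^ 2)) := by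
      refine Ex_congr P S fun T hT => ?_
      ring
    rw [h1, h2, Ex_add, Ex_add, Ex_add, Ex_add, ih, Ex_mul, Ex_mul, Ex_card, Ex_const, Ex_const]
    ring

open Classical in
/-- Probability of an event. -/
noncomputable def Pr (P : α → ℝ) (S : Finset α) (E : Finset α → Prop) : ℝ :=
  Ex P S (fun T => if E T then 1 else 0)

variable {P : α → ℝ} {S : Finset α}

theorem Pr_nonneg (hP : ∀ x ∈ S, 0 ≤ P x ∧ P x ≤ 1) (E : Finset α → Prop) : 0 ≤ Pr P S E :=
  Ex_nonneg P S hP fun T _ => by split_ifs <;> norm_num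

theorem Pr_mono (hP : ∀ x ∈ S, 0 ≤ P x ∧ P x ≤ 1) {E F : Finset α → Prop}
    (h : ∀ T, T ⊆ S → E T → F T) : Pr P S E ≤ Pr P S F :=
  Ex_mono P S hP fun T hT => by
    by_cases h1 : E T
    · simp [h1, h T hT h1]
    · simp only [h1, if_false]; split_ifs <;> norm_num

theorem Pr_le_one (hP : ∀ x ∈ S, 0 ≤ P x ∧ P x ≤ 1) (E : Finset α → Prop) : Pr P S E ≤ 1 := by
  rw [← Ex_const P S 1]
  exact Ex_mono P S hP fun T _ => by split_ifs <;> norm_num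

theorem Pr_or (hP : ∀ x ∈ S, 0 ≤ P x ∧ P x ≤ 1) (E F : Finset α → Prop) :
    Pr P S (fun T => E T ∨ F T) ≤ Pr P S E + Pr P S F := by
  unfold Pr
  rw [← Ex_add]
  refine Ex_mono P S hP fun T _ => ?_
  by_cases h1 : E T <;> by_cases h2 : F T <;> simp [h1, h2]

theorem Pr_exists {ι : Type*} (hP : ∀ x ∈ S, 0 ≤ P x ∧ P x ≤ 1) (I : Finset ι)
    (E : ι → Finset α → Prop) :
    Pr P S (fun T => ∃ i ∈ I, E i T) ≤ ∑ i ∈ I, Pr P S (E i) := by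
  unfold Pr
  rw [← Ex_sum]
  refine Ex_mono P S hP fun T _ => ?_
  classical
  by_cases h : ∃ i ∈ I, E i T
  · obtain ⟨i, hi, hE⟩ := h
    have h0 : ∃ i ∈ I, E i T := ⟨i, hi, hE⟩
    rw [if_pos h0]
    have := Finset.single_le_sum (f := fun i => if E i T then (1:ℝ) else 0)
      (fun j _ => by split_ifs <;> norm_num) hi
    simpa [hE] using this
  · rw [if_neg h]
    exact Finset.sum_nonneg fun j _ => by split_ifs <;> norm_num

theorem Pr_not (E : Finset α → Prop) : Pr P S (fun T => ¬ E T) = 1 - Pr P S E := by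
  unfold Pr
  have : (1:ℝ) - Ex P S (fun T => (@ite ℝ (E T) (Classical.propDecidable _) 1 0))
      = Ex P S (fun T => 1 - (@ite ℝ (E T) (Classical.propDecidable _) 1 0)) := by
    rw [Ex_sub, Ex_const]
  rw [this]
  refine Ex_congr P S fun T _ => ?_
  by_cases h : E T <;> simp [h]

theorem Pr_markov (hP : ∀ x ∈ S, 0 ≤ P x ∧ P x ≤ 1) (f : Finset α → ℝ) (hf : ∀ T, 0 ≤ f T)
    (t : ℝ) (ht : 0 < t) : Pr P S (fun T => t ≤ f T) ≤ Ex P S f / t := by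
  rw [div_eq_inv_mul, ← Ex_mul]
  refine Ex_mono P S hP fun T _ => ?_
  split_ifs with h
  · rw [← inv_mul_cancel₀ ht.ne']; exact mul_le_mul_of_nonneg_left h (by positivity)
  · have := hf T; positivity

theorem Pr_cheb (hP : ∀ x ∈ S, 0 ≤ P x ∧ P x ≤ 1) (f : Finset α → ℝ) (m v : ℝ)
    (hv : Ex P S (fun T => (f T - m) ^ 2) ≤ v)
    (t : ℝ) (ht : 0 < t) : Pr P S (fun T => t ≤ |f T - m|) ≤ v / t ^ 2 := by
  refine le_trans (Pr_mono (F := fun T => t ^ 2 ≤ (f T - m) ^ 2) hP fun T _ h => ?_)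
    (le_trans (Pr_markov hP _ (fun T => sq_nonneg _) _ (by positivity)) ?_)
  · show t ^ 2 ≤ (f T - m) ^ 2
    rw [← sq_abs (f T - m)]; gcongr
  · gcongr

theorem Pr_congr {E F : Finset α → Prop} (h : ∀ T, T ⊆ S → (E T ↔ F T)) : Pr P S E = Pr P S F := by
  unfold Pr
  refine Ex_congr P S fun T hT => ?_
  by_cases h1 : E T
  · simp [h1, (h T hT).1 h1]
  · have : ¬ F T := fun h2 => h1 ((h T hT).2 h2)
    simp [h1, this]

end ExBasics

end ML

open Filter

namespace ML

/-- direction-dependent comparison of rows -/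
def rel (d : Bool) (a b : ℕ) : Prop := if d then a < b else b < a

/-- strict order on cells `(row, col)` -/
def clt (d : Bool) (x y : ℕ × ℕ) : Prop := x.2 < y.2 ∧ rel d x.1 y.1

/-- chains of cells -/
def IsCh (d : Bool) (X : Finset (ℕ × ℕ)) : Prop :=
  ∀ x ∈ X, ∀ y ∈ X, x ≠ y → clt d x y ∨ clt d y x

open Classical in
/-- longest chain -/
noncomputable def L (d : Bool) (P : Finset (ℕ × ℕ)) : ℕ :=
  (P.powerset.filter (IsCh d)).sup Finset.card

theorem rel_irrefl (d : Bool) (a : ℕ) : ¬ rel d a a := by cases d <;> simp [rel]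

theorem rel_trans {d : Bool} {a b c : ℕ} (h : rel d a b) (h' : rel d b c) : rel d a c := by
  cases d <;> simp [rel] at * <;> omega

theorem clt_irrefl (d : Bool) (x : ℕ × ℕ) : ¬ clt d x x := fun h => rel_irrefl d _ h.2

theorem IsCh.subset {d : Bool} {X Y : Finset (ℕ × ℕ)} (h : IsCh d X) (hY : Y ⊆ X) : IsCh d Y :=
  fun x hx y hy => h x (hY hx) y (hY hy)

theorem le_L {d : Bool} {P X : Finset (ℕ × ℕ)} (hX : X ⊆ P) (h : IsCh d X) : X.card ≤ L d P := by
  classical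
  exact Finset.le_sup (f := Finset.card)
    (Finset.mem_filter.2 ⟨Finset.mem_powerset.2 hX, h⟩)

theorem exists_L (d : Bool) (P : Finset (ℕ × ℕ)) : ∃ X ⊆ P, IsCh d X ∧ X.card = L d P := by
  classical
  have hne : (P.powerset.filter (IsCh d)).Nonempty :=
    ⟨∅, Finset.mem_filter.2 ⟨by simp, fun x hx => by simp at hx⟩⟩
  obtain ⟨X, hX, h⟩ := Finset.exists_mem_eq_sup _ hne Finset.card
  rw [Finset.mem_filter, Finset.mem_powerset] at hX
  refine ⟨X, hX.1, hX.2, ?_⟩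
  rw [← h]; unfold L; congr

theorem L_mono {d : Bool} {P Q : Finset (ℕ × ℕ)} (h : P ⊆ Q) : L d P ≤ L d Q := by
  obtain ⟨X, hX, hc, he⟩ := exists_L d P
  rw [← he]; exact le_L (hX.trans h) hc

theorem L_le_iff {d : Bool} {P : Finset (ℕ × ℕ)} {k : ℕ} :
    L d P ≤ k ↔ ∀ X ⊆ P, IsCh d X → X.card ≤ k := by
  constructor
  · intro h X hX hc; exact (le_L hX hc).trans h
  · intro h
    obtain ⟨X, hX, hc, he⟩ := exists_L d P
    rw [← he]; exact h X hX hc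

theorem L_union (d : Bool) (P Q : Finset (ℕ × ℕ)) : L d (P ∪ Q) ≤ L d P + L d Q := by
  rw [L_le_iff]
  intro X hX hc
  have h1 : X = (X ∩ P) ∪ (X ∩ Q) := by
    rw [← Finset.inter_union_distrib_left]; exact (Finset.inter_eq_left.2 hX).symm
  calc X.card ≤ (X ∩ P).card + (X ∩ Q).card := by
        conv_lhs => rw [h1]
        exact Finset.card_union_le _ _
    _ ≤ _ := add_le_add (le_L Finset.inter_subset_right (hc.subset Finset.inter_subset_left))
        (le_L Finset.inter_subset_right (hc.subset Finset.inter_subset_left))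

theorem L_le_card (d : Bool) (P : Finset (ℕ × ℕ)) : L d P ≤ P.card := by
  rw [L_le_iff]; exact fun X hX _ => Finset.card_le_card hX

theorem L_image (d d' : Bool) (P : Finset (ℕ × ℕ)) (e : ℕ × ℕ → ℕ × ℕ)
    (he : ∀ x ∈ P, ∀ y ∈ P, clt d x y ↔ clt d' (e x) (e y)) (hi : Set.InjOn e P) :
    L d' (P.image e) = L d P := by
  classical
  apply le_antisymm
  · rw [L_le_iff]
    intro X hX hc
    obtain ⟨Y, hY, rfl⟩ := Finset.subset_image_iff.1 hX
    rw [Finset.card_image_of_injOn (hi.mono hY)]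
    refine le_L hY fun x hx y hy hne => ?_
    rw [he x (hY hx) y (hY hy), he y (hY hy) x (hY hx)]
    exact hc _ (Finset.mem_image_of_mem _ hx) _ (Finset.mem_image_of_mem _ hy)
      fun h => hne (hi (hY hx) (hY hy) h)
  · rw [L_le_iff]
    intro X hX hc
    rw [← Finset.card_image_of_injOn (hi.mono hX)]
    refine le_L (Finset.image_subset_image hX) ?_
    intro x hx y hy hne
    obtain ⟨x', hx', rfl⟩ := Finset.mem_image.1 hx
    obtain ⟨y', hy', rfl⟩ := Finset.mem_image.1 hy
    rw [← he _ (hX hx') _ (hX hy'), ← he _ (hX hy') _ (hX hx')]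
    exact hc _ hx' _ hy' fun h => hne (by rw [h])

theorem exists_enum (A : Finset ℕ) : ∃ f : ℕ → ℕ,
    (∀ i < A.card, ∀ j < A.card, (i < j ↔ f i < f j)) ∧ (Finset.range A.card).image f = A := by
  classical
  let o := A.orderEmbOfFin (k := A.card) rfl
  refine ⟨fun i => if h : i < A.card then o ⟨i, h⟩ else 0, ?_, ?_⟩
  · intro i hi j hj
    simp only [hi, hj, dif_pos]
    rw [o.lt_iff_lt]; simp
  · ext x
    simp only [Finset.mem_image, Finset.mem_range]
    constructor
    · rintro ⟨i, hi, rfl⟩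
      simp only [hi, dif_pos]; exact A.orderEmbOfFin_mem rfl _
    · intro hx
      have : x ∈ Set.range o := by rw [Finset.range_orderEmbOfFin]; exact hx
      obtain ⟨i, rfl⟩ := this
      exact ⟨i, i.2, by simp⟩

theorem exists_enum_d (d : Bool) (A : Finset ℕ) : ∃ f : ℕ → ℕ,
    (∀ i < A.card, ∀ j < A.card, (i < j ↔ rel d (f i) (f j))) ∧
      (Finset.range A.card).image f = A := by
  obtain ⟨f, h1, h2⟩ := exists_enum A
  cases d
  · refine ⟨fun i => f (A.card - 1 - i), ?_, ?_⟩
    · intro i hi j hj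
      simp only [rel, Bool.false_eq_true, if_false]
      rw [← h1 _ (by omega) _ (by omega)]; omega
    · conv_rhs => rw [← h2]
      ext x
      simp only [Finset.mem_image, Finset.mem_range]
      constructor
      · rintro ⟨i, hi, rfl⟩; exact ⟨_, by omega, rfl⟩
      · rintro ⟨i, hi, rfl⟩; exact ⟨A.card - 1 - i, by omega, by congr 1; omega⟩
  · exact ⟨f, by simpa [rel] using h1, h2⟩

/-- The law of the longest chain of a random subset of `A × B` only depends on the cardinalities. -/
theorem Ex_L_std (p : ℝ) (d : Bool) (A B : Finset ℕ) (f : ℕ → ℝ) :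
    Ex (fun _ => p) (A ×ˢ B) (fun T => f (L d T))
      = Ex (fun _ => p) (Finset.range A.card ×ˢ Finset.range B.card) (fun T => f (L true T)) := by
  classical
  obtain ⟨f1, h1, h2⟩ := exists_enum_d d A
  obtain ⟨g1, h3, h4⟩ := exists_enum B
  set e : ℕ × ℕ → ℕ × ℕ := fun x => (f1 x.1, g1 x.2) with he
  have hS : A ×ˢ B = (Finset.range A.card ×ˢ Finset.range B.card).image e := by
    conv_lhs => rw [← h2, ← h4]
    ext ⟨x, y⟩
    simp only [Finset.mem_product, Finset.mem_image, Finset.mem_range, he, Prod.mk.injEq,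
      Prod.exists]
    constructor
    · rintro ⟨⟨a, ha, rfl⟩, ⟨b, hb, rfl⟩⟩; exact ⟨a, b, ⟨ha, hb⟩, rfl, rfl⟩
    · rintro ⟨a, b, ⟨ha, hb⟩, rfl, rfl⟩; exact ⟨⟨a, ha, rfl⟩, ⟨b, hb, rfl⟩⟩
  have hc : ∀ x ∈ Finset.range A.card ×ˢ Finset.range B.card,
      ∀ y ∈ Finset.range A.card ×ˢ Finset.range B.card, clt true x y ↔ clt d (e x) (e y) := by
    intro x hx y hy
    simp only [Finset.mem_product, Finset.mem_range] at hx hy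
    simp only [clt, he]
    rw [← h1 _ hx.1 _ hy.1, ← h3 _ hx.2 _ hy.2]
    simp [rel]
  have hi : Set.InjOn e ↑(Finset.range A.card ×ˢ Finset.range B.card) := by
    intro x hx y hy hxy
    simp only [Finset.coe_product, Set.mem_prod, Finset.mem_coe, Finset.mem_range] at hx hy
    simp only [he, Prod.mk.injEq] at hxy
    have a1 := h1 _ hx.1 _ hy.1
    have a2 := h1 _ hy.1 _ hx.1
    have a3 := h3 _ hx.2 _ hy.2
    have a4 := h3 _ hy.2 _ hx.2
    rw [hxy.1] at a1 a2
    rw [hxy.2] at a3 a4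
    have b1 := rel_irrefl d (f1 y.1)
    ext
    · have := mt a1.1 b1; have := mt a2.1 b1; omega
    · omega
  rw [hS, Ex_image _ _ e hi]
  refine Ex_congr _ _ fun T hT => ?_
  rw [L_image true d T e (fun x hx y hy => hc x (hT hx) y (hT hy)) (hi.mono hT)]

theorem Pr_L_std (p : ℝ) (d : Bool) (A B : Finset ℕ) (E : ℕ → Prop) :
    Pr (fun _ => p) (A ×ˢ B) (fun T => E (L d T))
      = Pr (fun _ => p) (Finset.range A.card ×ˢ Finset.range B.card) (fun T => E (L true T)) := by
  classical
  have := Ex_L_std p d A B (fun k => if E k then 1 else 0)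
  unfold Pr
  convert this

end ML

open Filter

namespace ML

/-- outgoing carrier bit -/
def cu (u v w : Bool) : Bool := if u = v then !u && w else u
/-- outgoing row bit -/
def cv (u v w : Bool) : Bool := if u = v then !u && w else v

/-- carrier before column `j` -/
def car (V R : ℕ → Bool) : ℕ → Bool
  | 0 => R 0
  | j + 1 => cu (car V R j) (V j) (R (j + 1))

/-- outgoing row -/
def outf (V R : ℕ → Bool) (j : ℕ) : Bool := cv (car V R j) (V j) (R (j + 1))

theorem car_congr {V V' R R' : ℕ → Bool} (j : ℕ) (hV : ∀ k < j, V k = V' k)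
    (hR : ∀ k ≤ j, R k = R' k) : car V R j = car V' R' j := by
  induction j with
  | zero => exact hR 0 le_rfl
  | succ j ih =>
    simp only [car]
    rw [ih (fun k hk => hV k (by omega)) (fun k hk => hR k (by omega)), hV j (by omega),
      hR (j + 1) le_rfl]

theorem outf_congr {V V' R R' : ℕ → Bool} (j : ℕ) (hV : ∀ k ≤ j, V k = V' k)
    (hR : ∀ k ≤ j + 1, R k = R' k) : outf V R j = outf V' R' j := by
  simp only [outf]
  rw [car_congr j (fun k hk => hV k (by omega)) (fun k hk => hR k (by omega)), hV j le_rfl,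
    hR (j + 1) le_rfl]

/-- indicator of a finset as a Boolean function -/
def bf (V : Finset ℕ) : ℕ → Bool := fun j => decide (j ∈ V)

/-- row probabilities -/
noncomputable def PR (a p : ℝ) (j : ℕ) : ℝ := if j = 0 then a else p

theorem burke_row (a b p : ℝ) (hab : a * b = p * (1 - a) * (1 - b)) (c : ℕ)
    (F : Finset ℕ → Bool → ℝ) :
    Ex (fun _ => b) (Finset.range c) (fun V => Ex (PR a p) (Finset.range (c + 1)) (fun R =>
      F ((Finset.range c).filter (fun j => outf (bf V) (bf R) j = true)) (car (bf V) (bf R) c)))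
    = Ex (fun _ => b) (Finset.range c) (fun V => a * F V true + (1 - a) * F V false) := by
  induction c generalizing F with
  | zero =>
    simp only [Finset.range_zero, Ex_empty, zero_add, Finset.range_one, Finset.filter_empty, car]
    rw [show ({0} : Finset ℕ) = insert 0 ∅ from rfl, Ex_insert _ _ _ (by simp), Ex_empty, Ex_empty]
    simp [bf, PR]
  | succ c ih =>
    have key : ∀ (x y : Bool),
      Ex (fun _ => b) (Finset.range c) (fun V => Ex (PR a p) (Finset.range (c + 1)) (fun R =>
        F ((Finset.range (c+1)).filter (fun j => outf (bf (if x then insert c V else V))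
          (bf (if y then insert (c+1) R else R)) j = true))
          (car (bf (if x then insert c V else V)) (bf (if y then insert (c+1) R else R)) (c+1))))
      = Ex (fun _ => b) (Finset.range c) (fun V =>
        a * F (if cv true x y then insert c V else V) (cu true x y)
        + (1 - a) * F (if cv false x y then insert c V else V) (cu false x y)) := by
      intro x y
      rw [← ih (fun V u => F (if cv u x y then insert c V else V) (cu u x y))]
      refine Ex_congr _ _ fun V hV => Ex_congr _ _ fun R hR => ?_
      have hcV : c ∉ V := fun h => by simpa using hV h
      have hcR : c + 1 ∉ R := fun h => by simpa using hR h
      have e1 : ∀ k < c, bf (if x then insert c V else V) k = bf V k := by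
        intro k hk
        cases x <;> simp [bf]
        omega
      have e2 : ∀ k ≤ c, bf (if y then insert (c+1) R else R) k = bf R k := by
        intro k hk
        cases y <;> simp [bf]
        omega
      have e3 : bf (if x then insert c V else V) c = x := by cases x <;> simp [bf, hcV]
      have e4 : bf (if y then insert (c+1) R else R) (c+1) = y := by cases y <;> simp [bf, hcR]
      have e5 := car_congr c e1 e2
      congr 1
      · rw [Finset.range_add_one, Finset.filter_insert]
        have e6 : (Finset.range c).filter (fun j => outf (bf (if x then insert c V else V))
            (bf (if y then insert (c+1) R else R)) j = true)
            = (Finset.range c).filter (fun j => outf (bf V) (bf R) j = true) := by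
          refine Finset.filter_congr fun j hj => ?_
          rw [Finset.mem_range] at hj
          rw [outf_congr j (fun k hk => e1 k (by omega)) (fun k hk => e2 k (by omega))]
        rw [e6]
        simp only [outf, e5, e3, e4]
      · simp only [car, e5, e3, e4]
    have hc : c ∉ Finset.range c := by simp
    have hc1 : c + 1 ∉ Finset.range (c + 1) := by simp
    rw [Finset.range_add_one (n := c + 1), Finset.range_add_one (n := c)]
    rw [Ex_insert _ _ _ hc, Ex_insert _ _ _ hc]
    rw [← Finset.range_add_one (n := c)]
    simp only [Ex_insert (PR a p) _ _ hc1]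
    rw [Ex_add, Ex_add, Ex_mul, Ex_mul, Ex_mul, Ex_mul]
    have k1 := key true true
    have k2 := key true false
    have k3 := key false true
    have k4 := key false false
    simp only [if_true, Bool.false_eq_true, if_false] at k1 k2 k3 k4
    rw [k1, k2, k3, k4]
    simp only [cu, cv, Ex_add, Ex_mul]
    simp [PR]
    linear_combination (Ex (fun x => b) (Finset.range c) (fun T => F T false) -
      Ex (fun x => b) (Finset.range c) (fun T => F (insert c T) true)) * hab

/-- rows of the stationary process -/
def Vf (T : Finset (ℕ × ℕ)) : ℕ → ℕ → Bool
  | 0 => fun j => decide ((0, j + 1) ∈ T)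
  | i + 1 => outf (Vf T i) (fun j => decide ((i + 1, j) ∈ T))

/-- stationary last passage value -/
def G (T : Finset (ℕ × ℕ)) (i j : ℕ) : ℕ :=
  ((Finset.range i).filter (fun k => (k + 1, 0) ∈ T)).card
    + ((Finset.range j).filter (fun k => Vf T i k = true)).card

/-- cell probabilities in the augmented grid -/
noncomputable def Ph (a b p : ℝ) (x : ℕ × ℕ) : ℝ := if x.1 = 0 then b else if x.2 = 0 then a else p

theorem Vf_congr {T T' : Finset (ℕ × ℕ)} (i c : ℕ)
    (h : ∀ x ∈ Finset.range (i + 1) ×ˢ Finset.range (c + 1), (x ∈ T ↔ x ∈ T')) :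
    ∀ j < c, Vf T i j = Vf T' i j := by
  induction i with
  | zero =>
    intro j hj
    simp only [Vf]
    rw [decide_eq_decide]
    exact h _ (by simp; omega)
  | succ i ih =>
    intro j hj
    simp only [Vf]
    apply outf_congr
    · intro k hk
      refine ih (fun x hx => h x ?_) k (by omega)
      simp only [Finset.mem_product, Finset.mem_range] at hx ⊢; omega
    · intro k hk
      rw [decide_eq_decide]
      exact h _ (by simp; omega)

theorem burke_law (a b p : ℝ) (hab : a * b = p * (1 - a) * (1 - b)) (i c : ℕ)
    (F : Finset ℕ → ℝ) :
    Ex (Ph a b p) (Finset.range (i + 1) ×ˢ Finset.range (c + 1))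
      (fun T => F ((Finset.range c).filter (fun k => Vf T i k = true)))
    = Ex (fun _ => b) (Finset.range c) F := by
  induction i generalizing F with
  | zero =>
    have hsub : (Finset.range c).image (fun j => ((0:ℕ), j + 1)) ⊆
        Finset.range (0 + 1) ×ˢ Finset.range (c + 1) := by
      intro x hx
      obtain ⟨j, hj, rfl⟩ := Finset.mem_image.1 hx
      simp at hj ⊢; omega
    have hinj : Function.Injective (fun j : ℕ => ((0:ℕ), j + 1)) := by
      intro x y h; simpa using h
    rw [Ex_congr (g := fun T => F ((Finset.range c).filter (fun k => Vf
        (T ∩ (Finset.range c).image (fun j => ((0:ℕ), j + 1))) 0 k = true))),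
      Ex_inter _ _ _ hsub (fun T => F ((Finset.range c).filter (fun k => Vf T 0 k = true))),
      Ex_image _ _ _ hinj.injOn]
    · have : Ex (Ph a b p ∘ fun j => ((0:ℕ), j + 1)) (Finset.range c) F
          = Ex (fun _ => b) (Finset.range c) F := Ex_congrP _ _ fun x _ => by simp [Ph]
      rw [← this]
      refine Ex_congr _ _ fun T hT => ?_
      congr 1
      ext k
      simp only [Vf, Finset.mem_filter, Finset.mem_range, Finset.mem_image, decide_eq_true_eq,
        Prod.mk.injEq, true_and, add_left_inj, exists_eq_right]
      constructor
      · exact fun h => h.2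
      · exact fun h => ⟨by simpa using hT h, h⟩
    · intro T _
      congr 1
      ext k
      simp [Vf]
      intro _ h
      omega
  | succ i ih =>
    have hS : Finset.range (i + 1 + 1) ×ˢ Finset.range (c + 1) =
        (Finset.range (i + 1) ×ˢ Finset.range (c + 1)) ∪
          (Finset.range (c + 1)).image (fun j => (i + 1, j)) := by
      ext ⟨x, y⟩
      simp only [Finset.mem_product, Finset.mem_range, Finset.mem_union, Finset.mem_image,
        Prod.mk.injEq]
      constructor
      · rintro ⟨h1, h2⟩
        by_cases h : x < i + 1
        · exact Or.inl ⟨h, h2⟩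
        · exact Or.inr ⟨y, h2, by omega, rfl⟩
      · rintro (h | ⟨z, h1, h2, h3⟩) <;> omega
    have hd : Disjoint (Finset.range (i + 1) ×ˢ Finset.range (c + 1))
          ((Finset.range (c + 1)).image (fun j => (i + 1, j))) := by
      rw [Finset.disjoint_left]
      rintro ⟨x, y⟩ h1 h2
      simp only [Finset.mem_product, Finset.mem_range, Finset.mem_image, Prod.mk.injEq] at h1 h2
      obtain ⟨z, h3, h4, h5⟩ := h2
      omega
    have hinj : Function.Injective (fun j : ℕ => (i + 1, j)) := by
      intro x y h; simpa using h
    rw [hS, Ex_union _ _ _ hd]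
    have h1 : ∀ T₁ ⊆ Finset.range (i + 1) ×ˢ Finset.range (c + 1),
        Ex (Ph a b p) ((Finset.range (c + 1)).image (fun j => (i + 1, j))) (fun T₂ =>
          F ((Finset.range c).filter (fun k => Vf (T₁ ∪ T₂) (i + 1) k = true)))
        = Ex (PR a p) (Finset.range (c + 1)) (fun R => F ((Finset.range c).filter (fun k =>
          outf (bf ((Finset.range c).filter (fun k => Vf T₁ i k = true))) (bf R) k = true))) := by
      intro T₁ hT₁
      rw [Ex_image _ _ _ hinj.injOn]
      rw [Ex_congrP (Q := PR a p) _ _ (fun x _ => by simp [Ph, PR])]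
      refine Ex_congr _ _ fun R hR => ?_
      congr 1
      refine Finset.filter_congr fun k hk => ?_
      rw [Finset.mem_range] at hk
      have : Vf (T₁ ∪ R.image (fun j => (i + 1, j))) (i + 1) k =
          outf (bf ((Finset.range c).filter (fun k => Vf T₁ i k = true))) (bf R) k := by
        simp only [Vf]
        apply outf_congr
        · intro l hl
          have h2 : Vf (T₁ ∪ R.image (fun j => (i + 1, j))) i l = Vf T₁ i l := by
            apply Vf_congr i c _ l (by omega)
            rintro ⟨x, y⟩ hx
            simp only [Finset.mem_product, Finset.mem_range] at hx
            simp only [Finset.mem_union, Finset.mem_image, Prod.mk.injEq]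
            constructor
            · rintro (h | ⟨z, _, h, _⟩)
              · exact h
              · omega
            · exact Or.inl
          rw [h2]
          have : l < c := by omega
          simp [bf, this]
        · intro l hl
          simp only [bf, decide_eq_decide, Finset.mem_union, Finset.mem_image, Prod.mk.injEq,
            true_and, exists_eq_right]
          constructor
          · rintro (h | h)
            · have := hT₁ h; simp at this
            · exact h
          · exact Or.inr
      rw [this]
    rw [Ex_congr _ _ h1]
    rw [ih (fun V => Ex (PR a p) (Finset.range (c + 1)) (fun R => F ((Finset.range c).filter
      (fun k => outf (bf V) (bf R) k = true))))]
    rw [burke_row a b p hab c (fun V _ => F V)]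
    refine Ex_congr _ _ fun V _ => by ring

end ML

open Filter

namespace ML

theorem Ex_pull {α β : Type*} [DecidableEq α] [DecidableEq β] (P : β → ℝ) (S : Finset β)
    (A : Finset α) (e : α → β) (hi : Function.Injective e) (hs : ∀ x ∈ A, e x ∈ S)
    (F : Finset α → ℝ) :
    Ex P S (fun T => F (A.filter (fun x => e x ∈ T))) = Ex (P ∘ e) A F := by
  have hsub : A.image e ⊆ S := by
    intro x hx; obtain ⟨y, hy, rfl⟩ := Finset.mem_image.1 hx; exact hs y hy
  rw [Ex_congr (g := fun T => F (A.filter (fun x => e x ∈ T ∩ A.image e))),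
    Ex_inter P S _ hsub (fun T => F (A.filter (fun x => e x ∈ T))), Ex_image P A e hi.injOn]
  · refine Ex_congr _ _ fun T hT => ?_
    congr 1
    ext x
    simp only [Finset.mem_filter, Finset.mem_image, hi.eq_iff, exists_eq_right]
    exact ⟨fun h => h.2, fun h => ⟨hT h, h⟩⟩
  · intro T _
    congr 1
    refine Finset.filter_congr fun x hx => ?_
    simp only [Finset.mem_inter, Finset.mem_image, hi.eq_iff, exists_eq_right, hx, and_true]

theorem Pr_pull {α β : Type*} [DecidableEq α] [DecidableEq β] (P : β → ℝ) (S : Finset β)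
    (A : Finset α) (e : α → β) (hi : Function.Injective e) (hs : ∀ x ∈ A, e x ∈ S)
    (E : Finset α → Prop) :
    Pr P S (fun T => E (A.filter (fun x => e x ∈ T))) = Pr (P ∘ e) A E := by
  classical
  exact Ex_pull P S A e hi hs (fun T => if E T then 1 else 0)

theorem G_row_diff (T : Finset (ℕ × ℕ)) (i j : ℕ) :
    G T (i + 1) j = G T i j + (car (Vf T i) (fun j => decide ((i + 1, j) ∈ T)) j).toNat := by
  induction j with
  | zero =>
    simp only [G, Finset.range_zero, Finset.filter_empty, Finset.card_empty, add_zero, car]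
    rw [Finset.range_add_one, Finset.filter_insert]
    by_cases h : (i + 1, 0) ∈ T <;> simp [h]
  | succ j ih =>
    have h1 : G T (i + 1) (j + 1) = G T (i + 1) j + (Vf T (i + 1) j).toNat := by
      simp only [G]
      rw [Finset.range_add_one (n := j), Finset.filter_insert]
      by_cases h : Vf T (i + 1) j = true
      · simp [h]; omega
      · simp [h]
    have h2 : G T i (j + 1) = G T i j + (Vf T i j).toNat := by
      simp only [G]
      rw [Finset.range_add_one (n := j), Finset.filter_insert]
      by_cases h : Vf T i j = true
      · simp [h]; omega
      · simp [h]
    rw [h1, h2, ih]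
    simp only [Vf, outf, car]
    generalize car (Vf T i) (fun j => decide ((i + 1, j) ∈ T)) j = u
    generalize Vf T i j = v
    generalize decide ((i + 1, j + 1) ∈ T) = w
    cases u <;> cases v <;> cases w <;> simp [cu, cv]

theorem G_col_diff (T : Finset (ℕ × ℕ)) (i j : ℕ) :
    G T i (j + 1) = G T i j + (Vf T i j).toNat := by
  simp only [G]
  rw [Finset.range_add_one (n := j), Finset.filter_insert]
  by_cases h : Vf T i j = true
  · simp [h]; omega
  · simp [h]

theorem G_mono_row (T : Finset (ℕ × ℕ)) {i i' : ℕ} (j : ℕ) (h : i ≤ i') : G T i j ≤ G T i' j := by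
  induction h with
  | refl => exact le_rfl
  | step h ih => exact ih.trans (by rw [Nat.succ_eq_add_one, G_row_diff]; omega)

theorem G_mono_col (T : Finset (ℕ × ℕ)) (i : ℕ) {j j' : ℕ} (h : j ≤ j') : G T i j ≤ G T i j' := by
  induction h with
  | refl => exact le_rfl
  | step h ih => exact ih.trans (by rw [Nat.succ_eq_add_one, G_col_diff]; omega)

theorem G_mono (T : Finset (ℕ × ℕ)) {i i' j j' : ℕ} (h : i ≤ i') (h' : j ≤ j') :
    G T i j ≤ G T i' j' := (G_mono_row T j h).trans (G_mono_col T i' h')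

theorem G_step (T : Finset (ℕ × ℕ)) (i j : ℕ) (h : (i + 1, j + 1) ∈ T) :
    G T i j + 1 ≤ G T (i + 1) (j + 1) := by
  rw [G_row_diff, G_col_diff]
  simp only [car, h, decide_true]
  generalize car (Vf T i) (fun j => decide ((i + 1, j) ∈ T)) j = u
  generalize Vf T i j = v
  cases u <;> cases v <;> simp [cu]

theorem G_cases (T : Finset (ℕ × ℕ)) (i j : ℕ) :
    G T (i + 1) (j + 1) = G T (i + 1) j ∨ G T (i + 1) (j + 1) = G T i (j + 1) ∨
      ((i + 1, j + 1) ∈ T ∧ G T (i + 1) (j + 1) = G T i j + 1) := by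
  rw [G_row_diff, G_row_diff, G_col_diff]
  simp only [car]
  generalize car (Vf T i) (fun j => decide ((i + 1, j) ∈ T)) j = u
  generalize Vf T i j = v
  by_cases h : (i + 1, j + 1) ∈ T <;> simp only [h, decide_true, decide_false] <;>
    cases u <;> cases v <;> simp [cu]

/-- interior coins -/
def core (r c : ℕ) (T : Finset (ℕ × ℕ)) : Finset (ℕ × ℕ) :=
  (Finset.range r ×ˢ Finset.range c).filter (fun x => (x.1 + 1, x.2 + 1) ∈ T)

theorem exists_max_chain {X : Finset (ℕ × ℕ)} (hX : IsCh true X) (hne : X.Nonempty) :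
    ∃ x ∈ X, ∀ y ∈ X, y ≠ x → y.1 < x.1 ∧ y.2 < x.2 := by
  obtain ⟨x, hx, hm⟩ := Finset.exists_max_image X (fun x => x.2) hne
  refine ⟨x, hx, fun y hy hne => ?_⟩
  rcases hX y hy x hx hne with h | h
  · exact ⟨by simpa [rel] using h.2, h.1⟩
  · have := hm y hy; have := h.1; omega

theorem chain_le_G (T : Finset (ℕ × ℕ)) (k : ℕ) (X : Finset (ℕ × ℕ)) (hk : X.card = k)
    (hX : IsCh true X)
    (hT : ∀ x ∈ X, (x.1 + 1, x.2 + 1) ∈ T) (i j : ℕ) (hi : ∀ x ∈ X, x.1 < i ∧ x.2 < j) :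
    k ≤ G T i j := by
  induction k generalizing X i j with
  | zero => omega
  | succ k ih =>
    have hne : X.Nonempty := by rw [← Finset.card_pos]; omega
    obtain ⟨x, hx, hm⟩ := exists_max_chain hX hne
    have h1 := ih (X.erase x) (by rw [Finset.card_erase_of_mem hx]; omega)
      (hX.subset (Finset.erase_subset _ _)) (fun y hy => hT y (Finset.mem_of_mem_erase hy)) x.1 x.2
      (fun y hy => hm y (Finset.mem_of_mem_erase hy) (Finset.ne_of_mem_erase hy))
    have h2 := G_step T x.1 x.2 (hT x hx)
    have h3 := hi x hx
    have h4 := G_mono T (i := x.1 + 1) (i' := i) (j := x.2 + 1) (j' := j) (by omega) (by omega)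
    omega

theorem L_core_le (T : Finset (ℕ × ℕ)) (r c : ℕ) : L true (core r c T) ≤ G T r c := by
  rw [L_le_iff]
  intro X hX hc
  refine chain_le_G T _ X rfl hc (fun x hx => ?_) r c (fun x hx => ?_)
  · have := hX hx; simp only [core, Finset.mem_filter] at this; exact this.2
  · have := hX hx
    simp only [core, Finset.mem_filter, Finset.mem_product, Finset.mem_range] at this
    exact this.1

theorem insert_chain {X : Finset (ℕ × ℕ)} (hX : IsCh true X) (x : ℕ × ℕ)
    (h : ∀ y ∈ X, y.1 < x.1 ∧ y.2 < x.2) : IsCh true (insert x X) := by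
  intro y hy z hz hne
  rw [Finset.mem_insert] at hy hz
  rcases hy with rfl | hy <;> rcases hz with rfl | hz
  · exact absurd rfl hne
  · right; exact ⟨(h z hz).2, by simpa [rel] using (h z hz).1⟩
  · left; exact ⟨(h y hy).2, by simpa [rel] using (h y hy).1⟩
  · exact hX y hy z hz hne

theorem exit_lemma (T : Finset (ℕ × ℕ)) (n i j : ℕ) (hn : i + j = n) :
    ∃ X, IsCh true X ∧ (∀ x ∈ X, (x.1 + 1, x.2 + 1) ∈ T ∧ x.1 < i ∧ x.2 < j) ∧
      ((∃ z ≤ i, (∀ x ∈ X, z ≤ x.1) ∧ G T i j ≤ G T z 0 + X.card) ∨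
       (∃ z ≤ j, (∀ x ∈ X, z ≤ x.2) ∧ G T i j ≤ G T 0 z + X.card)) := by
  induction n using Nat.strong_induction_on generalizing i j with
  | _ n ih =>
  rcases i with _ | i
  · refine ⟨∅, fun x hx => by simp at hx, by simp, Or.inr ⟨j, le_rfl, by simp, by simp⟩⟩
  rcases j with _ | j
  · refine ⟨∅, fun x hx => by simp at hx, by simp, Or.inl ⟨i + 1, le_rfl, by simp, by simp⟩⟩
  rcases G_cases T i j with h | h | ⟨hw, h⟩
  · obtain ⟨X, h1, h2, h3⟩ := ih (i + 1 + j) (by omega) (i + 1) j rfl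
    refine ⟨X, h1, fun x hx => ⟨(h2 x hx).1, (h2 x hx).2.1, by have := (h2 x hx).2.2; omega⟩, ?_⟩
    rcases h3 with ⟨z, a, b, c⟩ | ⟨z, a, b, c⟩
    · exact Or.inl ⟨z, by omega, b, by omega⟩
    · exact Or.inr ⟨z, by omega, b, by omega⟩
  · obtain ⟨X, h1, h2, h3⟩ := ih (i + (j + 1)) (by omega) i (j + 1) rfl
    refine ⟨X, h1, fun x hx => ⟨(h2 x hx).1, by have := (h2 x hx).2.1; omega, (h2 x hx).2.2⟩, ?_⟩
    rcases h3 with ⟨z, a, b, c⟩ | ⟨z, a, b, c⟩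
    · exact Or.inl ⟨z, by omega, b, by omega⟩
    · exact Or.inr ⟨z, by omega, b, by omega⟩
  · obtain ⟨X, h1, h2, h3⟩ := ih (i + j) (by omega) i j rfl
    have hnot : (i, j) ∉ X := fun hx => by have := (h2 _ hx).2.1; simp at this
    refine ⟨insert (i, j) X, insert_chain h1 _ fun y hy => (h2 y hy).2, ?_, ?_⟩
    · intro x hx
      rw [Finset.mem_insert] at hx
      rcases hx with rfl | hx
      · exact ⟨hw, by simp, by simp⟩
      · have := h2 x hx; exact ⟨this.1, by omega, by omega⟩
    · rw [Finset.card_insert_of_notMem hnot]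
      rcases h3 with ⟨z, a, b, c⟩ | ⟨z, a, b, c⟩
      · refine Or.inl ⟨z, by omega, ?_, by omega⟩
        intro x hx
        rw [Finset.mem_insert] at hx
        rcases hx with rfl | hx
        · exact a
        · exact b x hx
      · refine Or.inr ⟨z, by omega, ?_, by omega⟩
        intro x hx
        rw [Finset.mem_insert] at hx
        rcases hx with rfl | hx
        · exact a
        · exact b x hx

/-- the grid with boundary -/
def grid (r c : ℕ) : Finset (ℕ × ℕ) := Finset.range (r + 1) ×ˢ Finset.range (c + 1)

theorem Ph_bd {a b p : ℝ} (ha : 0 ≤ a ∧ a ≤ 1) (hb : 0 ≤ b ∧ b ≤ 1) (hp : 0 ≤ p ∧ p ≤ 1)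
    (S : Finset (ℕ × ℕ)) : ∀ x ∈ S, 0 ≤ Ph a b p x ∧ Ph a b p x ≤ 1 := by
  intro x _; unfold Ph; split_ifs <;> assumption

theorem core_law (a b p : ℝ) (r c : ℕ) (E : Finset (ℕ × ℕ) → Prop) :
    Pr (Ph a b p) (grid r c) (fun T => E (core r c T))
      = Pr (fun _ => p) (Finset.range r ×ˢ Finset.range c) E := by
  unfold core
  rw [Pr_pull (Ph a b p) (grid r c) (Finset.range r ×ˢ Finset.range c)
    (fun x => (x.1 + 1, x.2 + 1)) (by intro x y h; ext <;> simp_all) (by simp [grid])]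
  exact Ex_congrP _ _ (by simp [Ph])

theorem core_law_Ex (a b p : ℝ) (r c : ℕ) (F : Finset (ℕ × ℕ) → ℝ) :
    Ex (Ph a b p) (grid r c) (fun T => F (core r c T))
      = Ex (fun _ => p) (Finset.range r ×ˢ Finset.range c) F := by
  unfold core
  rw [Ex_pull (Ph a b p) (grid r c) (Finset.range r ×ˢ Finset.range c)
    (fun x => (x.1 + 1, x.2 + 1)) (by intro x y h; ext <;> simp_all) (by simp [grid])]
  exact Ex_congrP _ _ (by simp [Ph])

theorem G_zero_col (T : Finset (ℕ × ℕ)) (z : ℕ) :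
    G T z 0 = ((Finset.range z).filter (fun k => (k + 1, 0) ∈ T)).card := by simp [G]

theorem G_zero_row (T : Finset (ℕ × ℕ)) (z : ℕ) :
    G T 0 z = ((Finset.range z).filter (fun k => (0, k + 1) ∈ T)).card := by simp [G, Vf]

theorem src_sq (a b p : ℝ) (r c z : ℕ) (hz : z ≤ r) :
    Ex (Ph a b p) (grid r c) (fun T => ((G T z 0 : ℝ) - a * z) ^ 2) = z * (a * (1 - a)) := by
  simp only [G_zero_col]
  rw [Ex_pull (Ph a b p) (grid r c) (Finset.range z) (fun k => (k + 1, 0))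
    (by intro x y h; simpa using h) (by intro x hx; simp [grid] at *; omega)
    (fun V => ((V.card : ℝ) - a * z) ^ 2)]
  rw [Ex_congrP (Q := fun _ => a) _ _ (by simp [Ph])]
  have := Ex_card_sq (fun _ => a) (Finset.range z)
  simp only [Finset.sum_const, Finset.card_range, nsmul_eq_mul] at this
  rw [← this]; simp only [mul_comm]

theorem src_sq' (a b p : ℝ) (r c z : ℕ) (hz : z ≤ c) :
    Ex (Ph a b p) (grid r c) (fun T => ((G T 0 z : ℝ) - b * z) ^ 2) = z * (b * (1 - b)) := by
  simp only [G_zero_row]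
  rw [Ex_pull (Ph a b p) (grid r c) (Finset.range z) (fun k => (0, k + 1))
    (by intro x y h; simpa using h) (by intro x hx; simp [grid] at *; omega)
    (fun V => ((V.card : ℝ) - b * z) ^ 2)]
  rw [Ex_congrP (Q := fun _ => b) _ _ (by simp [Ph])]
  have := Ex_card_sq (fun _ => b) (Finset.range z)
  simp only [Finset.sum_const, Finset.card_range, nsmul_eq_mul] at this
  rw [← this]; simp only [mul_comm]

theorem G_sq {a b p : ℝ} (ha : 0 ≤ a ∧ a ≤ 1) (hb : 0 ≤ b ∧ b ≤ 1) (hp : 0 ≤ p ∧ p ≤ 1)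
    (hab : a * b = p * (1 - a) * (1 - b)) (r c : ℕ) :
    Ex (Ph a b p) (grid r c) (fun T => ((G T r c : ℝ) - (a * r + b * c)) ^ 2)
      ≤ 2 * (a * r + b * c) := by
  have h1 := src_sq a b p r c r le_rfl
  have h2 := burke_law a b p hab r c (fun V => ((V.card : ℝ) - b * c) ^ 2)
  have h3 := Ex_card_sq (fun _ => b) (Finset.range c)
  simp only [Finset.sum_const, Finset.card_range, nsmul_eq_mul] at h3
  simp only [mul_comm (c:ℝ) b] at h3
  rw [h3] at h2
  have h4 : Ex (Ph a b p) (grid r c) (fun T => ((G T r c : ℝ) - (a * r + b * c)) ^ 2)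
    ≤ Ex (Ph a b p) (grid r c) (fun T => 2 * ((G T r 0 : ℝ) - a * r) ^ 2 + 2 *
      ((((Finset.range c).filter (fun k => Vf T r k = true)).card : ℝ) - b * c) ^ 2) := by
    refine Ex_mono _ _ (Ph_bd ha hb hp _) fun T _ => ?_
    have : (G T r c : ℝ) = (G T r 0 : ℝ) +
        (((Finset.range c).filter (fun k => Vf T r k = true)).card : ℝ) := by
      rw [G_zero_col]; simp [G]
    rw [this]
    nlinarith [sq_nonneg (((G T r 0 : ℝ) - a * r) -
      ((((Finset.range c).filter (fun k => Vf T r k = true)).card : ℝ) - b * c))]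
  rw [Ex_add, Ex_mul, Ex_mul, h1] at h4
  have h5 : Ex (Ph a b p) (grid r c) (fun T =>
      ((((Finset.range c).filter (fun k => Vf T r k = true)).card : ℝ) - b * c) ^ 2)
      = b * (1 - b) * c := by rw [← h2.trans (mul_comm _ _)]; rfl
  rw [h5] at h4
  have i1 : a * (1 - a) ≤ a := by nlinarith [ha.1]
  have i2 : b * (1 - b) ≤ b := by nlinarith [hb.1]
  have hr : (0:ℝ) ≤ r := by positivity
  have hc : (0:ℝ) ≤ c := by positivity
  nlinarith [mul_le_mul_of_nonneg_left i1 hr, mul_le_mul_of_nonneg_right i2 hc]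

theorem G_mean {a b p : ℝ} (hab : a * b = p * (1 - a) * (1 - b)) (r c : ℕ) :
    Ex (Ph a b p) (grid r c) (fun T => (G T r c : ℝ)) = a * r + b * c := by
  have h2 := burke_law a b p hab r c (fun V => ((V.card : ℝ) - b * c))
  have h3 := Ex_card (fun _ => b) (Finset.range c)
  simp only [Finset.sum_const, Finset.card_range, nsmul_eq_mul] at h3
  simp only [mul_comm (c:ℝ) b] at h3
  rw [h3] at h2
  have h1 : Ex (Ph a b p) (grid r c) (fun T => ((G T r 0 : ℝ) - a * r)) = 0 := by
    simp only [G_zero_col]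
    rw [Ex_pull (Ph a b p) (grid r c) (Finset.range r) (fun k => (k + 1, 0))
      (by intro x y h; simpa using h) (by intro x hx; simp [grid] at *; omega)
      (fun V => ((V.card : ℝ) - a * r))]
    rw [Ex_congrP (Q := fun _ => a) _ _ (by simp [Ph])]
    have := Ex_card (fun _ => a) (Finset.range r)
    simp only [Finset.sum_const, Finset.card_range, nsmul_eq_mul] at this
    rw [← this]; simp only [mul_comm]
  have h4 : Ex (Ph a b p) (grid r c) (fun T => (G T r c : ℝ))
    = Ex (Ph a b p) (grid r c) (fun T => ((G T r 0 : ℝ) - a * r) + ((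
      (((Finset.range c).filter (fun k => Vf T r k = true)).card : ℝ) - b * c) +
      (a * r + b * c))) := by
    refine Ex_congr _ _ fun T _ => ?_
    have : (G T r c : ℝ) = (G T r 0 : ℝ) +
        (((Finset.range c).filter (fun k => Vf T r k = true)).card : ℝ) := by
      rw [G_zero_col]; simp [G]
    rw [this]; ring
  rw [h4, Ex_add, Ex_add, h1, Ex_const]
  have h5 : Ex (Ph a b p) (grid r c) (fun T =>
      ((((Finset.range c).filter (fun k => Vf T r k = true)).card : ℝ) - b * c)) = 0 := h2
  rw [h5]; ring

end ML

open Filter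

namespace ML

/-- dual density -/
noncomputable def bOf (a p : ℝ) : ℝ := p * (1 - a) / (a + p * (1 - a))

theorem bOf_spec {a p : ℝ} (ha : 0 < a) (ha1 : a < 1) (hp : 0 < p) (hp1 : p ≤ 1) :
    a * bOf a p = p * (1 - a) * (1 - bOf a p) ∧ 0 ≤ bOf a p ∧ bOf a p ≤ 1 ∧ bOf a p ≤ p / a ∧
      p / a * (1 - a - p / a) ≤ bOf a p := by
  have h1 : 0 < p * (1 - a) := mul_pos hp (by linarith)
  have h2 : 0 < a + p * (1 - a) := by linarith
  unfold bOf
  refine ⟨by field_simp; ring, by positivity, by rw [div_le_one h2]; linarith, ?_, ?_⟩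
  · rw [div_le_div_iff₀ h2 ha]; nlinarith [mul_pos hp ha, mul_pos hp h1]
  · rw [le_div_iff₀ h2]
    have e : p / a * (1 - a - p / a) * (a + p * (1 - a)) =
        p * (1 - a) - p / a * (p * a * (2 - a) + p / a * (p * (1-a))) := by
      field_simp; ring
    rw [e]
    have : 0 ≤ p / a * (p * a * (2 - a) + p / a * (p * (1-a))) := by
      have : 0 < 2 - a := by linarith
      positivity
    linarith

theorem up_prob {p a : ℝ} (ha : 0 < a) (ha1 : a < 1) (hp : 0 < p) (hp1 : p ≤ 1) (r c : ℕ)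
    (t : ℝ) (ht : 0 < t) :
    Pr (fun _ => p) (Finset.range r ×ˢ Finset.range c)
      (fun T => a * r + p / a * c + t ≤ (L true T : ℝ)) ≤ 2 * (a * r + p / a * c) / t ^ 2 := by
  obtain ⟨h1, h2, h3, h4, -⟩ := bOf_spec ha ha1 hp hp1
  have hc : (0:ℝ) ≤ c := by positivity
  have hP := Ph_bd ⟨ha.le, ha1.le⟩ ⟨h2, h3⟩ ⟨hp.le, hp1⟩ (grid r c)
  rw [← core_law a (bOf a p) p r c]
  refine le_trans (Pr_mono (F := fun T => t ≤ |(G T r c : ℝ) - (a * r + bOf a p * c)|) hP ?_)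
    (le_trans (Pr_cheb hP _ _ _ (G_sq ⟨ha.le, ha1.le⟩ ⟨h2, h3⟩ ⟨hp.le, hp1⟩ h1 r c) t ht) ?_)
  · intro T _ h
    have h5 : (L true (core r c T) : ℝ) ≤ G T r c := by exact_mod_cast L_core_le T r c
    refine le_trans ?_ (le_abs_self _)
    have := mul_le_mul_of_nonneg_right h4 hc
    linarith
  · gcongr

theorem up_mean {p a : ℝ} (ha : 0 < a) (ha1 : a < 1) (hp : 0 < p) (hp1 : p ≤ 1) (r c : ℕ) :
    Ex (fun _ => p) (Finset.range r ×ˢ Finset.range c)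
      (fun T => (L true T : ℝ)) ≤ a * r + p / a * c := by
  obtain ⟨h1, h2, h3, h4, -⟩ := bOf_spec ha ha1 hp hp1
  have hP := Ph_bd ⟨ha.le, ha1.le⟩ ⟨h2, h3⟩ ⟨hp.le, hp1⟩ (grid r c)
  rw [← core_law_Ex a (bOf a p) p r c]
  refine le_trans (Ex_mono _ _ hP (g := fun T => (G T r c : ℝ)) fun T _ => ?_) ?_
  · exact_mod_cast L_core_le T r c
  · rw [G_mean h1]; gcongr

theorem up_prob_AB {p a : ℝ} (ha : 0 < a) (ha1 : a < 1) (hp : 0 < p) (hp1 : p ≤ 1) (d : Bool)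
    (A B : Finset ℕ) (t : ℝ) (ht : 0 < t) :
    Pr (fun _ => p) (A ×ˢ B)
      (fun T => a * A.card + p / a * B.card + t ≤ (L d T : ℝ))
        ≤ 2 * (a * A.card + p / a * B.card) / t ^ 2 := by
  rw [Pr_L_std p d A B (fun k => a * A.card + p / a * B.card + t ≤ (k : ℝ))]
  exact up_prob ha ha1 hp hp1 _ _ t ht

theorem disc_ivt (f : ℕ → ℕ) (N z : ℕ) (hN : 0 < N) (h0 : f 0 ≤ z) (h1 : z ≤ f N) :
    ∃ k < N, f k ≤ z ∧ z ≤ f (k + 1) := by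
  induction N with
  | zero => omega
  | succ N ih =>
    by_cases h : f N ≤ z
    · exact ⟨N, by omega, h, h1⟩
    · rcases Nat.eq_zero_or_pos N with rfl | hN'
      · omega
      · obtain ⟨k, hk, h2⟩ := ih hN' (by omega)
        exact ⟨k, by omega, h2⟩

/-- arithmetic of one branch of the exit argument -/
theorem branch (r N : ℕ) (hN : 0 < N) (α s ζ δ : ℝ) (hζ : 0 < ζ) (hζ1 : ζ ≤ 1)
    (hδ : δ = ζ ^ 2 / 64) (hs : 1 ≤ s) (hα0 : 0 ≤ α) (hα : α ≤ δ) (hαs : α * r = s)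
    (hNδ : 1 ≤ δ * N) (S M : ℕ → ℝ) (hS : Monotone S) (hM : Antitone M)
    (h1 : ∀ k ≤ N, S (k * r / N) ≤ α * (k * r / N : ℕ) + δ * s)
    (h2 : ∀ k ≤ N, M (k * r / N) ≤ (1 + ζ / 2) * α * (r - (k * r / N : ℕ) : ℝ)
      + s / (1 + ζ / 2) + δ * s)
    (z : ℕ) (hz : z ≤ r) : S z + M z < s * (2 - 3 * δ) ∨ S z ≤ s * (ζ + 2 * δ) := by
  obtain ⟨k, hk, h3, h4⟩ := disc_ivt (fun k => k * r / N) N z hN (by simp)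
    (by rw [Nat.mul_div_cancel_left _ hN]; exact hz)
  have hN0 : (0:ℝ) < N := by exact_mod_cast hN
  have hδ0 : 0 < δ := by rw [hδ]; positivity
  have hs0 : 0 < s := by linarith
  have a1 := (hS h4).trans (h1 (k + 1) (by omega))
  have a2 := (hM h3).trans (h2 k (by omega))
  have b1 : (((k + 1) * r / N : ℕ) : ℝ) ≤ (k + 1) * r / N := by
    have := @Nat.cast_div_le ℝ _ _ _ ((k + 1) * r) N
    push_cast at this; exact this
  have b2 : (k * r / N : ℝ) - 1 ≤ ((k * r / N : ℕ) : ℝ) := by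
    have := Nat.lt_div_mul_add (a := k * r) hN
    have h : (k * r : ℝ) < ((k * r / N : ℕ) : ℝ) * N + N := by exact_mod_cast this
    rw [tsub_le_iff_right, div_le_iff₀ hN0]; nlinarith
  set x : ℝ := k / N with hx
  have hx0 : 0 ≤ x := by positivity
  have hx1 : x ≤ 1 := by
    rw [hx, div_le_one hN0]; exact_mod_cast hk.le
  have hinv : 1 / (N:ℝ) ≤ δ := by rw [div_le_iff₀ hN0]; exact hNδ
  have c1 : α * (((k + 1) * r / N : ℕ) : ℝ) ≤ s * (x + δ) := by
    calc α * (((k + 1) * r / N : ℕ) : ℝ) ≤ α * ((k + 1) * r / N) := by gcongr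
      _ = s * (x + 1 / N) := by rw [← hαs, hx]; field_simp
      _ ≤ _ := by gcongr
  have c2 : α * ((r:ℝ) - ((k * r / N : ℕ) : ℝ)) ≤ s * (1 - x) + δ * s := by
    calc α * ((r:ℝ) - ((k * r / N : ℕ) : ℝ)) ≤ α * ((r:ℝ) - (k * r / N - 1)) := by gcongr
      _ = s * (1 - x) + α := by rw [← hαs, hx]; field_simp; ring
      _ ≤ _ := by nlinarith
  have c3 : s / (1 + ζ / 2) ≤ s * (1 - ζ / 2 + ζ ^ 2 / 4) := by
    rw [div_le_iff₀ (by linarith)]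
    have : s * (1 - ζ / 2 + ζ ^ 2 / 4) * (1 + ζ / 2) = s * (1 + ζ ^ 3 / 8) := by ring
    rw [this]
    have : 0 ≤ s * (ζ ^ 3 / 8) := by positivity
    linarith
  by_cases hxζ : x < ζ
  · right
    nlinarith
  · left
    push Not at hxζ
    have c4 : (1 + ζ / 2) * α * ((r:ℝ) - ((k * r / N : ℕ) : ℝ)) ≤
        (1 + ζ / 2) * (s * (1 - x) + δ * s) := by
      rw [mul_assoc]; gcongr
    have e : S z + M z ≤ s * (x + δ) + δ * s + ((1 + ζ / 2) * (s * (1 - x) + δ * s) +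
      s * (1 - ζ / 2 + ζ ^ 2 / 4) + δ * s) := by linarith
    have e2 : s * (x + δ) + δ * s + ((1 + ζ / 2) * (s * (1 - x) + δ * s) +
      s * (1 - ζ / 2 + ζ ^ 2 / 4) + δ * s) =
      s * (2 + ζ ^ 2 / 4 - ζ / 2 * x + 4 * δ + ζ / 2 * δ) := by ring
    rw [e2] at e
    refine lt_of_le_of_lt e ?_
    apply mul_lt_mul_of_pos_left _ hs0
    have : ζ / 2 * x ≥ ζ / 2 * ζ := by gcongr
    have : ζ / 2 * δ ≤ 1 / 2 * δ := by gcongr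
    have : 0 < ζ ^ 2 := by positivity
    rw [hδ] at *
    nlinarith

end ML

open Filter

namespace ML

theorem Pr_inter {α : Type*} [DecidableEq α] (P : α → ℝ) (S A : Finset α) (hA : A ⊆ S)
    (E : Finset α → Prop) : Pr P S (fun T => E (T ∩ A)) = Pr P A E := by
  classical
  exact Ex_inter P S A hA (fun T => if E T then 1 else 0)

theorem low_det (r c N : ℕ) (hN : 0 < N) (s ζ δ : ℝ) (hζ : 0 < ζ) (hζ1 : ζ ≤ 1)
    (hδ : δ = ζ ^ 2 / 64) (hs : 1 ≤ s) (hr : 0 < r) (hc : 0 < c) (hα : s / r ≤ δ) (hα' : s / c ≤ δ)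
    (hNδ : 1 ≤ δ * N) (T : Finset (ℕ × ℕ))
    (hG : s * (2 - 3 * δ) ≤ G T r c)
    (h1 : ∀ k ≤ N, (G T (k * r / N) 0 : ℝ) ≤ s / r * (k * r / N : ℕ) + δ * s)
    (h2 : ∀ k ≤ N, (L true ((core r c T).filter (fun x => k * r / N ≤ x.1)) : ℝ)
      ≤ (1 + ζ / 2) * (s / r) * (r - (k * r / N : ℕ) : ℝ) + s / (1 + ζ / 2) + δ * s)
    (h3 : ∀ k ≤ N, (G T 0 (k * c / N) : ℝ) ≤ s / c * (k * c / N : ℕ) + δ * s)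
    (h4 : ∀ k ≤ N, (L true ((core r c T).filter (fun x => k * c / N ≤ x.2)) : ℝ)
      ≤ (1 + ζ / 2) * (s / c) * (c - (k * c / N : ℕ) : ℝ) + s / (1 + ζ / 2) + δ * s) :
    s * (2 - 4 * ζ) ≤ L true (core r c T) := by
  have hr0 : (0:ℝ) < r := by exact_mod_cast hr
  have hc0 : (0:ℝ) < c := by exact_mod_cast hc
  have hs0 : 0 < s := by linarith
  have hδζ : 5 * δ ≤ ζ := by rw [hδ]; nlinarith
  obtain ⟨X, hX, hXT, h⟩ := exit_lemma T _ r c rfl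
  have hXc : X ⊆ core r c T := by
    intro x hx
    have := hXT x hx
    simp only [core, Finset.mem_filter, Finset.mem_product, Finset.mem_range]
    exact ⟨⟨this.2.1, this.2.2⟩, this.1⟩
  have hXL : (X.card : ℝ) ≤ L true (core r c T) := by exact_mod_cast le_L hXc hX
  rcases h with ⟨z, hz, hXz, hGz⟩ | ⟨z, hz, hXz, hGz⟩
  · have hb := branch r N hN (s / r) s ζ δ hζ hζ1 hδ hs (by positivity) hα (by field_simp) hNδ
      (fun z => (G T z 0 : ℝ)) (fun z => (L true ((core r c T).filter (fun x => z ≤ x.1)) : ℝ))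
      (fun x y hxy => Nat.cast_le.2 (G_mono_row T 0 hxy))
      (fun x y hxy => by
        have : L true ((core r c T).filter (fun w => y ≤ w.1)) ≤
            L true ((core r c T).filter (fun w => x ≤ w.1)) :=
          L_mono (Finset.monotone_filter_right _ fun w _ hw => le_trans hxy hw)
        exact Nat.cast_le.2 this) h1 h2 z hz
    have hXL2 : (X.card : ℝ) ≤ L true ((core r c T).filter (fun x => z ≤ x.1)) := by
      have : X ⊆ (core r c T).filter (fun x => z ≤ x.1) := fun x hx =>
        Finset.mem_filter.2 ⟨hXc hx, hXz x hx⟩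
      exact_mod_cast le_L this hX
    have hGz' : (G T r c : ℝ) ≤ G T z 0 + X.card := by exact_mod_cast hGz
    rcases hb with hb | hb
    · linarith
    · nlinarith
  · have hb := branch c N hN (s / c) s ζ δ hζ hζ1 hδ hs (by positivity) hα' (by field_simp) hNδ
      (fun z => (G T 0 z : ℝ)) (fun z => (L true ((core r c T).filter (fun x => z ≤ x.2)) : ℝ))
      (fun x y hxy => Nat.cast_le.2 (G_mono_col T 0 hxy))
      (fun x y hxy => by
        have : L true ((core r c T).filter (fun w => y ≤ w.2)) ≤
            L true ((core r c T).filter (fun w => x ≤ w.2)) :=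
          L_mono (Finset.monotone_filter_right _ fun w _ hw => le_trans hxy hw)
        exact Nat.cast_le.2 this) h3 h4 z hz
    have hXL2 : (X.card : ℝ) ≤ L true ((core r c T).filter (fun x => z ≤ x.2)) := by
      have : X ⊆ (core r c T).filter (fun x => z ≤ x.2) := fun x hx =>
        Finset.mem_filter.2 ⟨hXc hx, hXz x hx⟩
      exact_mod_cast le_L this hX
    have hGz' : (G T r c : ℝ) ≤ G T 0 z + X.card := by exact_mod_cast hGz
    rcases hb with hb | hb
    · linarith
    · nlinarith

theorem low_prob_aux (p s ζ δ : ℝ) (r c N : ℕ) (hp : 0 < p) (hp1 : p ≤ 1) (hr : 0 < r) (hc : 0 < c)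
    (hN : 0 < N) (hζ : 0 < ζ) (hζ1 : ζ ≤ 1) (hδ : δ = ζ ^ 2 / 64) (hs : 1 ≤ s)
    (hα : s / r ≤ δ) (hα' : s / c ≤ δ) (hNδ : 1 ≤ δ * N) (hs2 : s * s = p * r * c) :
    Pr (fun _ => p) (Finset.range r ×ˢ Finset.range c)
      (fun T => (L true T : ℝ) < s * (2 - 4 * ζ)) ≤ (4 + (N + 1) * 14) / (δ ^ 2 * s) := by
  have hr0 : (0:ℝ) < r := by exact_mod_cast hr
  have hc0 : (0:ℝ) < c := by exact_mod_cast hc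
  have hs0 : 0 < s := by linarith
  have hδ0 : 0 < δ := by rw [hδ]; positivity
  have hδ1 : δ ≤ 1 / 64 := by rw [hδ]; nlinarith
  set a := s / r with hadef
  have ha0 : 0 < a := by positivity
  have ha1 : a < 1 := by linarith
  have hpa : p / a = s / c := by rw [hadef]; field_simp; nlinarith
  obtain ⟨e1, e2, e3, e4, e5⟩ := bOf_spec ha0 ha1 hp hp1
  set b := bOf a p with hb
  rw [hpa] at e4 e5
  have har : a * r = s := by rw [hadef]; field_simp
  have hbc : b * c ≤ s := by
    calc b * c ≤ s / c * c := by gcongr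
      _ = s := by field_simp
  have hbc2 : s * (1 - 2 * δ) ≤ b * c := by
    calc s * (1 - 2 * δ) ≤ s * (1 - a - s / c) := mul_le_mul_of_nonneg_left (by linarith) hs0.le
      _ = s / c * (1 - a - s / c) * c := by field_simp
      _ ≤ _ := by gcongr
  have hP := Ph_bd ⟨ha0.le, ha1.le⟩ ⟨e2, e3⟩ ⟨hp.le, hp1⟩ (grid r c)
  rw [← core_law a b p r c]
  have hzk : ∀ k ≤ N, ∀ m : ℕ, k * m / N ≤ m := fun k hk m => by
    calc k * m / N ≤ N * m / N := by gcongr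
      _ = m := Nat.mul_div_cancel_left _ hN
  set B1 : ℕ → Finset (ℕ × ℕ) → Prop := fun k T =>
    s / r * (k * r / N : ℕ) + δ * s < (G T (k * r / N) 0 : ℝ) with hB1
  set B2 : ℕ → Finset (ℕ × ℕ) → Prop := fun k T =>
    (1 + ζ / 2) * (s / r) * (r - (k * r / N : ℕ) : ℝ) + s / (1 + ζ / 2) + δ * s
      < (L true ((core r c T).filter (fun x => k * r / N ≤ x.1)) : ℝ) with hB2
  set B3 : ℕ → Finset (ℕ × ℕ) → Prop := fun k T =>
    s / c * (k * c / N : ℕ) + δ * s < (G T 0 (k * c / N) : ℝ) with hB3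
  set B4 : ℕ → Finset (ℕ × ℕ) → Prop := fun k T =>
    (1 + ζ / 2) * (s / c) * (c - (k * c / N : ℕ) : ℝ) + s / (1 + ζ / 2) + δ * s
      < (L true ((core r c T).filter (fun x => k * c / N ≤ x.2)) : ℝ) with hB4
  have hsub : Pr (Ph a b p) (grid r c) (fun T => (L true (core r c T) : ℝ) < s * (2 - 4 * ζ)) ≤
      Pr (Ph a b p) (grid r c) (fun T => ((G T r c : ℝ) < s * (2 - 3 * δ)) ∨
        ∃ k ∈ Finset.range (N + 1), (B1 k T ∨ B2 k T) ∨ (B3 k T ∨ B4 k T)) := by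
    refine Pr_mono hP fun T _ h => ?_
    by_contra hcon
    push Not at hcon
    obtain ⟨g1, g2⟩ := hcon
    have g3 : ∀ k ≤ N, _ := fun k hk => g2 k (Finset.mem_range.2 (by omega))
    refine absurd (low_det r c N hN s ζ δ hζ hζ1 hδ hs hr hc hα hα' hNδ T g1
      (fun k hk => ?_) (fun k hk => ?_) (fun k hk => ?_) (fun k hk => ?_)) (not_le.2 h)
    · exact not_lt.1 (g3 k hk).1.1
    · exact not_lt.1 (g3 k hk).1.2
    · exact not_lt.1 (g3 k hk).2.1
    · exact not_lt.1 (g3 k hk).2.2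
  refine hsub.trans ?_
  refine (Pr_or hP _ _).trans ?_
  have hδs : 0 < δ * s := by positivity
  have q0 : Pr (Ph a b p) (grid r c) (fun T => (G T r c : ℝ) < s * (2 - 3 * δ))
      ≤ 4 / (δ ^ 2 * s) := by
    refine (Pr_mono hP (F := fun T => δ * s ≤ |(G T r c : ℝ) - (a * r + b * c)|) fun T _ h => ?_).trans
      ((Pr_cheb hP _ _ _ (G_sq ⟨ha0.le, ha1.le⟩ ⟨e2, e3⟩ ⟨hp.le, hp1⟩ e1 r c) _ hδs).trans ?_)
    · rw [abs_sub_comm]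
      refine le_trans ?_ (le_abs_self _)
      nlinarith
    · rw [div_le_div_iff₀ (by positivity) (by positivity)]
      have : 2 * (a * r + b * c) ≤ 4 * s := by linarith
      calc 2 * (a * r + b * c) * (δ ^ 2 * s) ≤ 4 * s * (δ ^ 2 * s) := by gcongr
        _ = _ := by ring
  have q1 : ∀ k ≤ N, Pr (Ph a b p) (grid r c) (B1 k) ≤ 1 / (δ ^ 2 * s) := by
    intro k hk
    refine (Pr_mono hP (F := fun T => δ * s ≤ |(G T (k * r / N) 0 : ℝ) - a * (k * r / N : ℕ)|)
      fun T _ h => ?_).trans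
      ((Pr_cheb hP _ _ _ (src_sq a b p r c _ (hzk k hk r)).le _ hδs).trans ?_)
    · refine le_trans ?_ (le_abs_self _)
      simp only [hB1] at h; linarith
    · rw [div_le_div_iff₀ (by positivity) (by positivity)]
      have hz : ((k * r / N : ℕ) : ℝ) ≤ r := by exact_mod_cast hzk k hk r
      have : ((k * r / N : ℕ) : ℝ) * (a * (1 - a)) ≤ r * (a * 1) := by
        have : 0 ≤ 1 - a := by linarith
        gcongr; linarith
      calc ((k * r / N : ℕ) : ℝ) * (a * (1 - a)) * (δ ^ 2 * s)
          ≤ r * (a * 1) * (δ ^ 2 * s) := by gcongr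
        _ = (a * r) * (δ ^ 2 * s) := by ring
        _ = _ := by rw [har]; ring
  have q3 : ∀ k ≤ N, Pr (Ph a b p) (grid r c) (B3 k) ≤ 1 / (δ ^ 2 * s) := by
    intro k hk
    refine (Pr_mono hP (F := fun T => δ * s ≤ |(G T 0 (k * c / N) : ℝ) - b * (k * c / N : ℕ)|)
      fun T _ h => ?_).trans
      ((Pr_cheb hP _ _ _ (src_sq' a b p r c _ (hzk k hk c)).le _ hδs).trans ?_)
    · refine le_trans ?_ (le_abs_self _)
      simp only [hB3] at h
      have : b * ((k * c / N : ℕ) : ℝ) ≤ s / c * ((k * c / N : ℕ) : ℝ) := by gcongr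
      linarith
    · rw [div_le_div_iff₀ (by positivity) (by positivity)]
      have hz : ((k * c / N : ℕ) : ℝ) ≤ c := by exact_mod_cast hzk k hk c
      have : ((k * c / N : ℕ) : ℝ) * (b * (1 - b)) ≤ c * (b * 1) := by
        have : 0 ≤ 1 - b := by linarith
        gcongr; linarith
      calc ((k * c / N : ℕ) : ℝ) * (b * (1 - b)) * (δ ^ 2 * s)
          ≤ c * (b * 1) * (δ ^ 2 * s) := by gcongr
        _ = (b * c) * (δ ^ 2 * s) := by ring
        _ ≤ s * (δ ^ 2 * s) := by gcongr
        _ = _ := by ring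
  have hl : 0 < 1 + ζ / 2 := by linarith
  have hfin : ∀ x : ℝ, x ≤ 3 * s → 2 * x / (δ * s) ^ 2 ≤ 6 / (δ ^ 2 * s) := by
    intro x hx
    rw [div_le_div_iff₀ (by positivity) (by positivity)]
    calc 2 * x * (δ ^ 2 * s) ≤ 2 * (3 * s) * (δ ^ 2 * s) := by gcongr
      _ = _ := by ring
  have hsl : s / (1 + ζ / 2) ≤ s := div_le_self hs0.le (by linarith)
  have q2 : ∀ k ≤ N, Pr (Ph a b p) (grid r c) (B2 k) ≤ 6 / (δ ^ 2 * s) := by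
    intro k hk
    set z := k * r / N with hz
    have hzr : z ≤ r := hzk k hk r
    have i1 := core_law a b p r c (fun C => (1 + ζ / 2) * (s / r) * (r - z : ℝ)
      + s / (1 + ζ / 2) + δ * s < (L true (C.filter (fun x => z ≤ x.1)) : ℝ))
    simp only [hB2]
    rw [i1]
    have hAsub : Finset.Ico z r ×ˢ Finset.range c ⊆ Finset.range r ×ˢ Finset.range c := by
      intro x hx; simp at hx ⊢; omega
    have i2 : Pr (fun _ => p) (Finset.range r ×ˢ Finset.range c)
      (fun C => (1 + ζ / 2) * (s / r) * (r - z : ℝ)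
      + s / (1 + ζ / 2) + δ * s < (L true (C.filter (fun x => z ≤ x.1)) : ℝ)) =
      Pr (fun _ => p) (Finset.range r ×ˢ Finset.range c)
      (fun C => (1 + ζ / 2) * (s / r) * (r - z : ℝ)
      + s / (1 + ζ / 2) + δ * s < (L true (C ∩ (Finset.Ico z r ×ˢ Finset.range c)) : ℝ)) := by
      refine Pr_congr fun C hC => ?_
      have : C.filter (fun x => z ≤ x.1) = C ∩ (Finset.Ico z r ×ˢ Finset.range c) := by
        ext x
        simp only [Finset.mem_filter, Finset.mem_inter, Finset.mem_product, Finset.mem_Ico,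
          Finset.mem_range]
        constructor
        · rintro ⟨h1, h2⟩; have := hC h1; simp at this; exact ⟨h1, ⟨h2, this.1⟩, this.2⟩
        · rintro ⟨h1, h2⟩; exact ⟨h1, h2.1.1⟩
      rw [this]
    rw [i2, Pr_inter _ _ _ hAsub (fun C => (1 + ζ / 2) * (s / r) * (r - z : ℝ)
      + s / (1 + ζ / 2) + δ * s < (L true C : ℝ))]
    have i3 := up_prob_AB (p := p) (a := (1 + ζ / 2) * a) (by positivity) (by nlinarith) hp hp1
      true (Finset.Ico z r) (Finset.range c) (δ * s) hδs
    have i4 : p / ((1 + ζ / 2) * a) * c = s / (1 + ζ / 2) := by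
      rw [mul_comm (1 + ζ / 2) a, ← div_div, hpa]; field_simp
    simp only [Nat.card_Ico, Finset.card_range, Nat.cast_sub hzr] at i3
    rw [i4] at i3
    refine (Pr_mono (fun _ _ => ⟨hp.le, hp1⟩) fun T _ h => le_of_lt ?_).trans (i3.trans (hfin _ ?_))
    · exact h
    · have : (1 + ζ / 2) * a * ((r:ℝ) - z) ≤ (1 + 1 / 2) * (a * r) := by
        rw [mul_assoc]
        have hz0 : (0:ℝ) ≤ z := by positivity
        have : (z:ℝ) ≤ r := by exact_mod_cast hzr
        have : 0 ≤ (r:ℝ) - z := by linarith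
        gcongr; linarith
      rw [har] at this; linarith
  have q4 : ∀ k ≤ N, Pr (Ph a b p) (grid r c) (B4 k) ≤ 6 / (δ ^ 2 * s) := by
    intro k hk
    set z := k * c / N with hz
    have hzr : z ≤ c := hzk k hk c
    have i1 := core_law a b p r c (fun C => (1 + ζ / 2) * (s / c) * (c - z : ℝ)
      + s / (1 + ζ / 2) + δ * s < (L true (C.filter (fun x => z ≤ x.2)) : ℝ))
    simp only [hB4]
    rw [i1]
    have hAsub : Finset.range r ×ˢ Finset.Ico z c ⊆ Finset.range r ×ˢ Finset.range c := by
      intro x hx; simp at hx ⊢; omega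
    have i2 : Pr (fun _ => p) (Finset.range r ×ˢ Finset.range c)
      (fun C => (1 + ζ / 2) * (s / c) * (c - z : ℝ)
      + s / (1 + ζ / 2) + δ * s < (L true (C.filter (fun x => z ≤ x.2)) : ℝ)) =
      Pr (fun _ => p) (Finset.range r ×ˢ Finset.range c)
      (fun C => (1 + ζ / 2) * (s / c) * (c - z : ℝ)
      + s / (1 + ζ / 2) + δ * s < (L true (C ∩ (Finset.range r ×ˢ Finset.Ico z c)) : ℝ)) := by
      refine Pr_congr fun C hC => ?_
      have : C.filter (fun x => z ≤ x.2) = C ∩ (Finset.range r ×ˢ Finset.Ico z c) := by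
        ext x
        simp only [Finset.mem_filter, Finset.mem_inter, Finset.mem_product, Finset.mem_Ico,
          Finset.mem_range]
        constructor
        · rintro ⟨h1, h2⟩; have := hC h1; simp at this; exact ⟨h1, this.1, h2, this.2⟩
        · rintro ⟨h1, h2⟩; exact ⟨h1, h2.2.1⟩
      rw [this]
    rw [i2, Pr_inter _ _ _ hAsub (fun C => (1 + ζ / 2) * (s / c) * (c - z : ℝ)
      + s / (1 + ζ / 2) + δ * s < (L true C : ℝ))]
    have hal : a / (1 + ζ / 2) < 1 := lt_of_le_of_lt (div_le_self ha0.le (by linarith)) ha1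
    have i3 := up_prob_AB (p := p) (a := a / (1 + ζ / 2)) (by positivity) hal hp hp1
      true (Finset.range r) (Finset.Ico z c) (δ * s) hδs
    have i4 : a / (1 + ζ / 2) * r = s / (1 + ζ / 2) := by
      rw [div_mul_eq_mul_div, har]
    have i5 : p / (a / (1 + ζ / 2)) = (1 + ζ / 2) * (s / c) := by
      rw [← hpa]; field_simp
    simp only [Nat.card_Ico, Finset.card_range, Nat.cast_sub hzr] at i3
    rw [i4, i5] at i3
    refine (Pr_mono (fun _ _ => ⟨hp.le, hp1⟩) fun T _ h => le_of_lt ?_).trans (i3.trans (hfin _ ?_))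
    · rw [add_comm (s / (1 + ζ / 2))]; exact h
    · have : (1 + ζ / 2) * (s / c) * ((c:ℝ) - z) ≤ (1 + 1 / 2) * (s / c * c) := by
        rw [mul_assoc]
        have hz0 : (0:ℝ) ≤ z := by positivity
        have : (z:ℝ) ≤ c := by exact_mod_cast hzr
        have : 0 ≤ (c:ℝ) - z := by linarith
        gcongr; linarith
      have e : s / c * c = s := by field_simp
      rw [e] at this; linarith
  have q5 : Pr (Ph a b p) (grid r c)
      (fun T => ∃ k ∈ Finset.range (N + 1), (B1 k T ∨ B2 k T) ∨ (B3 k T ∨ B4 k T))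
      ≤ (N + 1) * (14 / (δ ^ 2 * s)) := by
    refine (Pr_exists hP _ (fun k T => (B1 k T ∨ B2 k T) ∨ (B3 k T ∨ B4 k T))).trans ?_
    calc _ ≤ ∑ k ∈ Finset.range (N + 1), 14 / (δ ^ 2 * s) := by
          refine Finset.sum_le_sum fun k hk => ?_
          have hk' : k ≤ N := by rw [Finset.mem_range] at hk; omega
          have := Pr_or hP (fun T => B1 k T ∨ B2 k T) (fun T => B3 k T ∨ B4 k T)
          have h1 := Pr_or hP (B1 k) (B2 k)
          have h2 := Pr_or hP (B3 k) (B4 k)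
          have j1 := q1 k hk'
          have j2 := q2 k hk'
          have j3 := q3 k hk'
          have j4 := q4 k hk'
          have e : 14 / (δ ^ 2 * s) = 1 / (δ ^ 2 * s) + 6 / (δ ^ 2 * s) +
            (1 / (δ ^ 2 * s) + 6 / (δ ^ 2 * s)) := by ring
          rw [e]; linarith
      _ = _ := by simp
  calc _ ≤ 4 / (δ ^ 2 * s) + (N + 1) * (14 / (δ ^ 2 * s)) := add_le_add q0 q5
    _ = _ := by ring

theorem low_prob (η : ℝ) (hη : 0 < η) (hη1 : η ≤ 1) : ∃ s0 a0 : ℝ, 1 ≤ s0 ∧ 0 < a0 ∧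
    ∀ (p : ℝ) (r c : ℕ), 0 < p → p ≤ 1 → 0 < r → 0 < c → p * c ≤ a0 * r → p * r ≤ a0 * c →
      s0 ≤ p * r * c →
      Pr (fun _ => p) (Finset.range r ×ˢ Finset.range c)
        (fun T => (L true T : ℝ) < (2 - η) * Real.sqrt (p * r * c)) ≤ η := by
  set ζ := η / 4 with hζ
  set δ := ζ ^ 2 / 64 with hδ
  have hζ0 : 0 < ζ := by positivity
  have hδ0 : 0 < δ := by positivity
  obtain ⟨N, hN⟩ := exists_nat_ge (1 / δ)
  have hNδ : 1 ≤ δ * N := by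
    rw [div_le_iff₀ hδ0] at hN; linarith
  have hN0 : 0 < N := by
    rcases Nat.eq_zero_or_pos N with h | h
    · rw [h] at hNδ; norm_num at hNδ
    · exact h
  set K : ℝ := (4 + (N + 1) * 14) / (δ ^ 2 * η) with hK
  have hK0 : 0 < K := by positivity
  refine ⟨(1 + K) ^ 2, δ ^ 2, by nlinarith, by positivity, ?_⟩
  intro p r c hp hp1 hr hc h1 h2 h3
  have hr0 : (0:ℝ) < r := by exact_mod_cast hr
  have hc0 : (0:ℝ) < c := by exact_mod_cast hc
  set s := Real.sqrt (p * r * c) with hs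
  have hsK : 1 + K ≤ s := by
    rw [hs]; exact Real.le_sqrt_of_sq_le h3
  have hs2 : s * s = p * r * c := Real.mul_self_sqrt (by positivity)
  have hs0 : 0 < s := by linarith
  have g1 : s / r ≤ δ := by
    rw [div_le_iff₀ hr0]
    apply abs_le_of_sq_le_sq' _ (by positivity) |>.2
    nlinarith
  have g2 : s / c ≤ δ := by
    rw [div_le_iff₀ hc0]
    apply abs_le_of_sq_le_sq' _ (by positivity) |>.2
    nlinarith
  have := low_prob_aux p s ζ δ r c N hp hp1 hr hc hN0 hζ0 (by linarith) hδ (by linarith) g1 g2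
    hNδ hs2
  have e : (2 - η) * s = s * (2 - 4 * ζ) := by rw [hζ]; ring
  rw [e]
  refine this.trans ?_
  rw [div_le_iff₀ (by positivity)]
  have : K ≤ s := by linarith
  rw [hK, div_le_iff₀ (by positivity)] at this
  linarith

end ML

open Filter

namespace ML

/-- first available row with a success in column `j` -/
def fm (R : Finset ℕ) (T : Finset (ℕ × ℕ)) (j : ℕ) : WithTop ℕ :=
  (R.filter (fun i => (i, j) ∈ T)).min

/-- remaining rows after `j` columns of the greedy procedure -/
def Rset (R0 : Finset ℕ) (T : Finset (ℕ × ℕ)) : ℕ → Finset ℕ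
  | 0 => R0
  | j + 1 => (Rset R0 T j).filter (fun i => (i : WithTop ℕ) ≠ fm (Rset R0 T j) T j)

theorem coe_eq_fm {R : Finset ℕ} {T : Finset (ℕ × ℕ)} {j k : ℕ} :
    (k : WithTop ℕ) = fm R T j ↔ (k ∈ R ∧ (k, j) ∈ T ∧ ∀ i ∈ R, (i, j) ∈ T → k ≤ i) := by
  unfold fm
  constructor
  · intro h
    have h1 := Finset.mem_of_min h.symm
    rw [Finset.mem_filter] at h1
    refine ⟨h1.1, h1.2, fun i hi hT => ?_⟩
    have := Finset.min_le (s := R.filter (fun i => (i, j) ∈ T)) (Finset.mem_filter.2 ⟨hi, hT⟩)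
    rw [← h] at this
    exact WithTop.coe_le_coe.1 this
  · rintro ⟨h1, h2, h3⟩
    apply le_antisymm
    · apply Finset.le_min
      intro i hi
      rw [Finset.mem_filter] at hi
      exact WithTop.coe_le_coe.2 (h3 i hi.1 hi.2)
    · exact Finset.min_le (Finset.mem_filter.2 ⟨h1, h2⟩)

theorem fm_eq_top {R : Finset ℕ} {T : Finset (ℕ × ℕ)} {j : ℕ} :
    fm R T j = ⊤ ↔ ∀ i ∈ R, (i, j) ∉ T := by
  unfold fm
  rw [Finset.min_eq_top, Finset.filter_eq_empty_iff]

theorem Rset_succ_subset (R0 : Finset ℕ) (T : Finset (ℕ × ℕ)) (j : ℕ) :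
    Rset R0 T (j + 1) ⊆ Rset R0 T j := Finset.filter_subset _ _

theorem Rset_anti (R0 : Finset ℕ) (T : Finset (ℕ × ℕ)) {j j' : ℕ} (h : j ≤ j') :
    Rset R0 T j' ⊆ Rset R0 T j := by
  induction h with
  | refl => exact subset_rfl
  | step h ih => exact (Rset_succ_subset R0 T _).trans ih

theorem Rset_subset (R0 : Finset ℕ) (T : Finset (ℕ × ℕ)) (j : ℕ) : Rset R0 T j ⊆ R0 :=
  Rset_anti R0 T (Nat.zero_le j)

theorem fm_congr {R : Finset ℕ} {T T' : Finset (ℕ × ℕ)} {j : ℕ}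
    (h : ∀ i ∈ R, ((i, j) ∈ T ↔ (i, j) ∈ T')) : fm R T j = fm R T' j := by
  unfold fm; congr 1; exact Finset.filter_congr h

theorem Rset_congr {R0 : Finset ℕ} {T T' : Finset (ℕ × ℕ)} (j : ℕ)
    (h : ∀ i ∈ R0, ∀ k < j, ((i, k) ∈ T ↔ (i, k) ∈ T')) : Rset R0 T j = Rset R0 T' j := by
  induction j with
  | zero => rfl
  | succ j ih =>
    have e := ih fun i hi k hk => h i hi k (by omega)
    simp only [Rset]
    rw [e, fm_congr fun i hi => h i (Rset_subset _ _ _ hi) j (by omega)]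

theorem Rset_filter (R0 : Finset ℕ) (T : Finset (ℕ × ℕ)) (i j : ℕ) :
    Rset (R0.filter (· < i)) T j = (Rset R0 T j).filter (· < i) := by
  induction j with
  | zero => rfl
  | succ j ih =>
    simp only [Rset]
    rw [ih]
    ext k
    simp only [Finset.mem_filter, ne_eq, coe_eq_fm]
    constructor
    · rintro ⟨⟨h1, h2⟩, h3⟩
      refine ⟨⟨h1, fun h4 => h3 ⟨⟨h1, h2⟩, h4.2.1, fun i hi => h4.2.2 i hi.1⟩⟩, h2⟩
    · rintro ⟨⟨h1, h2⟩, h3⟩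
      refine ⟨⟨h1, h3⟩, fun h4 => h2 ⟨h1, h4.2.1, fun i' hi' hT => ?_⟩⟩
      by_cases h5 : i' < i
      · exact h4.2.2 i' ⟨hi', h5⟩ hT
      · omega

theorem Rset_card_succ (R0 : Finset ℕ) (T : Finset (ℕ × ℕ)) (j : ℕ) :
    (Rset R0 T (j + 1)).card + (if fm (Rset R0 T j) T j = ⊤ then 0 else 1)
      = (Rset R0 T j).card := by
  simp only [Rset]
  rcases h : fm (Rset R0 T j) T j with _ | k
  · have : ∀ i ∈ Rset R0 T j, (i : WithTop ℕ) ≠ ⊤ := fun i _ => WithTop.coe_ne_top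
    change ((Rset R0 T j).filter (fun i : ℕ => (i : WithTop ℕ) ≠ ⊤)).card +
      (if (⊤ : WithTop ℕ) = ⊤ then 0 else 1) = _
    rw [Finset.filter_true_of_mem this]; simp
  · change ((Rset R0 T j).filter (fun i : ℕ => (i : WithTop ℕ) ≠ (k : WithTop ℕ))).card +
      (if (k : WithTop ℕ) = ⊤ then 0 else 1) = _
    have hk := (coe_eq_fm.1 h.symm).1
    have e : (Rset R0 T j).filter (fun i : ℕ => (i : WithTop ℕ) ≠ (k : WithTop ℕ))
        = (Rset R0 T j).erase k := by
      ext x; simp only [Finset.mem_filter, Finset.mem_erase, ne_eq, Nat.cast_inj]; tauto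
    rw [e, if_neg (WithTop.natCast_ne_top k), Finset.card_erase_of_mem hk]
    have := Finset.card_pos.2 ⟨k, hk⟩
    omega

/-- rank in a set -/
def rk (R : Finset ℕ) (i : ℕ) : ℕ := (R.filter (· < i)).card

theorem min_law (p : ℝ) (R : Finset ℕ) (g : WithTop ℕ → ℝ) :
    Ex (fun _ => p) R (fun V => g V.min) = (1 - p) ^ R.card * g ⊤
      + ∑ i ∈ R, p * (1 - p) ^ rk R i * g i := by
  induction R using Finset.induction_on_max generalizing g with
  | empty => simp [Ex_empty]
  | insert a s hs ih =>
    have ha : a ∉ s := fun h => lt_irrefl _ (hs a h)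
    rw [Ex_insert _ _ _ ha, ih, Finset.sum_insert ha, Finset.card_insert_of_notMem ha]
    have h1 : Ex (fun _ => p) s (fun V => g (insert a V).min)
        = Ex (fun _ => p) s (fun V => (fun m => g (min (a : WithTop ℕ) m)) V.min) := by
      refine Ex_congr _ _ fun V _ => ?_
      simp only [Finset.min_insert]; rfl
    rw [h1, ih (fun m => g (min (a : WithTop ℕ) m))]
    have e1 : rk (insert a s) a = s.card := by
      unfold rk
      rw [Finset.filter_insert, if_neg (lt_irrefl _), Finset.filter_true_of_mem hs]
    have e2 : ∀ i ∈ s, rk (insert a s) i = rk s i := by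
      intro i hi
      unfold rk
      rw [Finset.filter_insert, if_neg (by have := hs i hi; omega)]
    have e3 : ∑ i ∈ s, p * (1 - p) ^ rk (insert a s) i * g i
        = ∑ i ∈ s, p * (1 - p) ^ rk s i * g i :=
      Finset.sum_congr rfl fun i hi => by rw [e2 i hi]
    have e4 : ∑ i ∈ s, p * (1 - p) ^ rk s i * g (min (a : WithTop ℕ) i)
        = ∑ i ∈ s, p * (1 - p) ^ rk s i * g i :=
      Finset.sum_congr rfl fun i hi => by
        rw [min_eq_right (Nat.cast_le.2 (hs i hi).le)]
    simp only [min_top_right]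
    rw [e3, e4, e1]; ring

theorem sum_rk (p : ℝ) (R : Finset ℕ) : ∑ i ∈ R, p * (1 - p) ^ rk R i = 1 - (1 - p) ^ R.card := by
  have := min_law p R (fun _ => 1)
  rw [Ex_const] at this
  simp only [mul_one] at this
  linarith

/-- One column of the greedy procedure. -/
theorem col_step (p : ℝ) (R0 : Finset ℕ) (j : ℕ) (f : Finset (ℕ × ℕ) → WithTop ℕ → ℝ)
    (hf : ∀ T T', (∀ i ∈ R0, ∀ k < j, ((i, k) ∈ T ↔ (i, k) ∈ T')) → f T = f T') :
    Ex (fun _ => p) (R0 ×ˢ Finset.range (j + 1)) (fun T => f T (fm (Rset R0 T j) T j))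
    = Ex (fun _ => p) (R0 ×ˢ Finset.range j) (fun T => (1 - p) ^ (Rset R0 T j).card * f T ⊤
      + ∑ i ∈ Rset R0 T j, p * (1 - p) ^ rk (Rset R0 T j) i * f T i) := by
  have hS : R0 ×ˢ Finset.range (j + 1) = (R0 ×ˢ Finset.range j) ∪ (R0 ×ˢ {j}) := by
    rw [← Finset.product_union]; congr 1
    ext x; simp; omega
  have hd : Disjoint (R0 ×ˢ Finset.range j) (R0 ×ˢ {j}) := by
    rw [Finset.disjoint_left]; rintro ⟨x, y⟩ h1 h2; simp at h1 h2; omega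
  rw [hS, Ex_union _ _ _ hd]
  refine Ex_congr _ _ fun T₁ hT₁ => ?_
  rw [← min_law p _ (f T₁)]
  have h1 := Ex_pull (fun _ => p) (R0 ×ˢ {j}) (Rset R0 T₁ j) (fun i => (i, j))
    (by intro x y h; simpa using h) (fun i hi => by simpa using Rset_subset _ _ _ hi)
    (fun V => f T₁ V.min)
  have h2 : Ex ((fun _ => p) ∘ fun i => (i, j)) (Rset R0 T₁ j) (fun V => f T₁ V.min) =
    Ex (fun _ => p) (Rset R0 T₁ j) (fun V => f T₁ V.min) := rfl
  rw [← h2, ← h1]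
  refine Ex_congr _ _ fun T₂ hT₂ => ?_
  have k1 : ∀ i ∈ R0, ∀ k < j, ((i, k) ∈ T₁ ∪ T₂ ↔ (i, k) ∈ T₁) := by
    intro i hi k hk
    rw [Finset.mem_union]
    constructor
    · rintro (h | h)
      · exact h
      · have := hT₂ h; simp at this; omega
    · exact Or.inl
  rw [hf _ _ k1, Rset_congr j k1]
  congr 1
  unfold fm
  congr 1
  refine Finset.filter_congr fun i hi => ?_
  rw [Finset.mem_union]
  constructor
  · rintro (h | h)
    · have := hT₁ h; simp at this
    · exact h
  · exact Or.inr

/-- Law of the card after one column. -/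
theorem card_step (p : ℝ) (R0 : Finset ℕ) (j : ℕ) (h : ℕ → ℝ) :
    Ex (fun _ => p) (R0 ×ˢ Finset.range (j + 1)) (fun T => h (Rset R0 T (j + 1)).card)
    = Ex (fun _ => p) (R0 ×ˢ Finset.range j) (fun T =>
      (1 - p) ^ (Rset R0 T j).card * h (Rset R0 T j).card
      + (1 - (1 - p) ^ (Rset R0 T j).card) * h ((Rset R0 T j).card - 1)) := by
  have h1 := col_step p R0 j (fun T m => h ((Rset R0 T j).card - if m = ⊤ then 0 else 1))
    (fun T T' hT => by funext m; rw [Rset_congr j hT])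
  simp only [if_true, WithTop.natCast_ne_top, if_false, Nat.sub_zero] at h1
  have h2 : Ex (fun _ => p) (R0 ×ˢ Finset.range (j + 1)) (fun T => h (Rset R0 T (j + 1)).card) =
    Ex (fun _ => p) (R0 ×ˢ Finset.range (j + 1)) (fun T => h ((Rset R0 T j).card -
      if fm (Rset R0 T j) T j = ⊤ then 0 else 1)) := by
    refine Ex_congr _ _ fun T _ => ?_
    have := Rset_card_succ R0 T j
    congr 1; omega
  rw [h2, h1]
  refine Ex_congr _ _ fun T _ => ?_
  rw [← Finset.sum_mul, sum_rk]

/-- exponential moments -/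
noncomputable def Xv (q : ℝ) (R0 : Finset ℕ) (T : Finset (ℕ × ℕ)) (j : ℕ) : ℝ :=
  (q ^ (Rset R0 T j).card)⁻¹

theorem X_step_aux {q : ℝ} (hq : 0 < q) (u : ℕ) :
    q ^ u * (q ^ u)⁻¹ + (1 - q ^ u) * (q ^ (u - 1))⁻¹ = q * (q ^ u)⁻¹ + (1 - q) ∧
    q ^ u * ((q ^ u)⁻¹) ^ 2 + (1 - q ^ u) * ((q ^ (u - 1))⁻¹) ^ 2
      = q ^ 2 * ((q ^ u)⁻¹) ^ 2 + (1 - q ^ 2) * (q ^ u)⁻¹ := by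
  rcases u with _ | u
  · simp
  · simp only [Nat.add_sub_cancel, pow_succ]
    constructor <;> field_simp <;> ring

theorem X_mean {q : ℝ} (hq : 0 < q) (R0 : Finset ℕ) (j : ℕ) :
    Ex (fun _ => 1 - q) (R0 ×ˢ Finset.range j) (fun T => Xv q R0 T j)
      = 1 + ((q ^ R0.card)⁻¹ - 1) * q ^ j := by
  induction j with
  | zero => simp [Ex_empty, Xv, Rset]
  | succ j ih =>
    have := card_step (1 - q) R0 j (fun u => (q ^ u)⁻¹)
    simp only [sub_sub_cancel] at this
    simp only [Xv] at ih ⊢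
    rw [this]
    simp only [(X_step_aux hq _).1]
    rw [Ex_add, Ex_mul, ih, Ex_const]; ring

theorem X_var {q : ℝ} (hq : 0 < q) (hq1 : q ≤ 1) (R0 : Finset ℕ) (j : ℕ) :
    Ex (fun _ => 1 - q) (R0 ×ˢ Finset.range j)
      (fun T => (Xv q R0 T j - (1 + ((q ^ R0.card)⁻¹ - 1) * q ^ j)) ^ 2)
      ≤ (1 - q) * ((q ^ R0.card)⁻¹ - 1) := by
  set s := (q ^ R0.card)⁻¹ - 1 with hs
  have hs0 : 0 ≤ s := by
    rw [hs, sub_nonneg]; exact (one_le_inv₀ (by positivity)).2 (pow_le_one₀ hq.le hq1)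
  have expand : ∀ j, Ex (fun _ => 1 - q) (R0 ×ˢ Finset.range j)
      (fun T => (Xv q R0 T j - (1 + s * q ^ j)) ^ 2) =
      Ex (fun _ => 1 - q) (R0 ×ˢ Finset.range j) (fun T => (Xv q R0 T j) ^ 2)
        - (1 + s * q ^ j) ^ 2 := by
    intro j
    have h : ∀ T, (Xv q R0 T j - (1 + s * q ^ j)) ^ 2 =
      (Xv q R0 T j) ^ 2 + (-2 * (1 + s * q ^ j) * Xv q R0 T j + (1 + s * q ^ j) ^ 2) :=
      fun T => by ring
    simp only [h]
    rw [Ex_add, Ex_add, Ex_mul, X_mean hq, Ex_const, ← hs]; ring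
  have sq : ∀ j, Ex (fun _ => 1 - q) (R0 ×ˢ Finset.range (j + 1)) (fun T => (Xv q R0 T (j + 1)) ^ 2)
      = q ^ 2 * Ex (fun _ => 1 - q) (R0 ×ˢ Finset.range j) (fun T => (Xv q R0 T j) ^ 2)
        + (1 - q ^ 2) * (1 + s * q ^ j) := by
    intro j
    have h1 := card_step (1 - q) R0 j (fun u => ((q ^ u)⁻¹) ^ 2)
    simp only [sub_sub_cancel] at h1
    have h2 := X_mean hq R0 j
    simp only [Xv] at h2 ⊢
    rw [h1]
    simp only [(X_step_aux hq _).2]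
    rw [Ex_add, Ex_mul, Ex_mul, h2]
  have key : ∀ j, Ex (fun _ => 1 - q) (R0 ×ˢ Finset.range j)
      (fun T => (Xv q R0 T j - (1 + s * q ^ j)) ^ 2) ≤ (1 - q) * s := by
    intro j
    induction j with
    | zero =>
      rw [expand]; simp [Ex_empty, Xv, Rset, hs]
      exact mul_nonneg (by linarith) hs0
    | succ j ih =>
      rw [expand] at ih ⊢
      rw [sq]
      have hqj : q ^ j ≤ 1 := pow_le_one₀ hq.le hq1
      have hqj0 : 0 < q ^ j := by positivity
      set E := Ex (fun _ => 1 - q) (R0 ×ˢ Finset.range j) (fun T => (Xv q R0 T j) ^ 2)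
      have e1 : q ^ 2 * E + (1 - q ^ 2) * (1 + s * q ^ j) - (1 + s * q ^ (j + 1)) ^ 2
        = q ^ 2 * (E - (1 + s * q ^ j) ^ 2) + (1 - q) ^ 2 * (s * q ^ j) := by
        rw [pow_succ]; ring
      rw [e1]
      have i1 : q ^ 2 * (E - (1 + s * q ^ j) ^ 2) ≤ q ^ 2 * ((1 - q) * s) := by gcongr
      have i2 : (1 - q) ^ 2 * (s * q ^ j) ≤ (1 - q) ^ 2 * (s * 1) := by gcongr
      have i3 : q ^ 2 * ((1 - q) * s) + (1 - q) ^ 2 * (s * 1) ≤ (1 - q) * s := by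
        have : 0 ≤ (1 - q) * s := mul_nonneg (by linarith) hs0
        have h3 : q ^ 2 + (1 - q) ≤ 1 := by nlinarith
        nlinarith
      linarith
  exact key j

end ML

open Filter

namespace ML

/-- Sequential construction of a Mallows word. -/
noncomputable def MW (q : ℝ) : ℕ → Finset ℕ → (List ℕ → ℝ) → ℝ
  | 0, _, f => f []
  | m + 1, R, f => ∑ i ∈ R, q ^ rk R i / (∑ k ∈ Finset.range (m + 1), q ^ k) *
      MW q m (R.erase i) (fun w => f (i :: w))

theorem MW_add (q : ℝ) (m : ℕ) (R : Finset ℕ) (f g : List ℕ → ℝ) :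
    MW q m R (fun w => f w + g w) = MW q m R f + MW q m R g := by
  induction m generalizing R f g with
  | zero => rfl
  | succ m ih =>
    simp only [MW]
    rw [← Finset.sum_add_distrib]
    refine Finset.sum_congr rfl fun i _ => ?_
    rw [ih]; ring

theorem MW_mul (q : ℝ) (m : ℕ) (R : Finset ℕ) (c : ℝ) (f : List ℕ → ℝ) :
    MW q m R (fun w => c * f w) = c * MW q m R f := by
  induction m generalizing R f with
  | zero => rfl
  | succ m ih =>
    simp only [MW]
    rw [Finset.mul_sum]
    refine Finset.sum_congr rfl fun i _ => ?_
    rw [ih]; ring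

theorem MW_mono {q : ℝ} (hq : 0 ≤ q) (m : ℕ) (R : Finset ℕ) {f g : List ℕ → ℝ}
    (h : ∀ w, f w ≤ g w) : MW q m R f ≤ MW q m R g := by
  induction m generalizing R f g with
  | zero => exact h []
  | succ m ih =>
    simp only [MW]
    refine Finset.sum_le_sum fun i _ => mul_le_mul_of_nonneg_left (ih _ fun w => h _) ?_
    positivity

theorem geom_p (q : ℝ) (m : ℕ) : (1 - q) * ∑ k ∈ Finset.range m, q ^ k = 1 - q ^ m := by
  have := mul_neg_geom_sum q m
  linarith [this]

theorem sum_rk_q (q : ℝ) (R : Finset ℕ) (hq1 : q < 1) :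
    ∑ i ∈ R, q ^ rk R i = ∑ k ∈ Finset.range R.card, q ^ k := by
  have h1 := sum_rk (1 - q) R
  rw [← Finset.mul_sum, sub_sub_cancel, ← geom_p] at h1
  exact mul_left_cancel₀ (by linarith) h1

theorem MW_const {q : ℝ} (hq : 0 < q) (hq1 : q < 1) (m : ℕ) (R : Finset ℕ) (hR : R.card = m)
    (c : ℝ) : MW q m R (fun _ => c) = c := by
  induction m generalizing R with
  | zero => rfl
  | succ m ih =>
    simp only [MW]
    have : ∀ i ∈ R, q ^ rk R i / (∑ k ∈ Finset.range (m + 1), q ^ k) *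
        MW q m (R.erase i) (fun _ => c) = q ^ rk R i * (c / (∑ k ∈ Finset.range (m + 1), q ^ k)) := by
      intro i hi
      rw [ih _ (by rw [Finset.card_erase_of_mem hi, hR]; rfl)]; ring
    rw [Finset.sum_congr rfl this, ← Finset.sum_mul, sum_rk_q q R hq1, hR]
    have : 0 < ∑ k ∈ Finset.range (m + 1), q ^ k :=
      Finset.sum_pos (fun k _ => by positivity) ⟨0, by simp⟩
    field_simp

/-- singleton or empty list -/
def tl (m : WithTop ℕ) : List ℕ := if m = ⊤ then [] else [m.untopD 0]

theorem tl_top : tl ⊤ = [] := by simp [tl]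
theorem tl_coe (i : ℕ) : tl (i : WithTop ℕ) = [i] := by
  rw [tl, if_neg (WithTop.natCast_ne_top i)]; rfl

/-- the word of kept rows -/
def word (R0 : Finset ℕ) (T : Finset (ℕ × ℕ)) : ℕ → List ℕ
  | 0 => []
  | j + 1 => word R0 T j ++ tl (fm (Rset R0 T j) T j)

theorem word_congr {R0 : Finset ℕ} {T T' : Finset (ℕ × ℕ)} (j : ℕ)
    (h : ∀ i ∈ R0, ∀ k < j, ((i, k) ∈ T ↔ (i, k) ∈ T')) : word R0 T j = word R0 T' j := by
  induction j with
  | zero => rfl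
  | succ j ih =>
    simp only [word]
    rw [ih fun i hi k hk => h i hi k (by omega),
      Rset_congr j fun i hi k hk => h i hi k (by omega),
      fm_congr fun i hi => h i (Rset_subset _ _ _ hi) j (by omega)]

theorem Rset_succ_top {R0 : Finset ℕ} {T : Finset (ℕ × ℕ)} {j : ℕ}
    (h : fm (Rset R0 T j) T j = ⊤) : Rset R0 T (j + 1) = Rset R0 T j := by
  simp only [Rset]; rw [h]
  exact Finset.filter_true_of_mem fun i _ => WithTop.natCast_ne_top i

theorem Rset_succ_coe {R0 : Finset ℕ} {T : Finset (ℕ × ℕ)} {j k : ℕ}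
    (h : fm (Rset R0 T j) T j = k) : Rset R0 T (j + 1) = (Rset R0 T j).erase k := by
  simp only [Rset]; rw [h]
  ext x; simp only [Finset.mem_filter, Finset.mem_erase, ne_eq, Nat.cast_inj]; tauto

/-- set of rows after possibly removing one -/
def rem (R : Finset ℕ) (m : WithTop ℕ) : Finset ℕ := if m = ⊤ then R else R.erase (m.untopD 0)

theorem Rset_succ_rem (R0 : Finset ℕ) (T : Finset (ℕ × ℕ)) (j : ℕ) :
    Rset R0 T (j + 1) = rem (Rset R0 T j) (fm (Rset R0 T j) T j) := by
  rcases h : fm (Rset R0 T j) T j with _ | k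
  · rw [Rset_succ_top h]; rfl
  · rw [Rset_succ_coe h]; rfl

theorem MW_coupling {q : ℝ} (hq : 0 < q) (hq1 : q < 1) (R0 : Finset ℕ) (f : List ℕ → ℝ) (j : ℕ) :
    MW q R0.card R0 f = Ex (fun _ => 1 - q) (R0 ×ˢ Finset.range j) (fun T =>
      MW q (Rset R0 T j).card (Rset R0 T j) (fun w => f (word R0 T j ++ w))) := by
  induction j with
  | zero => simp [Ex_empty, Rset, word]
  | succ j ih =>
    have h1 := col_step (1 - q) R0 j (fun T m => MW q (rem (Rset R0 T j) m).card
      (rem (Rset R0 T j) m) (fun w => f (word R0 T j ++ tl m ++ w)))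
      (fun T T' hT => by funext m; rw [Rset_congr j hT, word_congr j hT])
    simp only [← Rset_succ_rem] at h1
    simp only [word]
    rw [h1, ih]
    refine Ex_congr _ _ fun T _ => ?_
    generalize Rset R0 T j = R
    generalize word R0 T j = v
    have e0 : rem R ⊤ = R := by simp [rem]
    have e1 : ∀ i : ℕ, rem R i = R.erase i := fun i => by
      rw [rem, if_neg (WithTop.natCast_ne_top i)]; rfl
    simp only [e0, e1, tl_top, tl_coe, List.append_nil, sub_sub_cancel]
    rcases hm : R.card with _ | m
    · rw [Finset.card_eq_zero.1 hm]; simp [MW]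
    · simp only [MW]
      rw [Finset.mul_sum, ← Finset.sum_add_distrib]
      refine Finset.sum_congr rfl fun i hi => ?_
      have hc : (R.erase i).card = m := by rw [Finset.card_erase_of_mem hi, hm]; rfl
      rw [hc]
      simp only [List.append_assoc, List.singleton_append]
      have hZ : 0 < ∑ k ∈ Finset.range (m + 1), q ^ k :=
        Finset.sum_pos (fun k _ => by positivity) ⟨0, by simp⟩
      have hg := geom_p q (m + 1)
      have : (1 - q) * q ^ rk R i = (1 - q ^ (m + 1)) * (q ^ rk R i /
        ∑ k ∈ Finset.range (m + 1), q ^ k) := by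
        rw [← hg]; field_simp
      rw [this]; ring

/-- points of a word -/
def pts (w : List ℕ) : Finset (ℕ × ℕ) := (Finset.range w.length).image (fun k => (w.getD k 0, k))

theorem mem_pts {w : List ℕ} {x : ℕ × ℕ} : x ∈ pts w ↔ w[x.2]? = some x.1 := by
  unfold pts
  simp only [Finset.mem_image, Finset.mem_range, List.getD_eq_getElem?_getD]
  constructor
  · rintro ⟨k, hk, rfl⟩
    simp [List.getElem?_eq_getElem hk]
  · intro h
    have hk : x.2 < w.length := by
      by_contra hh
      rw [List.getElem?_eq_none (by omega)] at h; cases h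
    exact ⟨x.2, hk, by rw [h]; rfl⟩

theorem pts_append (w v : List ℕ) :
    pts (w ++ v) = pts w ∪ (pts v).image (fun x => (x.1, w.length + x.2)) := by
  ext ⟨a, b⟩
  simp only [Finset.mem_union, Finset.mem_image, mem_pts, Prod.mk.injEq, Prod.exists]
  by_cases hb : b < w.length
  · rw [List.getElem?_append_left hb]
    constructor
    · exact Or.inl
    · rintro (h | ⟨a', b', h, rfl, rfl⟩)
      · exact h
      · omega
  · rw [List.getElem?_append_right (by omega)]
    constructor
    · intro h; exact Or.inr ⟨a, b - w.length, h, rfl, by omega⟩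
    · rintro (h | ⟨a', b', h, rfl, rfl⟩)
      · rw [List.getElem?_eq_none (by omega)] at h; cases h
      · simpa using h

/-- chain length of a word -/
noncomputable def Lw (d : Bool) (w : List ℕ) : ℕ := L d (pts w)

theorem Lw_append_le (d : Bool) (w v : List ℕ) : Lw d (w ++ v) ≤ Lw d w + Lw d v := by
  unfold Lw
  rw [pts_append]
  refine (L_union _ _ _).trans (Nat.add_le_add_left (le_of_eq ?_) _)
  refine L_image d d _ _ (fun x _ y _ => ?_) (fun x _ y _ h => ?_)
  · simp [clt]
  · simp only [Prod.mk.injEq, Nat.add_left_cancel_iff] at h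
    exact Prod.ext h.1 h.2

theorem Lw_le_append (d : Bool) (w v : List ℕ) : Lw d w ≤ Lw d (w ++ v) := by
  unfold Lw
  rw [pts_append]; exact L_mono Finset.subset_union_left

/-- kept cells -/
def Kept (R0 : Finset ℕ) (T : Finset (ℕ × ℕ)) (M : ℕ) : Finset (ℕ × ℕ) :=
  (R0 ×ˢ Finset.range M).filter (fun x => (x.1 : WithTop ℕ) = fm (Rset R0 T x.2) T x.2)

theorem mem_Kept {R0 : Finset ℕ} {T : Finset (ℕ × ℕ)} {M : ℕ} {x : ℕ × ℕ} :
    x ∈ Kept R0 T M ↔ x.2 < M ∧ (x.1 : WithTop ℕ) = fm (Rset R0 T x.2) T x.2 := by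
  unfold Kept
  rw [Finset.mem_filter, Finset.mem_product, Finset.mem_range]
  constructor
  · rintro ⟨⟨_, h⟩, h'⟩; exact ⟨h, h'⟩
  · rintro ⟨h, h'⟩
    exact ⟨⟨Rset_subset _ _ _ (coe_eq_fm.1 h').1, h⟩, h'⟩

theorem Kept_image (R0 : Finset ℕ) (T : Finset (ℕ × ℕ)) (M : ℕ) :
    (Kept R0 T M).image (fun x => (x.1, (word R0 T x.2).length)) = pts (word R0 T M) := by
  induction M with
  | zero => simp [Kept, pts, word]
  | succ M ih =>
    simp only [word]
    rw [pts_append, ← ih]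
    rcases h : fm (Rset R0 T M) T M with _ | k
    · have : Kept R0 T (M + 1) = Kept R0 T M := by
        ext x; simp only [mem_Kept]
        constructor
        · rintro ⟨h1, h2⟩
          refine ⟨?_, h2⟩
          rcases Nat.lt_succ_iff_lt_or_eq.1 h1 with h3 | h3
          · exact h3
          · rw [h3, h] at h2; exact absurd h2 (WithTop.natCast_ne_top _)
        · rintro ⟨h1, h2⟩; exact ⟨by omega, h2⟩
      rw [this]
      change _ = _ ∪ (pts (tl ⊤)).image _
      rw [tl_top]; simp [pts]
    · have : Kept R0 T (M + 1) = Kept R0 T M ∪ {(k, M)} := by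
        ext x; simp only [mem_Kept, Finset.mem_union, Finset.mem_singleton]
        constructor
        · rintro ⟨h1, h2⟩
          rcases Nat.lt_succ_iff_lt_or_eq.1 h1 with h3 | h3
          · exact Or.inl ⟨h3, h2⟩
          · rw [h3, h] at h2; right
            exact Prod.ext (WithTop.coe_inj.1 h2) h3
        · rintro (⟨h1, h2⟩ | rfl)
          · exact ⟨by omega, h2⟩
          · exact ⟨Nat.lt_succ_self _, h.symm⟩
      rw [this, Finset.image_union]
      congr 1

theorem word_length_mono (R0 : Finset ℕ) (T : Finset (ℕ × ℕ)) {j j' : ℕ} (h : j ≤ j') :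
    (word R0 T j).length ≤ (word R0 T j').length := by
  induction h with
  | refl => exact le_rfl
  | step h ih => refine ih.trans ?_; simp [word]

theorem word_length_kept {R0 : Finset ℕ} {T : Finset (ℕ × ℕ)} {j j' k : ℕ}
    (h : (k : WithTop ℕ) = fm (Rset R0 T j) T j) (hj : j < j') :
    (word R0 T j).length < (word R0 T j').length := by
  refine lt_of_lt_of_le ?_ (word_length_mono R0 T (Nat.succ_le_of_lt hj))
  simp only [Nat.succ_eq_add_one, word]
  rw [← h, tl_coe]; simp

theorem Lw_word (d : Bool) (R0 : Finset ℕ) (T : Finset (ℕ × ℕ)) (M : ℕ) :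
    Lw d (word R0 T M) = L d (Kept R0 T M) := by
  unfold Lw
  rw [← Kept_image]
  have key : ∀ x ∈ Kept R0 T M, ∀ y ∈ Kept R0 T M,
      (x.2 < y.2 ↔ (word R0 T x.2).length < (word R0 T y.2).length) := by
    intro x hx y hy
    constructor
    · exact fun h => word_length_kept (mem_Kept.1 hx).2 h
    · intro h; by_contra hh
      have := word_length_mono R0 T (not_lt.1 hh); omega
  refine L_image d d _ _ (fun x hx y hy => ?_) (fun x hx y hy h => ?_)
  · simp only [clt]
    rw [key x hx y hy]
  · simp only [Prod.mk.injEq] at h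
    have h1 := key x hx y hy
    have h2 := key y hy x hx
    exact Prod.ext h.1 (by omega)

end ML

open Filter

namespace ML

/-- permutation with prescribed first value -/
def insPerm {n : ℕ} (k : Fin (n + 1)) (σ : Equiv.Perm (Fin n)) : Equiv.Perm (Fin (n + 1)) :=
  (finSuccEquiv' 0).trans ((Equiv.optionCongr σ).trans (finSuccEquiv' k).symm)

theorem insPerm_zero {n : ℕ} (k : Fin (n + 1)) (σ : Equiv.Perm (Fin n)) : insPerm k σ 0 = k := by
  simp [insPerm]

theorem insPerm_succ {n : ℕ} (k : Fin (n + 1)) (σ : Equiv.Perm (Fin n)) (i : Fin n) :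
    insPerm k σ i.succ = k.succAbove (σ i) := by
  have : (i.succ) = (0 : Fin (n + 1)).succAbove i := by simp
  simp only [insPerm, Equiv.trans_apply]
  rw [this, finSuccEquiv'_succAbove]; simp

theorem insPerm_bij (n : ℕ) : Function.Bijective
    (fun x : Fin (n + 1) × Equiv.Perm (Fin n) => insPerm x.1 x.2) := by
  rw [Fintype.bijective_iff_injective_and_card]
  constructor
  · rintro ⟨k, σ⟩ ⟨k', σ'⟩ h
    simp only at h
    have h0 : k = k' := by rw [← insPerm_zero k σ, h, insPerm_zero]
    subst h0
    congr 1
    ext i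
    have := congrArg (fun π => π i.succ) h
    simp only [insPerm_succ] at this
    rw [Fin.succAbove_right_injective this]
  · simp [Fintype.card_perm, Nat.factorial_succ]

theorem card_lt_fin {n : ℕ} (k : Fin n) : (Finset.univ.filter (fun i => i < k)).card = (k : ℕ) := by
  have : Finset.univ.filter (fun i => i < k) = Finset.Iio k := by ext; simp
  rw [this, Fin.card_Iio]

theorem L_image_anti (d d' : Bool) (P : Finset (ℕ × ℕ)) (e : ℕ × ℕ → ℕ × ℕ)
    (he : ∀ x ∈ P, ∀ y ∈ P, clt d x y ↔ clt d' (e y) (e x)) (hi : Set.InjOn e P) :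
    L d' (P.image e) = L d P := by
  classical
  apply le_antisymm
  · rw [L_le_iff]
    intro X hX hc
    obtain ⟨Y, hY, rfl⟩ := Finset.subset_image_iff.1 hX
    rw [Finset.card_image_of_injOn (hi.mono hY)]
    refine le_L hY fun x hx y hy hne => ?_
    rw [he x (hY hx) y (hY hy), he y (hY hy) x (hY hx)]
    exact hc _ (Finset.mem_image_of_mem _ hy) _ (Finset.mem_image_of_mem _ hx)
      fun h => hne (hi (hY hx) (hY hy) h.symm)
  · rw [L_le_iff]
    intro X hX hc
    rw [← Finset.card_image_of_injOn (hi.mono hX)]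
    refine le_L (Finset.image_subset_image hX) ?_
    intro x hx y hy hne
    obtain ⟨x', hx', rfl⟩ := Finset.mem_image.1 hx
    obtain ⟨y', hy', rfl⟩ := Finset.mem_image.1 hy
    rw [← he _ (hX hx') _ (hX hy'), ← he _ (hX hy') _ (hX hx')]
    exact hc _ hy' _ hx' fun h => hne (by rw [h])

theorem inv_insPerm {n : ℕ} (k : Fin (n + 1)) (σ : Equiv.Perm (Fin n)) :
    inversions (insPerm k σ) = k + inversions σ := by
  unfold inversions
  have e : (Finset.univ.filter (fun p : Fin (n + 1) × Fin (n + 1) => p.1 < p.2 ∧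
      insPerm k σ p.2 < insPerm k σ p.1)) =
      ((Finset.univ.filter (fun i : Fin n => k.succAbove (σ i) < k)).image (fun i => ((0 : Fin (n + 1)), i.succ))) ∪
      ((Finset.univ.filter (fun p : Fin n × Fin n => p.1 < p.2 ∧ σ p.2 < σ p.1)).image
        (fun p => (p.1.succ, p.2.succ))) := by
    ext ⟨a, b⟩
    simp only [Finset.mem_filter, Finset.mem_univ, true_and, Finset.mem_union, Finset.mem_image,
      Prod.mk.injEq, Prod.exists]
    refine Fin.cases ?_ (fun b => ?_) b
    · simp
    refine Fin.cases ?_ (fun a => ?_) a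
    · simp [insPerm_zero, insPerm_succ, Fin.succ_ne_zero, eq_comm]
    · simp only [insPerm_succ, Fin.succ_lt_succ_iff, Fin.succAbove_lt_succAbove_iff, Fin.succ_inj]
      constructor
      · intro h; exact Or.inr ⟨a, b, h, rfl, rfl⟩
      · rintro (⟨i, _, h, _⟩ | ⟨a', b', h, rfl, rfl⟩)
        · exact absurd h.symm (Fin.succ_ne_zero _)
        · exact h
  rw [e, Finset.card_union_of_disjoint, Finset.card_image_of_injective, Finset.card_image_of_injective]
  · congr 1
    have h1 : (Finset.univ.filter (fun i : Fin n => k.succAbove (σ i) < k)).card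
        = (Finset.univ.filter (fun i : Fin n => k.succAbove i < k)).card := by
      refine Finset.card_bij (fun i _ => σ i) ?_ ?_ ?_
      · intro i hi; simpa using hi
      · intro i _ j _ h; exact σ.injective h
      · intro i hi; exact ⟨σ.symm i, by simpa using hi, by simp⟩
    rw [h1]
    have h2 : (Finset.univ.filter (fun i : Fin n => k.succAbove i < k)).image k.succAbove
        = Finset.univ.filter (fun i => i < k) := by
      ext x
      simp only [Finset.mem_image, Finset.mem_filter, Finset.mem_univ, true_and]
      constructor
      · rintro ⟨i, h, rfl⟩; exact h
      · intro h
        obtain ⟨i, hi⟩ := Fin.exists_succAbove_eq h.ne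
        exact ⟨i, by rw [hi]; exact h, hi⟩
    rw [← Finset.card_image_of_injective _ (Fin.succAbove_right_injective (p := k)), h2, card_lt_fin]
  · rintro ⟨a, b⟩ ⟨a', b'⟩ h; simpa using h
  · intro a b h; simpa using h
  · rw [Finset.disjoint_left]
    rintro ⟨a, b⟩ h1 h2
    simp only [Finset.mem_image, Prod.mk.injEq] at h1 h2
    obtain ⟨i, _, h, _⟩ := h1
    obtain ⟨j, _, h', _⟩ := h2
    rw [← h] at h'
    exact Fin.succ_ne_zero _ h'

theorem MW_perm {q : ℝ} (hq : 0 < q) (n : ℕ) (e : Fin n → ℕ) (he : StrictMono e)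
    (f : List ℕ → ℝ) :
    MW q n (Finset.univ.image e) f * (∑ π : Equiv.Perm (Fin n), q ^ inversions π)
      = ∑ π : Equiv.Perm (Fin n), q ^ inversions π * f (List.ofFn (fun i => e (π i))) := by
  induction n generalizing f with
  | zero => simp [MW, mul_comm]
  | succ n ih =>
    have hs : ∀ F : Equiv.Perm (Fin (n + 1)) → ℝ, ∑ π, F π
        = ∑ k : Fin (n + 1), ∑ σ : Equiv.Perm (Fin n), F (insPerm k σ) := by
      intro F
      rw [← Finset.sum_product', Finset.univ_product_univ]
      exact (Function.Bijective.sum_comp (insPerm_bij n) F).symm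
    rw [hs, hs]
    simp only [inv_insPerm, pow_add]
    simp only [MW]
    rw [Finset.sum_image (fun a _ b _ h => he.injective h)]
    simp only [← Finset.mul_sum]
    rw [← Finset.sum_mul]
    have hZ : ∑ k ∈ Finset.range (n + 1), q ^ k = ∑ k : Fin (n + 1), q ^ (k : ℕ) :=
      (Fin.sum_univ_eq_sum_range (fun k => q ^ k) (n + 1)).symm
    have hZ0 : 0 < ∑ k ∈ Finset.range (n + 1), q ^ k :=
        Finset.sum_pos (fun k _ => by positivity) ⟨0, by simp⟩
    rw [← hZ, Finset.sum_mul]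
    refine Finset.sum_congr rfl fun k _ => ?_
    have h1 : rk (Finset.univ.image e) (e k) = k := by
      unfold rk
      have : (Finset.univ.image e).filter (· < e k) = (Finset.univ.filter (· < k)).image e := by
        ext x
        simp only [Finset.mem_filter, Finset.mem_image, Finset.mem_univ, true_and]
        constructor
        · rintro ⟨⟨i, rfl⟩, h⟩; exact ⟨i, he.lt_iff_lt.1 h, rfl⟩
        · rintro ⟨i, h, rfl⟩; exact ⟨⟨i, rfl⟩, he.lt_iff_lt.2 h⟩
      rw [this, Finset.card_image_of_injective _ he.injective, card_lt_fin]
    have h2 : (Finset.univ.image e).erase (e k) = Finset.univ.image (fun i => e (k.succAbove i)) := by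
      ext x
      simp only [Finset.mem_erase, Finset.mem_image, Finset.mem_univ, true_and]
      constructor
      · rintro ⟨hx, i, rfl⟩
        have : i ≠ k := fun h => hx (by rw [h])
        obtain ⟨j, hj⟩ := Fin.exists_succAbove_eq this
        exact ⟨j, by rw [hj]⟩
      · rintro ⟨i, rfl⟩
        exact ⟨fun h => Fin.succAbove_ne k i (he.injective h), _, rfl⟩
    have h3 := ih (fun i => e (k.succAbove i)) (he.comp (Fin.strictMono_succAbove k))
      (fun w => f (e k :: w))
    rw [h1, h2]
    have h4 : ∀ σ : Equiv.Perm (Fin n), f (List.ofFn (fun i => e (insPerm k σ i)))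
        = f (e k :: List.ofFn (fun i => e (k.succAbove (σ i)))) := by
      intro σ
      rw [List.ofFn_succ]
      simp only [insPerm_zero, insPerm_succ]
    simp only [h4]
    have h5 : ∑ σ : Equiv.Perm (Fin n), q ^ (k : ℕ) * q ^ inversions σ *
        f (e k :: List.ofFn (fun i => e (k.succAbove (σ i)))) = q ^ (k : ℕ) *
        ∑ σ : Equiv.Perm (Fin n), q ^ inversions σ *
        f (e k :: List.ofFn (fun i => e (k.succAbove (σ i)))) := by
      rw [Finset.mul_sum]; exact Finset.sum_congr rfl fun _ _ => by ring
    rw [h5, ← h3]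
    field_simp

theorem mem_pts_ofFn {n : ℕ} (g : Fin n → ℕ) (x : ℕ × ℕ) :
    x ∈ pts (List.ofFn g) ↔ ∃ k : Fin n, x = (g k, (k : ℕ)) := by
  rw [mem_pts, List.getElem?_ofFn]
  constructor
  · intro h
    split_ifs at h with hk
    exact ⟨⟨x.2, hk⟩, Prod.ext (Option.some.inj h).symm rfl⟩
  · rintro ⟨k, rfl⟩
    simp

theorem lis_eq {n : ℕ} (π : Equiv.Perm (Fin n)) :
    lisLength π = Lw true (List.ofFn (fun i => ((π i : Fin n) : ℕ))) := by
  classical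
  apply le_antisymm
  · unfold lisLength
    refine Finset.sup_le fun s _ => ?_
    split_ifs with h
    · have hi : Function.Injective (fun k : Fin n => (((π k : Fin n) : ℕ), (k : ℕ))) := by
        intro a b hab; simp only [Prod.mk.injEq] at hab; exact Fin.ext hab.2
      rw [← Finset.card_image_of_injective s hi]
      refine le_L ?_ ?_
      · intro x hx
        obtain ⟨k, _, rfl⟩ := Finset.mem_image.1 hx
        rw [mem_pts_ofFn]; exact ⟨k, rfl⟩
      · intro x hx y hy hne
        obtain ⟨k, hk, rfl⟩ := Finset.mem_image.1 hx
        obtain ⟨l, hl, rfl⟩ := Finset.mem_image.1 hy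
        have hkl : k ≠ l := fun e => hne (by rw [e])
        rcases lt_or_gt_of_ne hkl with h1 | h1
        · left; exact ⟨h1, by simpa [rel] using h k hk l hl h1⟩
        · right; exact ⟨h1, by simpa [rel] using h l hl k hk h1⟩
    · exact Nat.zero_le _
  · obtain ⟨X, hX, hch, hc⟩ := exists_L true (pts (List.ofFn (fun i => ((π i : Fin n) : ℕ))))
    change L true _ ≤ _
    rw [← hc]
    set s : Finset (Fin n) := Finset.univ.filter (fun k => (((π k : Fin n) : ℕ), (k : ℕ)) ∈ X)
    have hXs : X ⊆ s.image (fun k : Fin n => (((π k : Fin n) : ℕ), (k : ℕ))) := by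
      intro x hx
      obtain ⟨k, rfl⟩ := (mem_pts_ofFn _ _).1 (hX hx)
      exact Finset.mem_image.2 ⟨k, by simpa [s] using hx, rfl⟩
    refine (Finset.card_le_card hXs).trans (Finset.card_image_le.trans ?_)
    have hs : ∀ i ∈ s, ∀ j ∈ s, i < j → π i < π j := by
      intro i hi j hj hij
      simp only [s, Finset.mem_filter, Finset.mem_univ, true_and] at hi hj
      rcases hch _ hi _ hj (by intro e; simp only [Prod.mk.injEq] at e; omega) with h | h
      · simpa [clt, rel] using h.2
      · have := h.1; simp only at this; omega
    have := Finset.le_sup (f := fun s : Finset (Fin n) =>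
      if ∀ i ∈ s, ∀ j ∈ s, i < j → π i < π j then s.card else 0) (Finset.mem_powerset.2 (Finset.subset_univ s))
    simp only [if_pos hs] at this
    exact this

theorem Lw_rev {n : ℕ} (π : Equiv.Perm (Fin n)) :
    Lw true (List.ofFn (fun i => ((π (Fin.rev i) : Fin n) : ℕ)))
      = Lw false (List.ofFn (fun i => ((π i : Fin n) : ℕ))) := by
  unfold Lw
  have : pts (List.ofFn (fun i => ((π (Fin.rev i) : Fin n) : ℕ)))
      = (pts (List.ofFn (fun i => ((π i : Fin n) : ℕ)))).image (fun x => (x.1, n - 1 - x.2)) := by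
    ext x
    rw [mem_pts_ofFn, Finset.mem_image]
    constructor
    · rintro ⟨k, rfl⟩
      refine ⟨_, (mem_pts_ofFn _ _).2 ⟨Fin.rev k, rfl⟩, ?_⟩
      simp only [Prod.mk.injEq, Fin.val_rev, true_and]; omega
    · rintro ⟨y, hy, rfl⟩
      obtain ⟨k, rfl⟩ := (mem_pts_ofFn _ _).1 hy
      refine ⟨Fin.rev k, ?_⟩
      simp only [Fin.rev_rev, Prod.mk.injEq, Fin.val_rev, true_and]; omega
  rw [this]
  refine L_image_anti false true _ _ (fun x hx y hy => ?_) (fun x hx y hy h => ?_)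
  · obtain ⟨k, rfl⟩ := (mem_pts_ofFn _ _).1 hx
    obtain ⟨l, rfl⟩ := (mem_pts_ofFn _ _).1 hy
    simp only [clt, rel]; simp; omega
  · obtain ⟨k, rfl⟩ := (mem_pts_ofFn _ _).1 hx
    obtain ⟨l, rfl⟩ := (mem_pts_ofFn _ _).1 hy
    simp only [Prod.mk.injEq] at h ⊢
    omega

theorem mallows_MW {q : ℝ} (hq : 0 < q) (n : ℕ) (E : ℕ → Prop) [DecidablePred E] :
    mallowsProb n q {π | E (lisLength π)}
      = MW q n (Finset.range n) (fun w => if E (Lw true w) then 1 else 0) := by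
  classical
  have h := MW_perm hq n (fun i : Fin n => (i : ℕ)) (fun a b h => h)
    (fun w => if E (Lw true w) then 1 else 0)
  have hr : Finset.univ.image (fun i : Fin n => (i : ℕ)) = Finset.range n := by
    ext x; simp only [Finset.mem_image, Finset.mem_univ, true_and, Finset.mem_range]
    exact ⟨fun ⟨i, hi⟩ => hi ▸ i.2, fun hx => ⟨⟨x, hx⟩, rfl⟩⟩
  rw [hr] at h
  have hZ : 0 < ∑ π : Equiv.Perm (Fin n), q ^ inversions π :=
    Finset.sum_pos (fun _ _ => by positivity) Finset.univ_nonempty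
  unfold mallowsProb
  rw [div_eq_iff hZ.ne', h]
  refine Finset.sum_congr rfl fun π _ => ?_
  rw [Set.indicator_apply]
  simp only [Set.mem_ofPred_eq, ← lis_eq]
  split_ifs <;> simp

theorem inv_rev {n : ℕ} (π : Equiv.Perm (Fin n)) :
    inversions (Fin.revPerm.trans π) + inversions π
      = (Finset.univ.filter (fun p : Fin n × Fin n => p.1 < p.2)).card := by
  unfold inversions
  have e : (Finset.univ.filter (fun p : Fin n × Fin n => p.1 < p.2 ∧
      (Fin.revPerm.trans π) p.2 < (Fin.revPerm.trans π) p.1)).card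
      = (Finset.univ.filter (fun p : Fin n × Fin n => p.1 < p.2 ∧ ¬ π p.2 < π p.1)).card := by
    refine Finset.card_bij (fun p _ => (Fin.rev p.2, Fin.rev p.1)) ?_ ?_ ?_
    · rintro ⟨a, b⟩ h
      simp at h ⊢
      exact ⟨h.1, h.2.le⟩
    · rintro ⟨a, b⟩ _ ⟨a', b'⟩ _ h
      simp only [Prod.mk.injEq, Fin.rev_inj] at h ⊢
      exact ⟨h.2, h.1⟩
    · rintro ⟨a, b⟩ h
      simp at h
      refine ⟨(Fin.rev b, Fin.rev a), ?_, by simp⟩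
      simp
      exact ⟨h.1, lt_of_le_of_ne h.2 fun e => h.1.ne (π.injective e)⟩
  rw [e, add_comm, ← Finset.filter_filter, ← Finset.filter_filter]
  exact Finset.card_filter_add_card_filter_not _

theorem mallows_MW_rev {q : ℝ} (hq : 0 < q) (n : ℕ) (E : ℕ → Prop) [DecidablePred E] :
    mallowsProb n q {π | E (lisLength π)}
      = MW q⁻¹ n (Finset.range n) (fun w => if E (Lw false w) then 1 else 0) := by
  classical
  have hq' : 0 < q⁻¹ := inv_pos.2 hq
  have h := MW_perm hq' n (fun i : Fin n => (i : ℕ)) (fun a b h => h)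
    (fun w => if E (Lw false w) then 1 else 0)
  have hr : Finset.univ.image (fun i : Fin n => (i : ℕ)) = Finset.range n := by
    ext x; simp only [Finset.mem_image, Finset.mem_univ, true_and, Finset.mem_range]
    exact ⟨fun ⟨i, hi⟩ => hi ▸ i.2, fun hx => ⟨⟨x, hx⟩, rfl⟩⟩
  rw [hr] at h
  have hZ : 0 < ∑ π : Equiv.Perm (Fin n), q⁻¹ ^ inversions π :=
    Finset.sum_pos (fun _ _ => by positivity) Finset.univ_nonempty
  have hre : ∀ F : Equiv.Perm (Fin n) → ℝ, ∑ π, F π = ∑ π, F (Fin.revPerm.trans π) := by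
    intro F
    refine (Function.Bijective.sum_comp (g := F) (e := fun π => Fin.revPerm.trans π) ⟨?_, ?_⟩).symm
    · intro a b hab
      ext i
      have := congrArg (fun σ => σ (Fin.rev i)) hab
      simpa using congrArg Fin.val this
    · intro b
      refine ⟨Fin.revPerm.trans b, ?_⟩
      ext i; simp
  unfold mallowsProb
  rw [hre (fun π => q ^ inversions π), hre (fun π => Set.indicator _ _ π)]
  set C := (Finset.univ.filter (fun p : Fin n × Fin n => p.1 < p.2)).card with hC
  have hpow : ∀ π : Equiv.Perm (Fin n), q ^ inversions (Fin.revPerm.trans π)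
      = q ^ C * q⁻¹ ^ inversions π := by
    intro π
    rw [hC, ← inv_rev π, pow_add, inv_pow, mul_assoc, mul_inv_cancel₀ (by positivity), mul_one]
  have h2 : ∑ π : Equiv.Perm (Fin n), q ^ inversions (Fin.revPerm.trans π)
      = q ^ C * ∑ π : Equiv.Perm (Fin n), q⁻¹ ^ inversions π := by
    rw [Finset.mul_sum]; exact Finset.sum_congr rfl fun π _ => hpow π
  rw [h2, div_eq_iff (mul_pos (pow_pos hq _) hZ).ne', mul_left_comm, h, Finset.mul_sum]
  refine Finset.sum_congr rfl fun π _ => ?_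
  rw [Set.indicator_apply]
  have h3 : lisLength (Fin.revPerm.trans π) = Lw false (List.ofFn (fun i => ((π i : Fin n) : ℕ))) := by
    rw [lis_eq, ← Lw_rev]; rfl
  simp only [Set.mem_ofPred_eq, h3]
  rw [hpow]
  split_ifs <;> simp

end ML

open Filter

namespace ML

/-- boxes -/
def Qb (i1 i2 j1 j2 : ℕ) : Finset (ℕ × ℕ) := Finset.Ico i1 i2 ×ˢ Finset.Ico j1 j2

/-- available rows of the box -/
def Ab (n i1 i2 j1 : ℕ) (T : Finset (ℕ × ℕ)) : Finset ℕ :=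
  (Rset (Finset.range n) T j1).filter (fun i => i1 ≤ i ∧ i < i2)

/-- available columns of the box -/
def Bb (i1 j1 j2 : ℕ) (T : Finset (ℕ × ℕ)) : Finset ℕ :=
  (Finset.Ico j1 j2).filter (fun j => fm (Rset (Finset.range i1) T j) T j = ⊤)

theorem mem_Qb {i1 i2 j1 j2 : ℕ} {x : ℕ × ℕ} :
    x ∈ Qb i1 i2 j1 j2 ↔ (i1 ≤ x.1 ∧ x.1 < i2) ∧ (j1 ≤ x.2 ∧ x.2 < j2) := by
  simp [Qb, Finset.mem_product]

theorem Rset_range {n i : ℕ} (h : i ≤ n) (T : Finset (ℕ × ℕ)) (j : ℕ) :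
    Rset (Finset.range i) T j = (Rset (Finset.range n) T j).filter (· < i) := by
  rw [← Rset_filter]; congr 1
  ext x; simp; omega

theorem AB_sub (n i1 i2 j1 j2 : ℕ) (T : Finset (ℕ × ℕ)) :
    Ab n i1 i2 j1 T ×ˢ Bb i1 j1 j2 T ⊆ Qb i1 i2 j1 j2 := by
  intro x hx
  rw [Finset.mem_product, Ab, Bb, Finset.mem_filter, Finset.mem_filter, Finset.mem_Ico] at hx
  rw [mem_Qb]; tauto

theorem Ab_sdiff (n i1 i2 j1 j2 : ℕ) (T : Finset (ℕ × ℕ)) :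
    Ab n i1 i2 j1 (T \ Qb i1 i2 j1 j2) = Ab n i1 i2 j1 T := by
  unfold Ab
  rw [Rset_congr j1]
  intro i _ k hk
  rw [Finset.mem_sdiff, mem_Qb]
  simp only; constructor
  · exact And.left
  · intro h; exact ⟨h, by omega⟩

theorem Bb_sdiff (i1 i2 j1 j2 : ℕ) (T : Finset (ℕ × ℕ)) :
    Bb i1 j1 j2 (T \ Qb i1 i2 j1 j2) = Bb i1 j1 j2 T := by
  unfold Bb
  refine Finset.filter_congr fun j _ => ?_
  have h : ∀ i ∈ Finset.range i1, ∀ k, ((i, k) ∈ T \ Qb i1 i2 j1 j2 ↔ (i, k) ∈ T) := by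
    intro i hi k
    rw [Finset.mem_range] at hi
    rw [Finset.mem_sdiff, mem_Qb]
    simp only; constructor
    · exact And.left
    · intro h; exact ⟨h, by omega⟩
  rw [Rset_congr j fun i hi k _ => h i hi k, fm_congr fun i hi => h i (Rset_subset _ _ _ hi) j]

theorem card_Ab {n i1 i2 j1 : ℕ} (h : i1 ≤ i2) (h2 : i2 ≤ n) (T : Finset (ℕ × ℕ)) :
    (Ab n i1 i2 j1 T).card + (Rset (Finset.range i1) T j1).card
      = (Rset (Finset.range i2) T j1).card := by
  rw [Rset_range (h.trans h2), Rset_range h2, Ab, ← Finset.card_union_of_disjoint]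
  · congr 1; ext x; simp only [Finset.mem_union, Finset.mem_filter]
    constructor
    · rintro (⟨a, b⟩ | ⟨a, b⟩) <;> exact ⟨a, by omega⟩
    · rintro ⟨a, b⟩
      by_cases hx : x < i1
      · exact Or.inr ⟨a, hx⟩
      · exact Or.inl ⟨a, by omega, b⟩
  · rw [Finset.disjoint_left]; intro x hx hx'
    rw [Finset.mem_filter] at hx hx'; omega

theorem card_Bb (i1 j1 j2 : ℕ) (h : j1 ≤ j2) (T : Finset (ℕ × ℕ)) :
    (Bb i1 j1 j2 T).card + (Rset (Finset.range i1) T j1).card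
      = (j2 - j1) + (Rset (Finset.range i1) T j2).card := by
  induction h with
  | refl => simp [Bb]
  | @step m hm ih =>
    have hm' : j1 ≤ m := hm
    have h1 := Rset_card_succ (Finset.range i1) T m
    have h2 : (Bb i1 j1 (m + 1) T).card = (Bb i1 j1 m T).card +
        (if fm (Rset (Finset.range i1) T m) T m = ⊤ then 1 else 0) := by
      unfold Bb
      rw [← Finset.insert_Ico_right_eq_Ico_add_one hm', Finset.filter_insert]
      split_ifs with hh
      · rw [Finset.card_insert_of_notMem (by simp)]
      · rfl
    rw [Nat.succ_eq_add_one, h2]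
    split_ifs at h1 ⊢ <;> omega

theorem Kept_sub_AB {n M i1 i2 j1 j2 : ℕ} (hi : i1 ≤ n) (T : Finset (ℕ × ℕ)) :
    Kept (Finset.range n) T M ∩ Qb i1 i2 j1 j2 ⊆ T ∩ (Ab n i1 i2 j1 T ×ˢ Bb i1 j1 j2 T) := by
  intro x hx
  rw [Finset.mem_inter, mem_Kept, mem_Qb, coe_eq_fm] at hx
  obtain ⟨⟨_, h1, h2, h3⟩, h4, h5⟩ := hx
  rw [Finset.mem_inter, Finset.mem_product, Ab, Bb, Finset.mem_filter, Finset.mem_filter,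
    Finset.mem_Ico, fm_eq_top]
  refine ⟨h2, ⟨Rset_anti _ _ h5.1 h1, h4⟩, h5, fun i hi' hT => ?_⟩
  rw [Rset_range hi, Finset.mem_filter] at hi'
  have := h3 i hi'.1 hT
  omega

/-- cells sharing a row with another cell -/
def Drow (P : Finset (ℕ × ℕ)) : Finset (ℕ × ℕ) :=
  P.filter (fun x => ∃ y ∈ P, y.1 = x.1 ∧ y.2 ≠ x.2)

/-- cells sharing a column with another cell -/
def Dcol (P : Finset (ℕ × ℕ)) : Finset (ℕ × ℕ) :=
  P.filter (fun x => ∃ y ∈ P, y.2 = x.2 ∧ y.1 ≠ x.1)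

theorem AB_sub_Kept {n M i1 i2 j1 j2 : ℕ} (hi : i1 ≤ n) (hM : j2 ≤ M)
    (T : Finset (ℕ × ℕ)) :
    T ∩ (Ab n i1 i2 j1 T ×ˢ Bb i1 j1 j2 T) ⊆ (Kept (Finset.range n) T M ∩ Qb i1 i2 j1 j2) ∪
      (Drow (T ∩ Qb i1 i2 j1 j2) ∪ Dcol (T ∩ Qb i1 i2 j1 j2)) := by
  rintro ⟨i, j⟩ hx
  rw [Finset.mem_inter] at hx
  have hQ := AB_sub _ _ _ _ _ _ hx.2
  have hQ' := hQ
  rw [mem_Qb] at hQ'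
  obtain ⟨hxT, hxAB⟩ := hx
  rw [Finset.mem_product, Ab, Bb, Finset.mem_filter, Finset.mem_filter, fm_eq_top] at hxAB
  obtain ⟨⟨hA, _⟩, _, hB⟩ := hxAB
  simp only at hA hB hQ'
  by_cases hk : (i, j) ∈ Kept (Finset.range n) T M
  · exact Finset.mem_union_left _ (Finset.mem_inter.2 ⟨hk, hQ⟩)
  refine Finset.mem_union_right _ ?_
  rw [mem_Kept] at hk
  have hk' : ¬ ((i : WithTop ℕ) = fm (Rset (Finset.range n) T j) T j) := fun h =>
    hk ⟨by simp only; omega, h⟩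
  by_cases hR : i ∈ Rset (Finset.range n) T j
  · refine Finset.mem_union_right _ ?_
    rcases h : fm (Rset (Finset.range n) T j) T j with _ | k
    · exact absurd hxT (fm_eq_top.1 h i hR)
    · have h' := coe_eq_fm.1 (h.symm)
      have hki : k ≤ i := h'.2.2 i hR hxT
      have hne : k ≠ i := fun e => hk' (by rw [h, e]; rfl)
      have hk1 : i1 ≤ k := by
        by_contra hlt
        exact hB k (by rw [Rset_range hi, Finset.mem_filter]; exact ⟨h'.1, by omega⟩) h'.2.1
      rw [Dcol, Finset.mem_filter]
      refine ⟨Finset.mem_inter.2 ⟨hxT, hQ⟩, (k, j), Finset.mem_inter.2 ⟨h'.2.1, ?_⟩, rfl, hne⟩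
      rw [mem_Qb]; simp only; omega
  · refine Finset.mem_union_left _ ?_
    have : ∃ j', j1 ≤ j' ∧ j' < j ∧ (i : WithTop ℕ) = fm (Rset (Finset.range n) T j') T j' := by
      by_contra hcon
      push Not at hcon
      apply hR
      have : ∀ m, j1 ≤ m → m ≤ j → i ∈ Rset (Finset.range n) T m := by
        intro m hm
        induction hm with
        | refl => intro _; exact hA
        | @step m hm ih =>
          intro hmj
          rw [Nat.succ_eq_add_one, Rset, Finset.mem_filter]
          exact ⟨ih (by omega), hcon m hm (by omega)⟩
      exact this j (by omega) le_rfl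
    obtain ⟨j', h1, h2, h3⟩ := this
    have h' := coe_eq_fm.1 h3
    rw [Drow, Finset.mem_filter]
    refine ⟨Finset.mem_inter.2 ⟨hxT, hQ⟩, (i, j'), Finset.mem_inter.2 ⟨h'.2.1, ?_⟩, rfl,
      by simp only; omega⟩
    rw [mem_Qb]; simp only; omega

theorem box_cond {p ε : ℝ} (hp : 0 ≤ p) (hp1 : p ≤ 1) (hε : 0 ≤ ε) (S Q : Finset (ℕ × ℕ))
    (hQ : Q ⊆ S) (A B : Finset (ℕ × ℕ) → Finset ℕ) (hA : ∀ T, A (T \ Q) = A T)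
    (hB : ∀ T, B (T \ Q) = B T) (hAB : ∀ T, A T ×ˢ B T ⊆ Q) (good : Finset ℕ → Finset ℕ → Prop)
    (E : Finset ℕ → Finset ℕ → Finset (ℕ × ℕ) → Prop)
    (h : ∀ A B, good A B → Pr (fun _ => p) (A ×ˢ B) (E A B) ≤ ε) :
    Pr (fun _ => p) S (fun T => good (A T) (B T) ∧ E (A T) (B T) (T ∩ (A T ×ˢ B T))) ≤ ε := by
  classical
  have hS : S = (S \ Q) ∪ Q := by rw [Finset.sdiff_union_of_subset hQ]
  unfold Pr
  rw [hS, Ex_union _ _ _ Finset.sdiff_disjoint]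
  refine (Ex_mono (g := fun _ => ε) _ _ (fun _ _ => ⟨hp, hp1⟩) ?_).trans (Ex_const _ _ _).le
  intro T₁ hT₁
  have e1 : ∀ T₂, T₂ ⊆ Q → (T₁ ∪ T₂) \ Q = T₁ := by
    intro T₂ hT₂
    rw [Finset.union_sdiff_distrib, Finset.sdiff_eq_empty_iff_subset.2 hT₂, Finset.union_empty]
    ext x; rw [Finset.mem_sdiff]
    exact ⟨And.left, fun h => ⟨h, (Finset.mem_sdiff.1 (hT₁ h)).2⟩⟩
  have e2 : ∀ T₂, T₂ ⊆ Q → A (T₁ ∪ T₂) = A T₁ := fun T₂ h2 => by rw [← hA (T₁ ∪ T₂), e1 T₂ h2]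
  have e3 : ∀ T₂, T₂ ⊆ Q → B (T₁ ∪ T₂) = B T₁ := fun T₂ h2 => by rw [← hB (T₁ ∪ T₂), e1 T₂ h2]
  have e4 : ∀ T₂, T₂ ⊆ Q → (T₁ ∪ T₂) ∩ (A T₁ ×ˢ B T₁) = T₂ ∩ (A T₁ ×ˢ B T₁) := by
    intro T₂ _
    ext x; simp only [Finset.mem_inter, Finset.mem_union]
    constructor
    · rintro ⟨h1 | h1, h2⟩
      · exact absurd (hAB T₁ h2) (Finset.mem_sdiff.1 (hT₁ h1)).2
      · exact ⟨h1, h2⟩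
    · rintro ⟨h1, h2⟩; exact ⟨Or.inr h1, h2⟩
  change Pr (fun _ => p) Q (fun T₂ => good (A (T₁ ∪ T₂)) (B (T₁ ∪ T₂)) ∧
    E (A (T₁ ∪ T₂)) (B (T₁ ∪ T₂)) ((T₁ ∪ T₂) ∩ (A (T₁ ∪ T₂) ×ˢ B (T₁ ∪ T₂)))) ≤ ε
  by_cases hg : good (A T₁) (B T₁)
  · rw [Pr_congr (F := fun T₂ => E (A T₁) (B T₁) (T₂ ∩ (A T₁ ×ˢ B T₁)))
      (fun T₂ h2 => by rw [e2 T₂ h2, e3 T₂ h2, e4 T₂ h2]; tauto)]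
    rw [Pr_inter _ _ _ (hAB T₁)]
    exact h _ _ hg
  · rw [Pr_congr (F := fun _ => False) (fun T₂ h2 => by rw [e2 T₂ h2, e3 T₂ h2]; tauto)]
    unfold Pr; simp [Ex_const, hε]

theorem chain_rank {d : Bool} {X : Finset (ℕ × ℕ)} (h : IsCh d X) :
    Set.InjOn Prod.fst (X : Set (ℕ × ℕ)) ∧ Set.InjOn Prod.snd (X : Set (ℕ × ℕ)) := by
  constructor
  · intro x hx y hy hxy
    by_contra hne
    rcases h x hx y hy hne with h | h
    · have := h.2; rw [hxy] at this; exact rel_irrefl _ _ this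
    · have := h.2; rw [hxy] at this; exact rel_irrefl _ _ this
  · intro x hx y hy hxy
    by_contra hne
    rcases h x hx y hy hne with h | h
    · have := h.1; omega
    · have := h.1; omega

open Classical in
theorem chain_det {d : Bool} {X Y : Finset (ℕ × ℕ)} (hX : IsCh d X) (hY : IsCh d Y)
    (h1 : X.image Prod.fst = Y.image Prod.fst) (h2 : X.image Prod.snd = Y.image Prod.snd) :
    X ⊆ Y := by
  have key : ∀ Z : Finset (ℕ × ℕ), IsCh d Z → ∀ x ∈ Z,
      ((Z.image Prod.snd).filter (· < x.2)).card = ((Z.image Prod.fst).filter (rel d · x.1)).card := by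
    intro Z hZ x hx
    have e1 : (Z.image Prod.snd).filter (· < x.2) = (Z.filter (fun y => y.2 < x.2)).image Prod.snd := by
      rw [Finset.filter_image]
    have e2 : (Z.image Prod.fst).filter (rel d · x.1) =
        (Z.filter (fun y => rel d y.1 x.1)).image Prod.fst := by
      rw [Finset.filter_image]
    rw [e1, e2, Finset.card_image_of_injOn ((chain_rank hZ).2.mono (Finset.filter_subset _ _)),
      Finset.card_image_of_injOn ((chain_rank hZ).1.mono (Finset.filter_subset _ _))]
    congr 1
    refine Finset.filter_congr fun y hy => ?_
    by_cases hxy : y = x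
    · subst hxy; simp [rel_irrefl]
    · rcases hZ y hy x hx hxy with h | h
      · exact ⟨fun _ => h.2, fun _ => h.1⟩
      · constructor
        · intro h'; have := h.1; omega
        · intro h'; exact absurd (rel_trans h' h.2) (rel_irrefl _ _)
  intro x hx
  have hx2 : x.2 ∈ Y.image Prod.snd := by rw [← h2]; exact Finset.mem_image_of_mem _ hx
  obtain ⟨y, hy, hyx⟩ := Finset.mem_image.1 hx2
  have k1 := key X hX x hx
  have k2 := key Y hY y hy
  rw [hyx, ← h2, k1, ← h1] at k2
  have hx1 : x.1 ∈ X.image Prod.fst := Finset.mem_image_of_mem _ hx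
  have hy1 : y.1 ∈ X.image Prod.fst := by rw [h1]; exact Finset.mem_image_of_mem _ hy
  have mono : ∀ a ∈ X.image Prod.fst, ∀ b, rel d a b → ((X.image Prod.fst).filter (rel d · a)).card
      < ((X.image Prod.fst).filter (rel d · b)).card := by
    intro a ha b hab
    apply Finset.card_lt_card
    rw [Finset.ssubset_iff_of_subset]
    · exact ⟨a, Finset.mem_filter.2 ⟨ha, hab⟩, fun h => rel_irrefl _ _ (Finset.mem_filter.1 h).2⟩
    · intro c hc
      rw [Finset.mem_filter] at hc ⊢
      exact ⟨hc.1, rel_trans hc.2 hab⟩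
  have hxy : x.1 = y.1 := by
    by_contra hne
    have : rel d x.1 y.1 ∨ rel d y.1 x.1 := by
      cases d <;> simp only [rel] <;> simp <;> omega
    rcases this with h | h
    · have := mono _ hx1 _ h; omega
    · have := mono _ hy1 _ h; omega
  have : x = y := Prod.ext hxy hyx.symm
  rw [this]; exact hy

open Classical in
theorem chain_count (d : Bool) (H W : Finset ℕ) (k : ℕ) :
    ((H ×ˢ W).powerset.filter (fun X => IsCh d X ∧ X.card = k)).card
      ≤ H.card.choose k * W.card.choose k := by
  rw [← Finset.card_powersetCard, ← Finset.card_powersetCard, ← Finset.card_product]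
  refine Finset.card_le_card_of_injOn (fun X => (X.image Prod.fst, X.image Prod.snd)) ?_ ?_
  · intro X hX
    simp only [Finset.coe_filter, Finset.mem_powerset, Set.mem_ofPred_eq] at hX
    obtain ⟨h1, h2, h3⟩ := hX
    simp only [Finset.coe_product, Set.mem_prod, Finset.mem_coe, Finset.mem_powersetCard]
    refine ⟨⟨?_, ?_⟩, ?_, ?_⟩
    · intro a ha; obtain ⟨x, hx, rfl⟩ := Finset.mem_image.1 ha
      exact (Finset.mem_product.1 (h1 hx)).1
    · rw [Finset.card_image_of_injOn (chain_rank h2).1, h3]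
    · intro a ha; obtain ⟨x, hx, rfl⟩ := Finset.mem_image.1 ha
      exact (Finset.mem_product.1 (h1 hx)).2
    · rw [Finset.card_image_of_injOn (chain_rank h2).2, h3]
  · intro X hX Y hY hXY
    simp only [Finset.coe_filter, Finset.mem_powerset, Set.mem_ofPred_eq] at hX hY
    simp only [Prod.mk.injEq] at hXY
    exact Finset.Subset.antisymm (chain_det hX.2.1 hY.2.1 hXY.1 hXY.2)
      (chain_det hY.2.1 hX.2.1 hXY.1.symm hXY.2.symm)

end ML

open Filter

namespace ML

theorem Pr_subset (p : ℝ) (S Z : Finset (ℕ × ℕ)) (hZ : Z ⊆ S) :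
    Pr (fun _ => p) S (fun T => Z ⊆ T) = p ^ Z.card := by
  classical
  have := Ex_subset (fun _ => p) S Z hZ
  rw [Finset.prod_const] at this
  rw [← this]
  unfold Pr
  refine Ex_congr _ _ fun T _ => ?_
  congr

theorem partner {p : ℝ} (hp : 0 ≤ p) (hp1 : p ≤ 1) (S X : Finset (ℕ × ℕ))
    (N : ℕ × ℕ → Finset (ℕ × ℕ)) (hX : X ⊆ S) (hN : ∀ x ∈ X, N x ⊆ S) (w : ℕ)
    (hw : ∀ x ∈ X, (N x).card ≤ w)
    (hdisj : ∀ x ∈ X, ∀ x' ∈ X, x ≠ x' → Disjoint (N x) (N x'))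
    (hXN : ∀ x ∈ X, ∀ x' ∈ X, x' ∉ N x) :
    Pr (fun _ => p) S (fun T => X ⊆ T ∧ ∀ x ∈ X, ∃ y ∈ N x, y ∈ T) ≤ (p ^ 2 * w) ^ X.card := by
  classical
  set Z : (∀ a ∈ X, ℕ × ℕ) → Finset (ℕ × ℕ) := fun φ => X ∪ X.attach.image (fun x => φ x.1 x.2)
  have hP : ∀ x ∈ S, 0 ≤ (fun _ : ℕ × ℕ => p) x ∧ (fun _ : ℕ × ℕ => p) x ≤ 1 := fun _ _ => ⟨hp, hp1⟩
  have h1 : Pr (fun _ => p) S (fun T => X ⊆ T ∧ ∀ x ∈ X, ∃ y ∈ N x, y ∈ T)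
      ≤ Pr (fun _ => p) S (fun T => ∃ φ ∈ X.pi N, Z φ ⊆ T) := by
    refine Pr_mono hP fun T _ h => ?_
    obtain ⟨h1, h2⟩ := h
    choose φ hφ hφT using h2
    refine ⟨φ, Finset.mem_pi.2 hφ, Finset.union_subset h1 ?_⟩
    intro y hy
    obtain ⟨x, _, rfl⟩ := Finset.mem_image.1 hy
    exact hφT _ _
  refine h1.trans ((Pr_exists hP _ _).trans ?_)
  have h2 : ∀ φ ∈ X.pi N, Pr (fun _ => p) S (fun T => Z φ ⊆ T) = p ^ (2 * X.card) := by
    intro φ hφ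
    rw [Finset.mem_pi] at hφ
    have hinj : Function.Injective (fun x : {x // x ∈ X} => φ x.1 x.2) := by
      intro x y hxy
      by_contra hne
      have := hdisj x.1 x.2 y.1 y.2 (fun e => hne (Subtype.ext e))
      rw [Finset.disjoint_left] at this
      refine this (hφ x.1 x.2) ?_
      simp only at hxy
      rw [hxy]; exact hφ _ _
    rw [Pr_subset, Finset.card_union_of_disjoint, Finset.card_image_of_injective _ hinj,
      Finset.card_attach, two_mul]
    · rw [Finset.disjoint_left]
      intro y hy hy'
      obtain ⟨x, _, rfl⟩ := Finset.mem_image.1 hy'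
      exact hXN x.1 x.2 _ hy (hφ _ _)
    · refine Finset.union_subset hX ?_
      intro y hy
      obtain ⟨x, _, rfl⟩ := Finset.mem_image.1 hy
      exact hN x.1 x.2 (hφ _ _)
  rw [Finset.sum_congr rfl h2, Finset.sum_const, Finset.card_pi, nsmul_eq_mul]
  have h3 : ((∏ x ∈ X, (N x).card : ℕ) : ℝ) ≤ (w : ℝ) ^ X.card := by
    rw [← Finset.prod_const]
    push_cast
    exact Finset.prod_le_prod (fun _ _ => by positivity) fun x hx => by exact_mod_cast hw x hx
  calc _ ≤ (w : ℝ) ^ X.card * p ^ (2 * X.card) := by gcongr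
    _ = _ := by rw [mul_pow, ← pow_mul, mul_comm]

theorem deleted_gen {p : ℝ} (hp : 0 ≤ p) (hp1 : p ≤ 1) (d : Bool) (H W : Finset ℕ) (w k : ℕ)
    (D : Finset (ℕ × ℕ) → Finset (ℕ × ℕ)) (N : ℕ × ℕ → Finset (ℕ × ℕ))
    (hD : ∀ T, T ⊆ H ×ˢ W → ∀ x ∈ D T, x ∈ T ∧ ∃ y ∈ N x, y ∈ T)
    (hN : ∀ x ∈ H ×ˢ W, N x ⊆ H ×ˢ W) (hw : ∀ x ∈ H ×ˢ W, (N x).card ≤ w)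
    (hdisj : ∀ X, X ⊆ H ×ˢ W → IsCh d X → ∀ x ∈ X, ∀ x' ∈ X, x ≠ x' → Disjoint (N x) (N x'))
    (hXN : ∀ X, X ⊆ H ×ˢ W → IsCh d X → ∀ x ∈ X, ∀ x' ∈ X, x' ∉ N x)
    (hk : 0 < k) (hk2 : 36 * p ^ 2 * H.card * W.card * w ≤ (k : ℝ) ^ 2) :
    Pr (fun _ => p) (H ×ˢ W) (fun T => k ≤ L d (D T)) ≤ (1 / 4) ^ k := by
  classical
  have hP : ∀ x ∈ H ×ˢ W, 0 ≤ (fun _ : ℕ × ℕ => p) x ∧ (fun _ : ℕ × ℕ => p) x ≤ 1 := fun _ _ => ⟨hp, hp1⟩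
  set I := (H ×ˢ W).powerset.filter (fun X => IsCh d X ∧ X.card = k) with hI
  have h1 : Pr (fun _ => p) (H ×ˢ W) (fun T => k ≤ L d (D T)) ≤
      Pr (fun _ => p) (H ×ˢ W) (fun T => ∃ X ∈ I, X ⊆ T ∧ ∀ x ∈ X, ∃ y ∈ N x, y ∈ T) := by
    refine Pr_mono hP fun T hT h => ?_
    obtain ⟨Y, hY, hYc, hYk⟩ := exists_L d (D T)
    rw [← hYk] at h
    obtain ⟨X, hXY, hXk⟩ := Finset.exists_subset_card_eq h
    have hXD : ∀ x ∈ X, x ∈ T ∧ ∃ y ∈ N x, y ∈ T := fun x hx => hD T hT x (hY (hXY hx))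
    refine ⟨X, ?_, fun x hx => (hXD x hx).1, fun x hx => (hXD x hx).2⟩
    rw [hI, Finset.mem_filter, Finset.mem_powerset]
    exact ⟨fun x hx => hT (hXD x hx).1, hYc.subset hXY, hXk⟩
  refine h1.trans ((Pr_exists hP _ _).trans ?_)
  have h2 : ∀ X ∈ I, Pr (fun _ => p) (H ×ˢ W) (fun T => X ⊆ T ∧ ∀ x ∈ X, ∃ y ∈ N x, y ∈ T)
      ≤ (p ^ 2 * w) ^ k := by
    intro X hX
    rw [hI, Finset.mem_filter, Finset.mem_powerset] at hX
    obtain ⟨h1, h2, h3⟩ := hX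
    have := partner hp hp1 (H ×ˢ W) X N h1 (fun x hx => hN x (h1 hx)) w (fun x hx => hw x (h1 hx))
      (hdisj X h1 h2) (hXN X h1 h2)
    rwa [h3] at this
  refine (Finset.sum_le_sum h2).trans ?_
  rw [Finset.sum_const, nsmul_eq_mul]
  have h3 : (I.card : ℝ) ≤ (H.card.choose k : ℝ) * (W.card.choose k : ℝ) := by
    exact_mod_cast chain_count d H W k
  have h4 : ∀ m : ℕ, (m.choose k : ℝ) ≤ (3 * m / k) ^ k := by
    intro m
    refine (Nat.choose_le_pow_div k m).trans ?_
    have hk' : (0 : ℝ) < k := by exact_mod_cast hk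
    have h5 := Real.pow_div_factorial_le_exp (k : ℝ) hk'.le k
    have h6 : Real.exp k ≤ 3 ^ k := by
      rw [← Real.exp_one_pow]
      gcongr
      exact Real.exp_one_lt_three.le
    have hf : (0 : ℝ) < (k.factorial : ℝ) := by positivity
    rw [div_pow, mul_pow, div_le_div_iff₀ hf (by positivity)]
    have h7 : (k : ℝ) ^ k ≤ 3 ^ k * k.factorial := by
      rw [div_le_iff₀ hf] at h5
      exact h5.trans (by gcongr)
    calc (m : ℝ) ^ k * k ^ k ≤ (m : ℝ) ^ k * (3 ^ k * k.factorial) := by gcongr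
      _ = _ := by ring
  have hk' : (0 : ℝ) < k := by exact_mod_cast hk
  calc (I.card : ℝ) * (p ^ 2 * w) ^ k
      ≤ ((3 * H.card / k) ^ k * (3 * W.card / k) ^ k) * (p ^ 2 * w) ^ k := by
        have := mul_le_mul (h4 H.card) (h4 W.card) (by positivity) (by positivity)
        gcongr
        exact h3.trans this
    _ = ((3 * H.card / k) * (3 * W.card / k) * (p ^ 2 * w)) ^ k := by simp only [mul_pow]
    _ ≤ (1 / 4) ^ k := by
        gcongr
        have : (3 * (H.card : ℝ) / k) * (3 * W.card / k) * (p ^ 2 * w) =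
          (9 * p ^ 2 * H.card * W.card * w) / k ^ 2 := by field_simp; try ring
        rw [this, div_le_iff₀ (by positivity)]
        linarith

theorem deleted_row {p : ℝ} (hp : 0 ≤ p) (hp1 : p ≤ 1) (d : Bool) (H W : Finset ℕ) (k : ℕ)
    (hk : 0 < k) (hk2 : 36 * p ^ 2 * H.card * W.card * W.card ≤ (k : ℝ) ^ 2) :
    Pr (fun _ => p) (H ×ˢ W) (fun T => k ≤ L d (Drow T)) ≤ (1 / 4) ^ k := by
  refine deleted_gen hp hp1 d H W W.card k Drow (fun x => (W.erase x.2).image (fun j => (x.1, j)))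
    ?_ ?_ ?_ ?_ ?_ hk hk2
  · intro T hT x hx
    rw [Drow, Finset.mem_filter] at hx
    obtain ⟨h1, y, hy, h2, h3⟩ := hx
    refine ⟨h1, y, Finset.mem_image.2 ⟨y.2, Finset.mem_erase.2 ⟨h3, (Finset.mem_product.1 (hT hy)).2⟩, ?_⟩, hy⟩
    exact Prod.ext h2.symm rfl
  · intro x hx y hy
    obtain ⟨j, hj, rfl⟩ := Finset.mem_image.1 hy
    exact Finset.mem_product.2 ⟨(Finset.mem_product.1 hx).1, (Finset.mem_erase.1 hj).2⟩
  · intro x _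
    exact Finset.card_image_le.trans (Finset.card_erase_le)
  · intro X _ hX x hx x' hx' hne
    rw [Finset.disjoint_left]
    intro y hy hy'
    obtain ⟨j, hj, rfl⟩ := Finset.mem_image.1 hy
    obtain ⟨j', hj', h⟩ := Finset.mem_image.1 hy'
    simp only [Prod.mk.injEq] at h
    exact hne ((chain_rank hX).1 hx hx' h.1.symm)
  · intro X _ hX x hx x' hx' h
    obtain ⟨j, hj, rfl⟩ := Finset.mem_image.1 h
    have := (chain_rank hX).1 hx hx' rfl
    exact (Finset.mem_erase.1 hj).1 (by rw [this])

theorem deleted_col {p : ℝ} (hp : 0 ≤ p) (hp1 : p ≤ 1) (d : Bool) (H W : Finset ℕ) (k : ℕ)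
    (hk : 0 < k) (hk2 : 36 * p ^ 2 * H.card * W.card * H.card ≤ (k : ℝ) ^ 2) :
    Pr (fun _ => p) (H ×ˢ W) (fun T => k ≤ L d (Dcol T)) ≤ (1 / 4) ^ k := by
  refine deleted_gen hp hp1 d H W H.card k Dcol (fun x => (H.erase x.1).image (fun j => (j, x.2)))
    ?_ ?_ ?_ ?_ ?_ hk hk2
  · intro T hT x hx
    rw [Dcol, Finset.mem_filter] at hx
    obtain ⟨h1, y, hy, h2, h3⟩ := hx
    refine ⟨h1, y, Finset.mem_image.2 ⟨y.1, Finset.mem_erase.2 ⟨h3, (Finset.mem_product.1 (hT hy)).1⟩, ?_⟩, hy⟩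
    exact Prod.ext rfl h2.symm
  · intro x hx y hy
    obtain ⟨j, hj, rfl⟩ := Finset.mem_image.1 hy
    exact Finset.mem_product.2 ⟨(Finset.mem_erase.1 hj).2, (Finset.mem_product.1 hx).2⟩
  · intro x _
    exact Finset.card_image_le.trans (Finset.card_erase_le)
  · intro X _ hX x hx x' hx' hne
    rw [Finset.disjoint_left]
    intro y hy hy'
    obtain ⟨j, hj, rfl⟩ := Finset.mem_image.1 hy
    obtain ⟨j', hj', h⟩ := Finset.mem_image.1 hy'
    simp only [Prod.mk.injEq] at h
    exact hne ((chain_rank hX).2 hx hx' h.2.symm)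
  · intro X _ hX x hx x' hx' h
    obtain ⟨j, hj, rfl⟩ := Finset.mem_image.1 h
    have := (chain_rank hX).2 hx hx' rfl
    exact (Finset.mem_erase.1 hj).1 (by rw [this])

end ML

open Filter

namespace ML

theorem EU_le {q : ℝ} (hq : 0 < q) (hq1 : q < 1) (R0 : Finset ℕ) (j : ℕ) :
    Ex (fun _ => 1 - q) (R0 ×ˢ Finset.range j) (fun T => ((Rset R0 T j).card : ℝ))
      ≤ (q ^ R0.card)⁻¹ * R0.card * q ^ j := by
  have hp : 0 < 1 - q := by linarith
  have hP : ∀ x ∈ R0 ×ˢ Finset.range j, 0 ≤ (fun _ : ℕ × ℕ => 1 - q) x ∧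
    (fun _ : ℕ × ℕ => 1 - q) x ≤ 1 := fun _ _ => ⟨hp.le, by simp only; linarith⟩
  have h1 : Ex (fun _ => 1 - q) (R0 ×ˢ Finset.range j)
      (fun T => 1 + (1 - q) * ((Rset R0 T j).card : ℝ)) ≤
      Ex (fun _ => 1 - q) (R0 ×ˢ Finset.range j) (fun T => Xv q R0 T j) := by
    refine Ex_mono _ _ hP fun T _ => ?_
    unfold Xv
    have h2 : 1 + (1 - q) ≤ q⁻¹ := by
      rw [← one_div, le_div_iff₀ hq]; nlinarith
    have h3 := one_add_mul_le_pow (show (-2 : ℝ) ≤ 1 - q by linarith) (Rset R0 T j).card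
    rw [← inv_pow]
    calc _ = 1 + ((Rset R0 T j).card : ℝ) * (1 - q) := by ring
      _ ≤ _ := h3
      _ ≤ _ := by gcongr
  rw [Ex_add, Ex_const, Ex_mul, X_mean hq] at h1
  have h4 : 1 - R0.card * (1 - q) ≤ q ^ R0.card := by
    have := one_add_mul_le_pow (show (-2 : ℝ) ≤ -(1 - q) by linarith) R0.card
    have e : 1 + -(1 - q) = q := by ring
    rw [e] at this; linarith
  have hqm : 0 < q ^ R0.card := by positivity
  have h5 : (q ^ R0.card)⁻¹ - 1 ≤ (q ^ R0.card)⁻¹ * (R0.card * (1 - q)) := by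
    have : (q ^ R0.card)⁻¹ - 1 = (q ^ R0.card)⁻¹ * (1 - q ^ R0.card) := by field_simp
    rw [this]
    exact mul_le_mul_of_nonneg_left (by linarith) (by positivity)
  have h6 : (1 - q) * Ex (fun _ => 1 - q) (R0 ×ˢ Finset.range j) (fun T => ((Rset R0 T j).card : ℝ))
      ≤ (1 - q) * ((q ^ R0.card)⁻¹ * R0.card * q ^ j) := by
    have h7 : ((q ^ R0.card)⁻¹ - 1) * q ^ j ≤ ((q ^ R0.card)⁻¹ * (R0.card * (1 - q))) * q ^ j := by
      gcongr
    calc _ ≤ ((q ^ R0.card)⁻¹ - 1) * q ^ j := by linarith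
      _ ≤ _ := h7
      _ = _ := by ring
  exact le_of_mul_le_mul_left h6 hp

theorem sqrt_young (u t : ℝ) (hu : 0 ≤ u) (ht : 0 < t) : Real.sqrt u ≤ (2 * t)⁻¹ * u + t / 2 := by
  have h := Real.sq_sqrt hu
  have h2 : (2 * t)⁻¹ * u + t / 2 - Real.sqrt u = (2 * t)⁻¹ * (Real.sqrt u - t) ^ 2 := by
    field_simp
    nlinarith
  have : 0 ≤ (2 * t)⁻¹ * (Real.sqrt u - t) ^ 2 := by positivity
  linarith

theorem ELK_le {q : ℝ} (hq : 0 < q) (hq1 : q < 1) (d : Bool) (R0 : Finset ℕ) (hR : 0 < R0.card) (j : ℕ) :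
    Ex (fun _ => 1 - q) (R0 ×ˢ Finset.range j) (fun T => (L d (Kept R0 T j) : ℝ))
      ≤ (1 / 2 + 2 * (1 - q) * j) * Real.sqrt R0.card := by
  have hp : 0 < 1 - q := by linarith
  have hP : ∀ x ∈ R0 ×ˢ Finset.range j, 0 ≤ (fun _ : ℕ × ℕ => 1 - q) x ∧
    (fun _ : ℕ × ℕ => 1 - q) x ≤ 1 := fun _ _ => ⟨hp.le, by simp only; linarith⟩
  have h1 : Ex (fun _ => 1 - q) (R0 ×ˢ Finset.range j) (fun T => (L d (Kept R0 T j) : ℝ))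
      ≤ Ex (fun _ => 1 - q) (R0 ×ˢ Finset.range j) (fun T => (L d T : ℝ)) := by
    refine Ex_mono _ _ hP fun T _ => ?_
    exact_mod_cast L_mono fun x hx => (coe_eq_fm.1 (mem_Kept.1 hx).2).2.1
  refine h1.trans ?_
  rw [Ex_L_std (1 - q) d R0 (Finset.range j) (fun k => (k : ℝ)), Finset.card_range]
  have hm : (1 : ℝ) ≤ R0.card := by exact_mod_cast hR
  set s := Real.sqrt R0.card with hs
  have hs1 : 1 ≤ s := by rw [hs, Real.one_le_sqrt]; exact hm
  have hss : s * s = R0.card := Real.mul_self_sqrt (by linarith)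
  have h2 := up_mean (a := 1 / (2 * s)) (p := 1 - q) (by positivity)
    (by rw [div_lt_one (by positivity)]; linarith) hp (by linarith) R0.card j
  refine h2.trans (le_of_eq ?_)
  rw [← hss]; field_simp

theorem tail_aux (c0 : ℝ) (hc : 0 < c0) (hc1 : c0 ≤ 1) : ∃ B : ℝ, 0 < B ∧ ∀ (q : ℝ) (n : ℕ) (d : Bool), 0 < q → q < 1 →
    c0 ≤ q ^ n → ∀ R : Finset ℕ, R.card ≤ n →
      MW q R.card R (fun w => (Lw d w : ℝ)) ≤ B * Real.sqrt R.card := by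
  set K := Real.log (16 / c0) with hK
  have hK0 : 0 ≤ K := Real.log_nonneg (by rw [le_div_iff₀ hc]; linarith)
  refine ⟨4 / 3 * (1 / 2 + 2 * (K + 1)), by positivity, ?_⟩
  intro q n d hq hq1 hqn R hRn
  have hp : 0 < 1 - q := by linarith
  rcases R.eq_empty_or_nonempty with rfl | hne
  · simp [MW, Lw, pts, L]
  obtain ⟨R1, hR1, hmax⟩ := Finset.exists_max_image (R.powerset.erase ∅)
    (fun R' => MW q R'.card R' (fun w => (Lw d w : ℝ)) / Real.sqrt R'.card)
    ⟨R, by simp [hne.ne_empty]⟩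
  set B := MW q R1.card R1 (fun w => (Lw d w : ℝ)) / Real.sqrt R1.card with hB
  rw [Finset.mem_erase, Finset.mem_powerset] at hR1
  have hbound : ∀ R' ⊆ R, MW q R'.card R' (fun w => (Lw d w : ℝ)) ≤ B * Real.sqrt R'.card := by
    intro R' hR'
    rcases R'.eq_empty_or_nonempty with rfl | hne'
    · simp [MW, Lw, pts, L]
    · have := hmax R' (by rw [Finset.mem_erase, Finset.mem_powerset]; exact ⟨hne'.ne_empty, hR'⟩)
      have hpos : 0 < Real.sqrt R'.card := Real.sqrt_pos.2 (by exact_mod_cast hne'.card_pos)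
      exact (div_le_iff₀ hpos).1 this
  have hR1pos : 0 < R1.card := Finset.card_pos.2 (Finset.nonempty_iff_ne_empty.2 hR1.1)
  have hspos : 0 < Real.sqrt R1.card := Real.sqrt_pos.2 (by exact_mod_cast hR1pos)
  have hB0 : 0 ≤ B := by
    rw [hB]; refine div_nonneg ?_ hspos.le
    have := MW_mono hq.le R1.card R1 (f := fun _ => 0) (g := fun w => (Lw d w : ℝ))
      (fun w => by positivity)
    rwa [MW_const hq hq1 _ _ rfl] at this
  set M := ⌈K / (1 - q)⌉₊ with hM
  have hM1 : K ≤ (1 - q) * M := by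
    have := Nat.le_ceil (K / (1 - q))
    rw [div_le_iff₀ hp] at this; linarith
  have hM2 : (1 - q) * M ≤ K + 1 := by
    have := Nat.ceil_lt_add_one (div_nonneg hK0 hp.le)
    rw [← hM] at this
    have h2 : (1 - q) * M ≤ (1 - q) * (K / (1 - q) + 1) := by gcongr
    have h3 : (1 - q) * (K / (1 - q) + 1) = K + (1 - q) := by field_simp
    linarith
  have hqM : q ^ M ≤ c0 / 16 := by
    have h1 : q ≤ Real.exp (-(1 - q)) := by
      have := Real.add_one_le_exp (-(1 - q)); linarith
    calc q ^ M ≤ (Real.exp (-(1 - q))) ^ M := by gcongr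
      _ = Real.exp (-((1 - q) * M)) := by rw [← Real.exp_nat_mul]; congr 1; ring
      _ ≤ Real.exp (-K) := by gcongr
      _ = c0 / 16 := by rw [Real.exp_neg, hK, Real.exp_log (by positivity), inv_div]
  have hP : ∀ x ∈ R1 ×ˢ Finset.range M, 0 ≤ (fun _ : ℕ × ℕ => 1 - q) x ∧
    (fun _ : ℕ × ℕ => 1 - q) x ≤ 1 := fun _ _ => ⟨hp.le, by simp only; linarith⟩
  have key : MW q R1.card R1 (fun w => (Lw d w : ℝ)) ≤
      (1 / 2 + 2 * (K + 1)) * Real.sqrt R1.card + B * (Real.sqrt R1.card / 4) := by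
    rw [MW_coupling hq hq1 R1 _ M]
    have h1 : ∀ T, T ⊆ R1 ×ˢ Finset.range M → MW q (Rset R1 T M).card (Rset R1 T M)
        (fun w => (Lw d (word R1 T M ++ w) : ℝ)) ≤ (L d (Kept R1 T M) : ℝ) +
        B * ((2 * (Real.sqrt R1.card / 4))⁻¹ * ((Rset R1 T M).card : ℝ) + (Real.sqrt R1.card / 4) / 2) := by
      intro T _
      have h2 : MW q (Rset R1 T M).card (Rset R1 T M) (fun w => (Lw d (word R1 T M ++ w) : ℝ))
        ≤ MW q (Rset R1 T M).card (Rset R1 T M) (fun w => (L d (Kept R1 T M) : ℝ) + (Lw d w : ℝ)) := by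
        refine MW_mono hq.le _ _ fun w => ?_
        rw [← Lw_word]
        exact_mod_cast Lw_append_le d _ w
      rw [MW_add, MW_const hq hq1 _ _ rfl] at h2
      refine h2.trans (add_le_add_right ?_ _)
      refine (hbound _ ((Rset_subset _ _ _).trans hR1.2)).trans ?_
      exact mul_le_mul_of_nonneg_left (sqrt_young _ _ (by positivity) (by positivity)) hB0
    refine (Ex_mono _ _ hP h1).trans ?_
    rw [Ex_add, Ex_mul, Ex_add, Ex_mul, Ex_const]
    have h3 := ELK_le hq hq1 d R1 hR1pos M
    have h4 := EU_le hq hq1 R1 M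
    have h5 : (q ^ R1.card)⁻¹ * R1.card * q ^ M ≤ R1.card / 16 := by
      have h6 : c0 ≤ q ^ R1.card := hqn.trans
        (pow_le_pow_of_le_one hq.le hq1.le ((Finset.card_le_card hR1.2).trans hRn))
      have h7 : (q ^ R1.card)⁻¹ ≤ c0⁻¹ := by gcongr
      calc (q ^ R1.card)⁻¹ * R1.card * q ^ M ≤ c0⁻¹ * R1.card * (c0 / 16) := by gcongr
        _ = _ := by field_simp
    refine add_le_add (h3.trans ?_) ?_
    · refine mul_le_mul_of_nonneg_right ?_ hspos.le
      have h10 : 2 * (1 - q) * M = 2 * ((1 - q) * M) := by ring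
      linarith
    · refine mul_le_mul_of_nonneg_left ?_ hB0
      have hss : Real.sqrt R1.card * Real.sqrt R1.card = R1.card := Real.mul_self_sqrt (by positivity)
      have h8 : (2 * (Real.sqrt R1.card / 4))⁻¹ * Ex (fun _ => 1 - q) (R1 ×ˢ Finset.range M)
        (fun T => ((Rset R1 T M).card : ℝ)) ≤ (2 * (Real.sqrt R1.card / 4))⁻¹ * (R1.card / 16) := by
        refine mul_le_mul_of_nonneg_left (h4.trans h5) (by positivity)
      have h9 : (2 * (Real.sqrt R1.card / 4))⁻¹ * ((R1.card : ℝ) / 16) = Real.sqrt R1.card / 8 := by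
        have e : ∀ x : ℝ, 0 < x → (2 * (x / 4))⁻¹ * (x * x / 16) = x / 8 := fun x hx => by
          field_simp; norm_num
        have := e _ hspos
        rwa [hss] at this
      linarith
  have hBeq : MW q R1.card R1 (fun w => (Lw d w : ℝ)) = B * Real.sqrt R1.card := by
    exact (div_mul_cancel₀ _ hspos.ne').symm
  rw [hBeq] at key
  have hBle : B ≤ 4 / 3 * (1 / 2 + 2 * (K + 1)) := by
    have : B ≤ (1 / 2 + 2 * (K + 1)) + B / 4 := by
      refine le_of_mul_le_mul_right ?_ hspos
      linarith
    linarith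
  exact (hbound R subset_rfl).trans (mul_le_mul_of_nonneg_right hBle (Real.sqrt_nonneg _))

theorem upper_MW (c0 : ℝ) (hc : 0 < c0) (hc1 : c0 ≤ 1) : ∃ B : ℝ, 0 < B ∧ ∀ (q : ℝ) (n M : ℕ) (d : Bool) (γ t1 t2 : ℝ),
    0 < q → q < 1 → 0 < n → c0 ≤ q ^ n → 0 < γ → q ^ M ≤ γ → 0 < t2 →
    MW q n (Finset.range n) (fun w => if t1 + t2 ≤ (Lw d w : ℝ) then 1 else 0) ≤
      Pr (fun _ => 1 - q) (Finset.range n ×ˢ Finset.range M)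
        (fun T => t1 ≤ (L d (Kept (Finset.range n) T M) : ℝ)) + B * Real.sqrt (n * γ) / t2 := by
  obtain ⟨B, hB, hT⟩ := tail_aux c0 hc hc1
  refine ⟨B * Real.sqrt c0⁻¹, by positivity, ?_⟩
  intro q n M d γ t1 t2 hq hq1 hn hqn hγ hM ht2
  classical
  have hp : 0 < 1 - q := by linarith
  have hP : ∀ x ∈ Finset.range n ×ˢ Finset.range M, 0 ≤ (fun _ : ℕ × ℕ => 1 - q) x ∧
    (fun _ : ℕ × ℕ => 1 - q) x ≤ 1 := fun _ _ => ⟨hp.le, by simp only; linarith⟩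
  have h0 := MW_coupling hq hq1 (Finset.range n) (fun w => if t1 + t2 ≤ (Lw d w : ℝ) then (1 : ℝ) else 0) M
  rw [Finset.card_range] at h0
  rw [h0]
  have hn' : (0 : ℝ) < n := by exact_mod_cast hn
  set t := Real.sqrt (n * γ * c0⁻¹) with ht
  have htpos : 0 < t := Real.sqrt_pos.2 (by positivity)
  have h1 : ∀ T, T ⊆ Finset.range n ×ˢ Finset.range M →
      MW q (Rset (Finset.range n) T M).card (Rset (Finset.range n) T M)
        (fun w => if t1 + t2 ≤ (Lw d (word (Finset.range n) T M ++ w) : ℝ) then (1 : ℝ) else 0) ≤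
      (if t1 ≤ (L d (Kept (Finset.range n) T M) : ℝ) then 1 else 0) +
      t2⁻¹ * (B * ((2 * t)⁻¹ * ((Rset (Finset.range n) T M).card : ℝ) + t / 2)) := by
    intro T _
    set R := Rset (Finset.range n) T M with hR
    have h2 : MW q R.card R
        (fun w => if t1 + t2 ≤ (Lw d (word (Finset.range n) T M ++ w) : ℝ) then (1 : ℝ) else 0) ≤
        MW q R.card R (fun w => (if t1 ≤ (L d (Kept (Finset.range n) T M) : ℝ) then 1 else 0) +
          t2⁻¹ * (Lw d w : ℝ)) := by
      refine MW_mono hq.le _ _ fun w => ?_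
      have h3 : (Lw d (word (Finset.range n) T M ++ w) : ℝ) ≤ (L d (Kept (Finset.range n) T M) : ℝ) + Lw d w := by
        rw [← Lw_word]; exact_mod_cast Lw_append_le d _ w
      have h4 : 0 ≤ t2⁻¹ * (Lw d w : ℝ) := by positivity
      by_cases h5 : t1 + t2 ≤ (Lw d (word (Finset.range n) T M ++ w) : ℝ)
      · rw [if_pos h5]
        by_cases h6 : t1 ≤ (L d (Kept (Finset.range n) T M) : ℝ)
        · rw [if_pos h6]; linarith
        · rw [if_neg h6, zero_add, ← div_eq_inv_mul, le_div_iff₀ ht2]; linarith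
      · rw [if_neg h5]
        split_ifs <;> linarith
    rw [MW_add, MW_const hq hq1 _ _ rfl, MW_mul] at h2
    refine h2.trans (add_le_add_right ?_ _)
    refine mul_le_mul_of_nonneg_left ?_ (by positivity)
    have hRn : R.card ≤ n := by
      have := Finset.card_le_card (Rset_subset (Finset.range n) T M)
      rwa [Finset.card_range] at this
    refine (hT q n d hq hq1 hqn R hRn).trans ?_
    exact mul_le_mul_of_nonneg_left (sqrt_young _ _ (by positivity) htpos) hB.le
  refine (Ex_mono _ _ hP h1).trans ?_
  rw [Ex_add, Ex_mul, Ex_mul, Ex_add, Ex_mul, Ex_const]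
  have h7 := EU_le hq hq1 (Finset.range n) M
  rw [Finset.card_range] at h7
  have h8 : (q ^ n)⁻¹ * n * q ^ M ≤ n * γ * c0⁻¹ := by
    have : (q ^ n)⁻¹ ≤ c0⁻¹ := by gcongr
    calc (q ^ n)⁻¹ * n * q ^ M ≤ c0⁻¹ * n * γ := by gcongr
      _ = _ := by ring
  have hss : t * t = n * γ * c0⁻¹ := Real.mul_self_sqrt (by positivity)
  have h9 : (2 * t)⁻¹ * Ex (fun _ => 1 - q) (Finset.range n ×ˢ Finset.range M)
      (fun T => ((Rset (Finset.range n) T M).card : ℝ)) + t / 2 ≤ t := by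
    have : (2 * t)⁻¹ * Ex (fun _ => 1 - q) (Finset.range n ×ˢ Finset.range M)
      (fun T => ((Rset (Finset.range n) T M).card : ℝ)) ≤ (2 * t)⁻¹ * (t * t) := by
      rw [hss]; exact mul_le_mul_of_nonneg_left (h7.trans h8) (by positivity)
    have e : (2 * t)⁻¹ * (t * t) = t / 2 := by field_simp
    linarith
  refine add_le_add (le_of_eq ?_) ?_
  · unfold Pr; refine Ex_congr _ _ fun T _ => ?_
    congr
  · have ht' : t = Real.sqrt (n * γ) * Real.sqrt c0⁻¹ := by rw [ht, Real.sqrt_mul (by positivity)]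
    calc t2⁻¹ * (B * _) ≤ t2⁻¹ * (B * t) := by gcongr
      _ = _ := by rw [ht']; ring

theorem lower_MW {q : ℝ} (hq : 0 < q) (hq1 : q < 1) (n M : ℕ) (d : Bool) (t : ℝ) :
    MW q n (Finset.range n) (fun w => if (Lw d w : ℝ) < t then 1 else 0) ≤
      Pr (fun _ => 1 - q) (Finset.range n ×ˢ Finset.range M)
        (fun T => (L d (Kept (Finset.range n) T M) : ℝ) < t) := by
  classical
  have hP : ∀ x ∈ Finset.range n ×ˢ Finset.range M, 0 ≤ (fun _ : ℕ × ℕ => 1 - q) x ∧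
    (fun _ : ℕ × ℕ => 1 - q) x ≤ 1 := fun _ _ => ⟨by simp only; linarith, by simp only; linarith⟩
  have h0 := MW_coupling hq hq1 (Finset.range n) (fun w => if (Lw d w : ℝ) < t then (1 : ℝ) else 0) M
  rw [Finset.card_range] at h0
  rw [h0]
  unfold Pr
  refine Ex_mono _ _ hP fun T _ => ?_
  set R := Rset (Finset.range n) T M with hR
  have h2 : MW q R.card R
        (fun w => if (Lw d (word (Finset.range n) T M ++ w) : ℝ) < t then (1 : ℝ) else 0) ≤
        MW q R.card R (fun w => (if (L d (Kept (Finset.range n) T M) : ℝ) < t then 1 else 0)) := by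
    refine MW_mono hq.le _ _ fun w => ?_
    have h3 : (L d (Kept (Finset.range n) T M) : ℝ) ≤ (Lw d (word (Finset.range n) T M ++ w) : ℝ) := by
      rw [← Lw_word]; exact_mod_cast Lw_le_append d _ w
    split_ifs <;> linarith
  rw [MW_const hq hq1 _ _ rfl] at h2
  refine h2.trans (le_of_eq ?_)
  congr

end ML

open Filter
namespace ML

/-- a sequence of parameters in `(0,1)` with `n (1 - q n) → β` -/
structure Sq where
  q : ℕ → ℝ
  β : ℝ
  h0 : ∀ n, 0 < q n
  h1 : ∀ n, q n < 1
  hβ : 0 ≤ β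
  hlim : Tendsto (fun n : ℕ => (n : ℝ) * (1 - q n)) atTop (nhds β)

namespace Sq

theorem p0 (Z : Sq) (n : ℕ) : 0 < 1 - Z.q n := by linarith [Z.h1 n]
theorem p1 (Z : Sq) (n : ℕ) : 1 - Z.q n ≤ 1 := by linarith [Z.h0 n]
theorem hP (Z : Sq) (n : ℕ) (S : Finset (ℕ × ℕ)) : ∀ x ∈ S, 0 ≤ (fun _ : ℕ × ℕ => 1 - Z.q n) x ∧
    (fun _ : ℕ × ℕ => 1 - Z.q n) x ≤ 1 := fun _ _ => ⟨(Z.p0 n).le, Z.p1 n⟩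

/-- the coin space -/
def sp (M : ℕ → ℕ) (n : ℕ) : Finset (ℕ × ℕ) := Finset.range n ×ˢ Finset.range (M n)

/-- events whose probability tends to one -/
def wF (Z : Sq) (M : ℕ → ℕ) : Filter (ℕ × Finset (ℕ × ℕ)) where
  sets := {s | Tendsto (fun n => Pr (fun _ => 1 - Z.q n) (sp M n) (fun T => (n, T) ∉ s)) atTop (nhds 0)}
  univ_sets := by
    simp only [Set.mem_ofPred_eq]
    refine tendsto_const_nhds.congr fun n => ?_
    simp [Pr, Ex_const]
  sets_of_superset := by
    intro s t hs hst
    exact squeeze_zero (fun n => Pr_nonneg (Z.hP n _) _)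
      (fun n => Pr_mono (Z.hP n _) fun T _ h h' => h (hst h')) hs
  inter_sets := by
    intro s t hs ht
    have := Tendsto.add hs ht
    rw [add_zero] at this
    refine squeeze_zero (fun n => Pr_nonneg (Z.hP n _) _) (fun n => ?_) this
    refine (Pr_mono (Z.hP n _) fun T _ h => ?_).trans (Pr_or (Z.hP n _) _ _)
    by_contra h'
    push Not at h'
    exact h h'

theorem ev_wF {Z : Sq} {M : ℕ → ℕ} {E : ℕ × Finset (ℕ × ℕ) → Prop} :
    (∀ᶠ w in Z.wF M, E w) ↔ Tendsto (fun n => Pr (fun _ => 1 - Z.q n) (sp M n) (fun T => ¬ E (n, T)))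
      atTop (nhds 0) := Iff.rfl

theorem ev_of_le {Z : Sq} {M : ℕ → ℕ} {E : ℕ × Finset (ℕ × ℕ) → Prop} (f : ℕ → ℝ)
    (hf : Tendsto f atTop (nhds 0))
    (h : ∀ᶠ n in atTop, Pr (fun _ => 1 - Z.q n) (sp M n) (fun T => ¬ E (n, T)) ≤ f n) :
    ∀ᶠ w in Z.wF M, E w :=
  ev_wF.2 (squeeze_zero' (Eventually.of_forall fun n => Pr_nonneg (Z.hP n _) _) h hf)

theorem ev_sub (Z : Sq) (M : ℕ → ℕ) : ∀ᶠ w in Z.wF M, w.2 ⊆ sp M w.1 := by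
  refine ev_of_le (fun _ => 0) tendsto_const_nhds (Eventually.of_forall fun n => ?_)
  rw [Pr_congr (F := fun _ => False) fun T hT => by simp [hT]]
  simp [Pr, Ex_const]

theorem fst_wF (Z : Sq) (M : ℕ → ℕ) : Tendsto Prod.fst (Z.wF M) atTop := by
  intro s hs
  refine ev_of_le (fun _ => 0) tendsto_const_nhds ?_
  filter_upwards [hs] with n hn
  rw [Pr_congr (F := fun _ => False) fun T hT => by simpa using hn]
  simp [Pr, Ex_const]

theorem ev_fst {Z : Sq} {M : ℕ → ℕ} {E : ℕ → Prop} (h : ∀ᶠ n in atTop, E n) :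
    ∀ᶠ w in Z.wF M, E w.1 := (fst_wF Z M).eventually h

theorem tp (Z : Sq) : Tendsto (fun n => 1 - Z.q n) atTop (nhds 0) := by
  have h := Z.hlim.mul (tendsto_inv_atTop_nhds_zero_nat (𝕜 := ℝ))
  rw [mul_zero] at h
  refine h.congr' ?_
  filter_upwards [eventually_gt_atTop 0] with n hn
  have : (n : ℝ) ≠ 0 := by positivity
  field_simp

theorem tq (Z : Sq) : Tendsto Z.q atTop (nhds 1) := by
  have := Z.tp.const_sub 1
  simpa using this

theorem tlq (Z : Sq) : Tendsto (fun n => Real.log (Z.q n) / (1 - Z.q n)) atTop (nhds (-1)) := by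
  have h1 : Tendsto (fun n => -(Z.q n)⁻¹) atTop (nhds (-1)) := by
    have := (Z.tq.inv₀ one_ne_zero).neg
    simpa using this
  refine tendsto_of_tendsto_of_tendsto_of_le_of_le h1 (tendsto_const_nhds (x := -1)) (fun n => ?_) (fun n => ?_)
  · have h := Real.one_sub_inv_le_log_of_pos (Z.h0 n)
    rw [le_div_iff₀ (Z.p0 n)]
    have := Z.h0 n
    have e : -(Z.q n)⁻¹ * (1 - Z.q n) = 1 - (Z.q n)⁻¹ := by field_simp; ring
    linarith
  · have h := Real.log_le_sub_one_of_pos (Z.h0 n)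
    rw [div_le_iff₀ (Z.p0 n)]; linarith

theorem qpow_tendsto (Z : Sq) (i : ℕ → ℕ) (y : ℝ) (h : Tendsto (fun n => (i n : ℝ) * (1 - Z.q n)) atTop (nhds y)) :
    Tendsto (fun n => Z.q n ^ i n) atTop (nhds (Real.exp (-y))) := by
  have h1 := h.mul Z.tlq
  have h2 := (Real.continuous_exp.tendsto _).comp h1
  rw [mul_neg_one] at h2
  refine h2.congr fun n => ?_
  have : (i n : ℝ) * (1 - Z.q n) * (Real.log (Z.q n) / (1 - Z.q n)) = i n * Real.log (Z.q n) := by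
    have := (Z.p0 n).ne'
    field_simp
  simp only [Function.comp]
  rw [this, ← Real.log_pow, Real.exp_log (pow_pos (Z.h0 n) _)]

/-- column index -/
noncomputable def cI (Z : Sq) (γ : ℝ) (n : ℕ) : ℕ := ⌊-Real.log γ / (1 - Z.q n)⌋₊

/-- row parameter -/
noncomputable def xf (Z : Sq) (s : ℝ) : ℝ := if Z.β = 0 then s else Real.log (1 + Z.β * s) / Z.β

/-- row index -/
noncomputable def rI (Z : Sq) (s : ℝ) (n : ℕ) : ℕ := ⌊Z.xf s * n⌋₊

/-- the maximal row coordinate -/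
noncomputable def S (Z : Sq) : ℝ := if Z.β = 0 then 1 else (Real.exp Z.β - 1) / Z.β

theorem βpos {Z : Sq} (h : Z.β ≠ 0) : 0 < Z.β := lt_of_le_of_ne Z.hβ (Ne.symm h)

theorem Spos (Z : Sq) : 0 < Z.S := by
  unfold S; split_ifs with h
  · norm_num
  · have := βpos h
    have h2 : 1 < Real.exp Z.β := by rw [← Real.exp_zero]; exact Real.exp_lt_exp.2 this
    exact div_pos (by linarith) this

theorem xf_S (Z : Sq) : Z.xf Z.S = 1 := by
  unfold xf S; split_ifs with h
  · rfl
  · rw [mul_div_cancel₀ _ h]; simp [h]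

theorem xf_mono (Z : Sq) {s t : ℝ} (hs : 0 ≤ s) (h : s ≤ t) : Z.xf s ≤ Z.xf t := by
  unfold xf; split_ifs with h0
  · exact h
  · have := βpos h0
    gcongr

theorem xf_zero (Z : Sq) : Z.xf 0 = 0 := by unfold xf; split_ifs <;> simp

theorem xf_nonneg (Z : Sq) {s : ℝ} (hs : 0 ≤ s) : 0 ≤ Z.xf s := by
  rw [← Z.xf_zero]; exact Z.xf_mono le_rfl hs

theorem rI_mono (Z : Sq) {s t : ℝ} (hs : 0 ≤ s) (h : s ≤ t) (n : ℕ) : Z.rI s n ≤ Z.rI t n := by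
  unfold rI; have := Z.xf_mono hs h; gcongr

theorem rI_S (Z : Sq) (n : ℕ) : Z.rI Z.S n = n := by simp [rI, xf_S]
theorem rI_zero (Z : Sq) (n : ℕ) : Z.rI 0 n = 0 := by simp [rI, xf_zero]
theorem cI_one (Z : Sq) (n : ℕ) : Z.cI 1 n = 0 := by simp [cI]
theorem rI_le (Z : Sq) {s : ℝ} (hs : 0 ≤ s) (h : s ≤ Z.S) (n : ℕ) : Z.rI s n ≤ n := by
  conv_rhs => rw [← Z.rI_S n]
  exact Z.rI_mono hs h n
theorem cI_anti (Z : Sq) {s t : ℝ} (hs : 0 < s) (h : s ≤ t) (n : ℕ) : Z.cI t n ≤ Z.cI s n := by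
  unfold cI
  have := Z.p0 n
  have h2 := Real.log_le_log hs h
  gcongr

theorem cI_tendsto (Z : Sq) {γ : ℝ} (h0 : 0 < γ) (h1 : γ ≤ 1) :
    Tendsto (fun n => Z.q n ^ Z.cI γ n) atTop (nhds γ) := by
  have hl : 0 ≤ -Real.log γ := by have := Real.log_nonpos h0.le h1; linarith
  have := Z.qpow_tendsto (Z.cI γ) (-Real.log γ) ?_
  · rwa [neg_neg, Real.exp_log h0] at this
  · have h2 := Z.tp.const_sub (-Real.log γ)
    rw [sub_zero] at h2
    refine tendsto_of_tendsto_of_tendsto_of_le_of_le h2 tendsto_const_nhds (fun n => ?_) (fun n => ?_)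
    · have := Nat.sub_one_lt_floor (-Real.log γ / (1 - Z.q n))
      have hp := Z.p0 n
      have h3 : (-Real.log γ / (1 - Z.q n) - 1) * (1 - Z.q n) ≤ (⌊-Real.log γ / (1 - Z.q n)⌋₊ : ℝ) * (1 - Z.q n) := by
        gcongr
      have h4 : (-Real.log γ / (1 - Z.q n) - 1) * (1 - Z.q n) = -Real.log γ - (1 - Z.q n) := by field_simp
      simp only [cI]; linarith
    · have := Nat.floor_le (div_nonneg hl (Z.p0 n).le)
      rwa [le_div_iff₀ (Z.p0 n)] at this

/-- row coordinate of a row index -/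
noncomputable def sc (Z : Sq) (n i : ℕ) : ℝ := ((Z.q n ^ i)⁻¹ - 1) / (n * (1 - Z.q n))

theorem rI_div (Z : Sq) {s : ℝ} (h0 : 0 ≤ s) :
    Tendsto (fun n : ℕ => (Z.rI s n : ℝ) / n) atTop (nhds (Z.xf s)) := by
  have := (tendsto_nat_floor_mul_div_atTop (R := ℝ) (Z.xf_nonneg h0)).comp tendsto_natCast_atTop_atTop
  exact this

theorem rI_tendsto (Z : Sq) {s : ℝ} (h0 : 0 ≤ s) :
    Tendsto (fun n => Z.sc n (Z.rI s n)) atTop (nhds s) := by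
  have hd := Z.rI_div h0
  have h1 : Tendsto (fun n => (Z.rI s n : ℝ) * (1 - Z.q n)) atTop (nhds (Z.xf s * Z.β)) := by
    refine (hd.mul Z.hlim).congr' ?_
    filter_upwards [eventually_gt_atTop 0] with n hn
    have : (n : ℝ) ≠ 0 := by positivity
    field_simp
  have h2 := Z.qpow_tendsto _ _ h1
  have h3 := h2.inv₀ (Real.exp_ne_zero _)
  rw [← Real.exp_neg, neg_neg] at h3
  by_cases hb : Z.β = 0
  · have e1 : Z.xf s = s := by simp [xf, hb]
    rw [hb, mul_zero, Real.exp_zero] at h3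
    rw [e1] at hd
    have h4 := h3.mul hd
    rw [one_mul] at h4
    refine tendsto_of_tendsto_of_tendsto_of_le_of_le' hd h4 ?_ ?_
    all_goals
      filter_upwards [eventually_gt_atTop 0] with n hn
      have hn' : (0 : ℝ) < n := by positivity
      have hp := Z.p0 n
      have hqi : 0 < Z.q n ^ Z.rI s n := pow_pos (Z.h0 n) _
      have hB := one_add_mul_le_pow (a := -(1 - Z.q n)) (by linarith [Z.p1 n]) (Z.rI s n)
      have e5 : 1 + -(1 - Z.q n) = Z.q n := by ring
      rw [e5] at hB
      unfold sc
    · rw [div_le_div_iff₀ hn' (by positivity)]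
      have hB2 := one_add_mul_le_pow (a := (Z.q n)⁻¹ - 1) (by
        have : 0 < (Z.q n)⁻¹ := inv_pos.2 (Z.h0 n)
        linarith) (Z.rI s n)
      have e6 : 1 + ((Z.q n)⁻¹ - 1) = (Z.q n)⁻¹ := by ring
      rw [e6, inv_pow] at hB2
      have h7 : 1 - Z.q n ≤ (Z.q n)⁻¹ - 1 := by
        have h8 : (Z.q n)⁻¹ * Z.q n = 1 := inv_mul_cancel₀ (Z.h0 n).ne'
        have h9 : 0 < (Z.q n)⁻¹ := inv_pos.2 (Z.h0 n)
        nlinarith [sq_nonneg (Z.q n - 1)]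
      have h10 : (Z.rI s n : ℝ) * (1 - Z.q n) ≤ (Z.rI s n : ℝ) * ((Z.q n)⁻¹ - 1) := by gcongr
      nlinarith
    · rw [← mul_div_assoc, div_le_div_iff₀ (by positivity) hn']
      have h7 : (Z.q n ^ Z.rI s n)⁻¹ - 1 ≤ (Z.q n ^ Z.rI s n)⁻¹ * ((Z.rI s n : ℝ) * (1 - Z.q n)) := by
        have h8 : (Z.q n ^ Z.rI s n)⁻¹ * Z.q n ^ Z.rI s n = 1 := inv_mul_cancel₀ hqi.ne'
        have h9 : 0 < (Z.q n ^ Z.rI s n)⁻¹ := inv_pos.2 hqi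
        nlinarith
      nlinarith
  · have h4 := (h3.sub_const 1).div Z.hlim hb
    have hβ := βpos hb
    have e : (Real.exp (Z.xf s * Z.β) - 1) / Z.β = s := by
      unfold xf
      rw [if_neg hb, div_mul_cancel₀ _ hb, Real.exp_log (by positivity)]
      field_simp; ring
    rw [e] at h4
    exact h4

/-- normalised exponential of the number of remaining rows -/
noncomputable def xh (Z : Sq) (n : ℕ) (T : Finset (ℕ × ℕ)) (i j : ℕ) : ℝ :=
  (Xv (Z.q n) (Finset.range i) T j - 1) / (n * (1 - Z.q n))

theorem xh_tendsto (Z : Sq) (M i j : ℕ → ℕ) (hi : ∀ n, i n ≤ n) (hj : ∀ n, j n ≤ M n) (s γ : ℝ)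
    (hs : Tendsto (fun n => Z.sc n (i n)) atTop (nhds s))
    (hγ : Tendsto (fun n => Z.q n ^ j n) atTop (nhds γ)) :
    Tendsto (fun w : ℕ × Finset (ℕ × ℕ) => Z.xh w.1 w.2 (i w.1) (j w.1)) (Z.wF M) (nhds (s * γ)) := by
  have h1 : Tendsto (fun w : ℕ × Finset (ℕ × ℕ) => Z.sc w.1 (i w.1) * Z.q w.1 ^ j w.1) (Z.wF M) (nhds (s * γ)) :=
    (hs.mul hγ).comp (fst_wF Z M)
  have h2 : Tendsto (fun w : ℕ × Finset (ℕ × ℕ) => Z.xh w.1 w.2 (i w.1) (j w.1) -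
      Z.sc w.1 (i w.1) * Z.q w.1 ^ j w.1) (Z.wF M) (nhds 0) := by
    rw [Metric.tendsto_nhds]
    intro η hη
    refine ev_of_le (fun n => Z.sc n (i n) * (n : ℝ)⁻¹ * (η ^ 2)⁻¹) ?_ ?_
    · have := (hs.mul (tendsto_inv_atTop_nhds_zero_nat (𝕜 := ℝ))).mul_const (η ^ 2)⁻¹
      simpa using this
    · filter_upwards [eventually_gt_atTop 0] with n hn
      have hn' : (0 : ℝ) < n := by positivity
      have hp := Z.p0 n
      set A := Finset.range (i n) ×ˢ Finset.range (j n) with hA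
      have hAs : A ⊆ sp M n := Finset.product_subset_product
        (Finset.range_subset_range.2 (hi n)) (Finset.range_subset_range.2 (hj n))
      set b := (n : ℝ) * (1 - Z.q n) with hb
      have hbpos : 0 < b := by positivity
      have h3 : Pr (fun _ => 1 - Z.q n) (sp M n) (fun T => ¬ dist (Z.xh n T (i n) (j n) -
        Z.sc n (i n) * Z.q n ^ j n) 0 < η) = Pr (fun _ => 1 - Z.q n) (sp M n) (fun T => b * η ≤
          |Xv (Z.q n) (Finset.range (i n)) (T ∩ A) (j n) - (1 + ((Z.q n ^ i n)⁻¹ - 1) * Z.q n ^ j n)|) := by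
        refine Pr_congr fun T _ => ?_
        have e1 : Xv (Z.q n) (Finset.range (i n)) (T ∩ A) (j n) = Xv (Z.q n) (Finset.range (i n)) T (j n) := by
          unfold Xv
          rw [Rset_congr (T := T ∩ A) (T' := T)]
          intro a ha k hk
          rw [Finset.mem_inter, hA, Finset.mem_product]
          simp only [Finset.mem_range] at ha ⊢
          tauto
        rw [e1, dist_zero_right, Real.norm_eq_abs, not_lt]
        have e2 : Z.xh n T (i n) (j n) - Z.sc n (i n) * Z.q n ^ j n =
          (Xv (Z.q n) (Finset.range (i n)) T (j n) - (1 + ((Z.q n ^ i n)⁻¹ - 1) * Z.q n ^ j n)) / b := by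
          unfold xh sc; rw [← hb]; field_simp; ring
        rw [e2, abs_div, abs_of_pos hbpos, le_div_iff₀ hbpos, mul_comm]
      rw [h3, Pr_inter _ _ _ hAs (fun T => b * η ≤
          |Xv (Z.q n) (Finset.range (i n)) T (j n) - (1 + ((Z.q n ^ i n)⁻¹ - 1) * Z.q n ^ j n)|)]
      have hv := X_var (Z.h0 n) (Z.h1 n).le (Finset.range (i n)) (j n)
      rw [Finset.card_range] at hv
      refine (Pr_cheb (Z.hP n _) _ _ _ hv _ (by positivity)).trans (le_of_eq ?_)
      unfold sc; rw [← hb]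
      have e3 : 1 - Z.q n = b / n := by rw [hb]; field_simp
      rw [e3]; field_simp
  have := h2.add h1
  simpa using this

end Sq
end ML

open Filter
namespace ML
namespace Sq

theorem pow_bd {q : ℝ} (h0 : 0 < q) (h1 : q < 1) (m : ℕ) :
    1 - q ^ m ≤ (1 - q) * m ∧ (1 - q) * m ≤ (q ^ m)⁻¹ - 1 := by
  constructor
  · have hB := one_add_mul_le_pow (a := -(1 - q)) (by linarith) m
    have e5 : 1 + -(1 - q) = q := by ring
    rw [e5] at hB; linarith
  · have hB2 := one_add_mul_le_pow (a := q⁻¹ - 1) (by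
      have : 0 < q⁻¹ := inv_pos.2 h0
      linarith) m
    have e6 : 1 + (q⁻¹ - 1) = q⁻¹ := by ring
    rw [e6, inv_pow] at hB2
    have h7 : 1 - q ≤ q⁻¹ - 1 := by
      have h8 : q⁻¹ * q = 1 := inv_mul_cancel₀ h0.ne'
      have h9 : 0 < q⁻¹ := inv_pos.2 h0
      nlinarith [sq_nonneg (q - 1)]
    have h10 : (1 - q) * m ≤ (q⁻¹ - 1) * m := by gcongr
    linarith

/-- admissible boxes -/
structure Box (Z : Sq) (γ0 s1 s2 γ1 γ2 : ℝ) : Prop where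
  a1 : 0 ≤ s1
  a2 : s1 < s2
  a3 : s2 ≤ Z.S
  b0 : 0 < γ0
  b1 : γ0 ≤ γ2
  b2 : γ2 < γ1
  b3 : γ1 ≤ 1

variable {Z : Sq} {γ0 s1 s2 γ1 γ2 : ℝ}

namespace Box
theorem c1 (B : Box Z γ0 s1 s2 γ1 γ2) : 0 < γ2 := B.b0.trans_le B.b1
theorem c2 (B : Box Z γ0 s1 s2 γ1 γ2) : 0 < γ1 := B.c1.trans B.b2
theorem i12 (B : Box Z γ0 s1 s2 γ1 γ2) (n : ℕ) : Z.rI s1 n ≤ Z.rI s2 n := Z.rI_mono B.a1 B.a2.le n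
theorem i2n (B : Box Z γ0 s1 s2 γ1 γ2) (n : ℕ) : Z.rI s2 n ≤ n := Z.rI_le (B.a1.trans B.a2.le) B.a3 n
theorem i1n (B : Box Z γ0 s1 s2 γ1 γ2) (n : ℕ) : Z.rI s1 n ≤ n := (B.i12 n).trans (B.i2n n)
theorem j12 (B : Box Z γ0 s1 s2 γ1 γ2) (n : ℕ) : Z.cI γ1 n ≤ Z.cI γ2 n := Z.cI_anti B.c1 B.b2.le n
theorem j2M (B : Box Z γ0 s1 s2 γ1 γ2) (n : ℕ) : Z.cI γ2 n ≤ Z.cI γ0 n := Z.cI_anti B.b0 B.b1 n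
theorem j1M (B : Box Z γ0 s1 s2 γ1 γ2) (n : ℕ) : Z.cI γ1 n ≤ Z.cI γ0 n := (B.j12 n).trans (B.j2M n)

theorem x11 (B : Box Z γ0 s1 s2 γ1 γ2) :
    Tendsto (fun w : ℕ × Finset (ℕ × ℕ) => Z.xh w.1 w.2 (Z.rI s1 w.1) (Z.cI γ1 w.1)) (Z.wF (Z.cI γ0))
      (nhds (s1 * γ1)) :=
  Z.xh_tendsto _ _ _ B.i1n B.j1M _ _ (Z.rI_tendsto B.a1) (Z.cI_tendsto B.c2 B.b3)
theorem x21 (B : Box Z γ0 s1 s2 γ1 γ2) :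
    Tendsto (fun w : ℕ × Finset (ℕ × ℕ) => Z.xh w.1 w.2 (Z.rI s2 w.1) (Z.cI γ1 w.1)) (Z.wF (Z.cI γ0))
      (nhds (s2 * γ1)) :=
  Z.xh_tendsto _ _ _ B.i2n B.j1M _ _ (Z.rI_tendsto (B.a1.trans B.a2.le)) (Z.cI_tendsto B.c2 B.b3)
theorem x12 (B : Box Z γ0 s1 s2 γ1 γ2) :
    Tendsto (fun w : ℕ × Finset (ℕ × ℕ) => Z.xh w.1 w.2 (Z.rI s1 w.1) (Z.cI γ2 w.1)) (Z.wF (Z.cI γ0))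
      (nhds (s1 * γ2)) :=
  Z.xh_tendsto _ _ _ B.i1n B.j2M _ _ (Z.rI_tendsto B.a1) (Z.cI_tendsto B.c1 (B.b2.le.trans B.b3))
theorem tb (Z : Sq) (M : ℕ → ℕ) : Tendsto (fun w : ℕ × Finset (ℕ × ℕ) => (w.1 : ℝ) * (1 - Z.q w.1)) (Z.wF M) (nhds Z.β) :=
  Z.hlim.comp (fst_wF Z M)

theorem D11 (B : Box Z γ0 s1 s2 γ1 γ2) : 0 < 1 + Z.β * (s1 * γ1) := by
  have := mul_nonneg Z.hβ (mul_nonneg B.a1 B.c2.le); linarith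
theorem D21 (B : Box Z γ0 s1 s2 γ1 γ2) : 0 < 1 + Z.β * (s2 * γ1) := by
  have := mul_nonneg Z.hβ (mul_nonneg (B.a1.trans B.a2.le) B.c2.le); linarith
theorem D12 (B : Box Z γ0 s1 s2 γ1 γ2) : 0 < 1 + Z.β * (s1 * γ2) := by
  have := mul_nonneg Z.hβ (mul_nonneg B.a1 B.c1.le); linarith
end Box

/-- number of available rows in the box -/
noncomputable def rw' (Z : Sq) (s1 s2 γ1 : ℝ) (w : ℕ × Finset (ℕ × ℕ)) : ℝ :=
  ((Ab w.1 (Z.rI s1 w.1) (Z.rI s2 w.1) (Z.cI γ1 w.1) w.2).card : ℝ)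
/-- number of available columns in the box -/
noncomputable def cw' (Z : Sq) (s1 γ1 γ2 : ℝ) (w : ℕ × Finset (ℕ × ℕ)) : ℝ :=
  ((Bb (Z.rI s1 w.1) (Z.cI γ1 w.1) (Z.cI γ2 w.1) w.2).card : ℝ)

theorem X_xh (Z : Sq) {n : ℕ} (hn : 0 < n) (T : Finset (ℕ × ℕ)) (i j : ℕ) :
    (Z.q n ^ (Rset (Finset.range i) T j).card)⁻¹ = 1 + n * (1 - Z.q n) * Z.xh n T i j := by
  have hn' : (0 : ℝ) < n := by positivity
  have := Z.p0 n
  unfold xh Xv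
  rw [mul_div_cancel₀ _ (by positivity)]; ring

theorem xh_pos (Z : Sq) {n : ℕ} (hn : 0 < n) (T : Finset (ℕ × ℕ)) (i j : ℕ) :
    0 < 1 + n * (1 - Z.q n) * Z.xh n T i j := by
  rw [← X_xh Z hn]; exact inv_pos.2 (pow_pos (Z.h0 n) _)

theorem row_bd (B : Box Z γ0 s1 s2 γ1 γ2) {w : ℕ × Finset (ℕ × ℕ)} (hn : 0 < w.1) :
    (Z.xh w.1 w.2 (Z.rI s2 w.1) (Z.cI γ1 w.1) - Z.xh w.1 w.2 (Z.rI s1 w.1) (Z.cI γ1 w.1)) /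
      (1 + w.1 * (1 - Z.q w.1) * Z.xh w.1 w.2 (Z.rI s2 w.1) (Z.cI γ1 w.1)) ≤ rw' Z s1 s2 γ1 w / w.1 ∧
    rw' Z s1 s2 γ1 w / w.1 ≤
    (Z.xh w.1 w.2 (Z.rI s2 w.1) (Z.cI γ1 w.1) - Z.xh w.1 w.2 (Z.rI s1 w.1) (Z.cI γ1 w.1)) /
      (1 + w.1 * (1 - Z.q w.1) * Z.xh w.1 w.2 (Z.rI s1 w.1) (Z.cI γ1 w.1)) := by
  have hn' : (0 : ℝ) < w.1 := by positivity
  have hp := Z.p0 w.1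
  have hA := card_Ab (j1 := Z.cI γ1 w.1) (B.i12 w.1) (B.i2n w.1) w.2
  have e1 := X_xh Z hn w.2 (Z.rI s1 w.1) (Z.cI γ1 w.1)
  have e2 := X_xh Z hn w.2 (Z.rI s2 w.1) (Z.cI γ1 w.1)
  have p1 := xh_pos Z hn w.2 (Z.rI s1 w.1) (Z.cI γ1 w.1)
  have p2 := xh_pos Z hn w.2 (Z.rI s2 w.1) (Z.cI γ1 w.1)
  have hbd := pow_bd (Z.h0 w.1) (Z.h1 w.1) (Ab w.1 (Z.rI s1 w.1) (Z.rI s2 w.1) (Z.cI γ1 w.1) w.2).card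
  rw [← hA, pow_add, mul_inv, e1] at e2
  rw [rw']
  set r := (Ab w.1 (Z.rI s1 w.1) (Z.rI s2 w.1) (Z.cI γ1 w.1) w.2).card
  have hq : 0 < Z.q w.1 ^ r := pow_pos (Z.h0 w.1) _
  set x1 := Z.xh w.1 w.2 (Z.rI s1 w.1) (Z.cI γ1 w.1)
  set x2 := Z.xh w.1 w.2 (Z.rI s2 w.1) (Z.cI γ1 w.1)
  set Q := Z.q w.1 ^ r
  set p := 1 - Z.q w.1
  have e3 : 1 + w.1 * p * x1 = Q * (1 + w.1 * p * x2) := by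
    rw [← e2, ← mul_assoc, mul_inv_cancel₀ hq.ne', one_mul]
  constructor
  · rw [div_le_div_iff₀ p2 hn']
    have h : (1 - Q) * (1 + w.1 * p * x2) ≤ p * r * (1 + w.1 * p * x2) := by
      gcongr; exact hbd.1
    have h2 : p * ((x2 - x1) * w.1) ≤ p * (r * (1 + w.1 * p * x2)) := by nlinarith
    exact le_of_mul_le_mul_left h2 hp
  · rw [div_le_div_iff₀ hn' p1]
    have h : p * r * (1 + w.1 * p * x1) ≤ (Q⁻¹ - 1) * (1 + w.1 * p * x1) := by
      gcongr; exact hbd.2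
    have h2 : p * (r * (1 + w.1 * p * x1)) ≤ p * ((x2 - x1) * w.1) := by nlinarith
    exact le_of_mul_le_mul_left h2 hp

theorem col_bd (B : Box Z γ0 s1 s2 γ1 γ2) {w : ℕ × Finset (ℕ × ℕ)} (hn : 0 < w.1) :
    (1 - Z.q w.1 ^ (Z.cI γ2 w.1) * (1 + w.1 * (1 - Z.q w.1) * Z.xh w.1 w.2 (Z.rI s1 w.1) (Z.cI γ1 w.1)) /
      (Z.q w.1 ^ (Z.cI γ1 w.1) * (1 + w.1 * (1 - Z.q w.1) * Z.xh w.1 w.2 (Z.rI s1 w.1) (Z.cI γ2 w.1)))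
      ≤ (1 - Z.q w.1) * cw' Z s1 γ1 γ2 w) ∧
    (1 - Z.q w.1) * cw' Z s1 γ1 γ2 w ≤
    (Z.q w.1 ^ (Z.cI γ1 w.1) * (1 + w.1 * (1 - Z.q w.1) * Z.xh w.1 w.2 (Z.rI s1 w.1) (Z.cI γ2 w.1))) /
     (Z.q w.1 ^ (Z.cI γ2 w.1) * (1 + w.1 * (1 - Z.q w.1) * Z.xh w.1 w.2 (Z.rI s1 w.1) (Z.cI γ1 w.1))) - 1 := by
  have hA := card_Bb (Z.rI s1 w.1) _ _ (B.j12 w.1) w.2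
  have e1 := X_xh Z hn w.2 (Z.rI s1 w.1) (Z.cI γ1 w.1)
  have e2 := X_xh Z hn w.2 (Z.rI s1 w.1) (Z.cI γ2 w.1)
  have hj := B.j12 w.1
  have hbd := pow_bd (Z.h0 w.1) (Z.h1 w.1) (Bb (Z.rI s1 w.1) (Z.cI γ1 w.1) (Z.cI γ2 w.1) w.2).card
  have hA2 : (Bb (Z.rI s1 w.1) (Z.cI γ1 w.1) (Z.cI γ2 w.1) w.2).card +
    (Rset (Finset.range (Z.rI s1 w.1)) w.2 (Z.cI γ1 w.1)).card + Z.cI γ1 w.1 =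
    Z.cI γ2 w.1 + (Rset (Finset.range (Z.rI s1 w.1)) w.2 (Z.cI γ2 w.1)).card := by omega
  rw [← e1, ← e2, cw']
  have hq := Z.h0 w.1
  have key := congrArg (fun m => Z.q w.1 ^ m) hA2
  simp only [pow_add] at key
  set c := (Bb (Z.rI s1 w.1) (Z.cI γ1 w.1) (Z.cI γ2 w.1) w.2).card
  have k1 : Z.q w.1 ^ c = Z.q w.1 ^ (Z.cI γ2 w.1) * (Z.q w.1 ^ (Rset (Finset.range (Z.rI s1 w.1)) w.2 (Z.cI γ1 w.1)).card)⁻¹ /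
      (Z.q w.1 ^ (Z.cI γ1 w.1) * (Z.q w.1 ^ (Rset (Finset.range (Z.rI s1 w.1)) w.2 (Z.cI γ2 w.1)).card)⁻¹) := by
    generalize (Rset (Finset.range (Z.rI s1 w.1)) w.2 (Z.cI γ1 w.1)).card = u1 at *
    generalize (Rset (Finset.range (Z.rI s1 w.1)) w.2 (Z.cI γ2 w.1)).card = u2 at *
    have h1 : 0 < Z.q w.1 ^ u1 := pow_pos hq _
    have h2 : 0 < Z.q w.1 ^ u2 := pow_pos hq _
    have h3 : 0 < Z.q w.1 ^ (Z.cI γ1 w.1) := pow_pos hq _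
    rw [eq_div_iff (by positivity)]
    field_simp
    linarith
  rw [← k1]
  refine ⟨hbd.1, ?_⟩
  have k2 := congrArg (·⁻¹) k1
  simp only [inv_div] at k2
  rw [← k2]; exact hbd.2

theorem row_up (B : Box Z γ0 s1 s2 γ1 γ2) (ρ : ℝ) (h : (s2 - s1) * γ1 / (1 + Z.β * (s1 * γ1)) < ρ) :
    ∀ᶠ w in Z.wF (Z.cI γ0), rw' Z s1 s2 γ1 w / w.1 < ρ := by
  have h1 := (B.x21.sub B.x11).div (((Box.tb Z (Z.cI γ0)).mul B.x11).const_add 1) B.D11.ne'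
  rw [← sub_mul] at h1
  filter_upwards [h1.eventually (eventually_lt_nhds h), ev_fst (eventually_gt_atTop 0)] with w h2 h3
  exact (row_bd B h3).2.trans_lt h2

theorem row_low (B : Box Z γ0 s1 s2 γ1 γ2) (ρ : ℝ) (h : ρ < (s2 - s1) * γ1 / (1 + Z.β * (s2 * γ1))) :
    ∀ᶠ w in Z.wF (Z.cI γ0), ρ < rw' Z s1 s2 γ1 w / w.1 := by
  have h1 := (B.x21.sub B.x11).div (((Box.tb Z (Z.cI γ0)).mul B.x21).const_add 1) B.D21.ne'
  rw [← sub_mul] at h1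
  filter_upwards [h1.eventually (eventually_gt_nhds h), ev_fst (eventually_gt_atTop 0)] with w h2 h3
  exact h2.trans_le (row_bd B h3).1

theorem col_up (B : Box Z γ0 s1 s2 γ1 γ2) (κ : ℝ) (h : (γ1 - γ2) / (γ2 * (1 + Z.β * (s1 * γ1))) < κ) :
    ∀ᶠ w in Z.wF (Z.cI γ0), (1 - Z.q w.1) * cw' Z s1 γ1 γ2 w < κ := by
  have g1 := (Z.cI_tendsto B.c2 B.b3).comp (fst_wF Z (Z.cI γ0))
  have g2 := (Z.cI_tendsto B.c1 (B.b2.le.trans B.b3)).comp (fst_wF Z (Z.cI γ0))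
  have h1 := ((g1.mul (((Box.tb Z (Z.cI γ0)).mul B.x12).const_add 1)).div
    (g2.mul (((Box.tb Z (Z.cI γ0)).mul B.x11).const_add 1)) (mul_pos B.c1 B.D11).ne').sub_const 1
  have e : γ1 * (1 + Z.β * (s1 * γ2)) / (γ2 * (1 + Z.β * (s1 * γ1))) - 1 =
    (γ1 - γ2) / (γ2 * (1 + Z.β * (s1 * γ1))) := by
    rw [div_sub_one (mul_pos B.c1 B.D11).ne']; congr 1; ring
  rw [e] at h1
  filter_upwards [h1.eventually (eventually_lt_nhds h), ev_fst (eventually_gt_atTop 0)] with w h2 h3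
  exact (col_bd B h3).2.trans_lt h2

theorem col_low (B : Box Z γ0 s1 s2 γ1 γ2) (κ : ℝ) (h : κ < (γ1 - γ2) / (γ1 * (1 + Z.β * (s1 * γ2)))) :
    ∀ᶠ w in Z.wF (Z.cI γ0), κ < (1 - Z.q w.1) * cw' Z s1 γ1 γ2 w := by
  have g1 := (Z.cI_tendsto B.c2 B.b3).comp (fst_wF Z (Z.cI γ0))
  have g2 := (Z.cI_tendsto B.c1 (B.b2.le.trans B.b3)).comp (fst_wF Z (Z.cI γ0))
  have h1 := ((g2.mul (((Box.tb Z (Z.cI γ0)).mul B.x11).const_add 1)).div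
    (g1.mul (((Box.tb Z (Z.cI γ0)).mul B.x12).const_add 1)) (mul_pos B.c2 B.D12).ne').const_sub 1
  have e : 1 - γ2 * (1 + Z.β * (s1 * γ1)) / (γ1 * (1 + Z.β * (s1 * γ2))) =
    (γ1 - γ2) / (γ1 * (1 + Z.β * (s1 * γ2))) := by
    rw [one_sub_div (mul_pos B.c2 B.D12).ne']; congr 1; ring
  rw [e] at h1
  filter_upwards [h1.eventually (eventually_gt_nhds h), ev_fst (eventually_gt_atTop 0)] with w h2 h3
  exact h2.trans_le (col_bd B h3).1

end Sq
end ML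

open Filter
namespace ML
namespace Sq
variable {Z : Sq} {γ0 s1 s2 γ1 γ2 : ℝ}

theorem ev_of_small {Z : Sq} {M : ℕ → ℕ} {E : ℕ × Finset (ℕ × ℕ) → Prop}
    (h : ∀ e > 0, ∀ᶠ n in atTop, Pr (fun _ => 1 - Z.q n) (sp M n) (fun T => ¬ E (n, T)) ≤ e) :
    ∀ᶠ w in Z.wF M, E w := by
  rw [ev_wF, Metric.tendsto_nhds]
  intro e he
  filter_upwards [h (e / 2) (by positivity)] with n hn
  rw [Real.dist_0_eq_abs, abs_of_nonneg (Pr_nonneg (Z.hP n _) _)]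
  linarith

theorem sqrt_nat_atTop : Tendsto (fun n : ℕ => Real.sqrt n) atTop atTop :=
  Real.tendsto_sqrt_atTop.comp tendsto_natCast_atTop_atTop

/-- the box of cells -/
noncomputable def QB (Z : Sq) (s1 s2 γ1 γ2 : ℝ) (n : ℕ) : Finset (ℕ × ℕ) :=
  Qb (Z.rI s1 n) (Z.rI s2 n) (Z.cI γ1 n) (Z.cI γ2 n)

/-- kept cells -/
noncomputable def KP (Z : Sq) (γ0 : ℝ) (w : ℕ × Finset (ℕ × ℕ)) : Finset (ℕ × ℕ) :=
  Kept (Finset.range w.1) w.2 (Z.cI γ0 w.1)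

theorem QB_sub (B : Box Z γ0 s1 s2 γ1 γ2) (n : ℕ) : QB Z s1 s2 γ1 γ2 n ⊆ sp (Z.cI γ0) n := by
  intro x hx
  rw [QB, mem_Qb] at hx
  rw [sp, Finset.mem_product, Finset.mem_range, Finset.mem_range]
  have := B.i2n n; have := B.j2M n; omega

theorem rect_up (B : Box Z γ0 s1 s2 γ1 γ2) (d : Bool) (α t : ℝ) (hα : 0 < α)
    (h : α * ((s2 - s1) * γ1 / (1 + Z.β * (s1 * γ1))) + (γ1 - γ2) / (γ2 * (1 + Z.β * (s1 * γ1))) / α < t) :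
    ∀ᶠ w in Z.wF (Z.cI γ0), (L d (KP Z γ0 w ∩ QB Z s1 s2 γ1 γ2 w.1) : ℝ) < Real.sqrt w.1 * t := by
  set R := (s2 - s1) * γ1 / (1 + Z.β * (s1 * γ1)) with hR
  set C := (γ1 - γ2) / (γ2 * (1 + Z.β * (s1 * γ1))) with hC
  have hR0 : 0 ≤ R := div_nonneg (mul_nonneg (by linarith [B.a2]) B.c2.le) B.D11.le
  have hC0 : 0 ≤ C := div_nonneg (by linarith [B.b2]) (mul_pos B.c1 B.D11).le
  set δ := (t - (α * R + C / α)) / (α + 1 / α + 1) with hδ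
  have hδ0 : 0 < δ := div_pos (by linarith) (by positivity)
  have hδt : α * (R + δ) + (C + δ) / α + δ = t := by
    have : δ * (α + 1 / α + 1) = t - (α * R + C / α) := div_mul_cancel₀ _ (by positivity)
    have e : (C + δ) / α = C / α + δ * (1 / α) := by ring
    rw [e]; linarith
  have ht : 0 < t := by rw [← hδt]; positivity
  have key : ∀ᶠ w in Z.wF (Z.cI γ0), ¬ ((rw' Z s1 s2 γ1 w / w.1 < R + δ ∧ (1 - Z.q w.1) * cw' Z s1 γ1 γ2 w < C + δ)
      ∧ Real.sqrt w.1 * t ≤ L d (w.2 ∩ (Ab w.1 (Z.rI s1 w.1) (Z.rI s2 w.1) (Z.cI γ1 w.1) w.2 ×ˢ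
        Bb (Z.rI s1 w.1) (Z.cI γ1 w.1) (Z.cI γ2 w.1) w.2))) := by
    refine ev_of_le (fun n => 2 * t / δ ^ 2 / Real.sqrt n) ?_ ?_
    · exact sqrt_nat_atTop.const_div_atTop _
    · filter_upwards [eventually_gt_atTop 0, sqrt_nat_atTop.eventually_gt_atTop α] with n hn hna
      simp only [not_not]
      have hn' : (0 : ℝ) < n := by positivity
      have hsn : 0 < Real.sqrt n := Real.sqrt_pos.2 hn'
      have hss : Real.sqrt n * Real.sqrt n = n := Real.mul_self_sqrt hn'.le
      refine box_cond (Z.p0 n).le (Z.p1 n) (by positivity) (sp (Z.cI γ0) n) (QB Z s1 s2 γ1 γ2 n) (QB_sub B n)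
        (fun T => Ab n (Z.rI s1 n) (Z.rI s2 n) (Z.cI γ1 n) T) (fun T => Bb (Z.rI s1 n) (Z.cI γ1 n) (Z.cI γ2 n) T)
        (fun T => Ab_sdiff _ _ _ _ _ T) (fun T => Bb_sdiff _ _ _ _ T) (fun T => AB_sub _ _ _ _ _ T)
        (fun A B => (A.card : ℝ) / n < R + δ ∧ (1 - Z.q n) * B.card < C + δ)
        (fun _ _ T' => Real.sqrt n * t ≤ L d T') ?_
      rintro A B' ⟨g1, g2⟩
      have ha1 : α / Real.sqrt n < 1 := by rw [div_lt_one hsn]; exact hna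
      have hbd : α / Real.sqrt n * A.card + (1 - Z.q n) / (α / Real.sqrt n) * B'.card
          ≤ Real.sqrt n * (α * (R + δ) + (C + δ) / α) := by
        rw [div_lt_iff₀ hn'] at g1
        have e1 : α / Real.sqrt n * A.card ≤ α / Real.sqrt n * ((R + δ) * n) := by gcongr
        have e2 : α / Real.sqrt n * ((R + δ) * n) = Real.sqrt n * (α * (R + δ)) := by
          nth_rewrite 2 [← hss]; field_simp
        have e3 : (1 - Z.q n) / (α / Real.sqrt n) * B'.card = Real.sqrt n / α * ((1 - Z.q n) * B'.card) := by
          field_simp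
        have e4 : Real.sqrt n / α * ((1 - Z.q n) * B'.card) ≤ Real.sqrt n / α * (C + δ) := by gcongr
        have e5 : Real.sqrt n / α * (C + δ) = Real.sqrt n * ((C + δ) / α) := by ring
        linarith
      have hup := up_prob_AB (p := 1 - Z.q n) (a := α / Real.sqrt n) (by positivity) ha1 (Z.p0 n) (Z.p1 n) d A B'
        (δ * Real.sqrt n) (by positivity)
      refine (Pr_mono (Z.hP n _) fun T _ hT => ?_).trans (hup.trans ?_)
      · refine le_trans ?_ hT
        have : Real.sqrt n * t = Real.sqrt n * (α * (R + δ) + (C + δ) / α) + δ * Real.sqrt n := by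
          rw [← hδt]; ring
        linarith
      · have h5 : α * (R + δ) + (C + δ) / α ≤ t := by linarith
        have h6 : α / Real.sqrt n * A.card + (1 - Z.q n) / (α / Real.sqrt n) * B'.card ≤ Real.sqrt n * t :=
          hbd.trans (by gcongr)
        calc _ ≤ 2 * (Real.sqrt n * t) / (δ * Real.sqrt n) ^ 2 := by gcongr
          _ = _ := by field_simp
  filter_upwards [key, row_up B (R + δ) (by linarith), col_up B (C + δ) (by linarith)] with w h1 h2 h3
  by_contra h4
  refine h1 ⟨⟨h2, h3⟩, (not_lt.1 h4).trans ?_⟩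
  exact_mod_cast L_mono (Kept_sub_AB (B.i1n w.1) w.2)

theorem rect_low1 (B : Box Z γ0 s1 s2 γ1 γ2) (d : Bool) (t : ℝ)
    (h : t < 2 * Real.sqrt ((s2 - s1) * γ1 / (1 + Z.β * (s2 * γ1)) * ((γ1 - γ2) / (γ1 * (1 + Z.β * (s1 * γ2)))))) :
    ∀ᶠ w in Z.wF (Z.cI γ0), Real.sqrt w.1 * t ≤
      (L d (w.2 ∩ (Ab w.1 (Z.rI s1 w.1) (Z.rI s2 w.1) (Z.cI γ1 w.1) w.2 ×ˢ
        Bb (Z.rI s1 w.1) (Z.cI γ1 w.1) (Z.cI γ2 w.1) w.2)) : ℝ) := by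
  set R := (s2 - s1) * γ1 / (1 + Z.β * (s2 * γ1)) with hR
  set C := (γ1 - γ2) / (γ1 * (1 + Z.β * (s1 * γ2))) with hC
  have hR0 : 0 < R := div_pos (mul_pos (by linarith [B.a2]) B.c2) B.D21
  have hC0 : 0 < C := div_pos (by linarith [B.b2]) (mul_pos B.c2 B.D12)
  obtain ⟨δ, hδ0, hδR, hδC, hδ1, hδt⟩ : ∃ δ : ℝ, 0 < δ ∧ δ < R ∧ δ < C ∧ δ < 1 ∧
      t < (2 - δ) * Real.sqrt ((R - δ) * (C - δ)) := by
    have hc : Continuous fun δ : ℝ => (2 - δ) * Real.sqrt ((R - δ) * (C - δ)) := by fun_prop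
    have h1 : ∀ᶠ δ in nhds (0:ℝ), t < (2 - δ) * Real.sqrt ((R - δ) * (C - δ)) := by
      refine hc.continuousAt.eventually (eventually_gt_nhds ?_)
      simpa using h
    have h2 : ∀ᶠ δ in nhdsWithin (0:ℝ) (Set.Ioi 0), 0 < δ ∧ δ < R ∧ δ < C ∧ δ < 1 ∧
      t < (2 - δ) * Real.sqrt ((R - δ) * (C - δ)) := by
      filter_upwards [self_mem_nhdsWithin, mem_nhdsWithin_of_mem_nhds (eventually_lt_nhds hR0),
        mem_nhdsWithin_of_mem_nhds (eventually_lt_nhds hC0),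
        mem_nhdsWithin_of_mem_nhds (eventually_lt_nhds one_pos),
        mem_nhdsWithin_of_mem_nhds h1] with δ a b c d e
      exact ⟨a, b, c, d, e⟩
    exact h2.exists
  set ρ := R - δ with hρ
  set κ := C - δ with hκ
  have hρ0 : 0 < ρ := by linarith
  have hκ0 : 0 < κ := by linarith
  set κ2 := (γ1 - γ2) / (γ2 * (1 + Z.β * (s1 * γ1))) + 1 with hκ2
  have key : ∀ᶠ w in Z.wF (Z.cI γ0), ¬ ((rw' Z s1 s2 γ1 w ≤ w.1 ∧ ρ < rw' Z s1 s2 γ1 w / w.1 ∧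
        κ < (1 - Z.q w.1) * cw' Z s1 γ1 γ2 w ∧ (1 - Z.q w.1) * cw' Z s1 γ1 γ2 w < κ2)
      ∧ L d (w.2 ∩ (Ab w.1 (Z.rI s1 w.1) (Z.rI s2 w.1) (Z.cI γ1 w.1) w.2 ×ˢ
        Bb (Z.rI s1 w.1) (Z.cI γ1 w.1) (Z.cI γ2 w.1) w.2)) < Real.sqrt w.1 * t) := by
    refine ev_of_small fun e he => ?_
    obtain ⟨s0, a0, hs0, ha0, hlow⟩ := low_prob (min δ e) (lt_min hδ0 he) ((min_le_left _ _).trans hδ1.le)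
    have t1 : ∀ᶠ n : ℕ in atTop, κ2 < a0 * ρ * n :=
      (tendsto_natCast_atTop_atTop.const_mul_atTop (mul_pos ha0 hρ0)).eventually_gt_atTop κ2
    have t2 : ∀ᶠ n : ℕ in atTop, (n : ℝ) * (1 - Z.q n) * (1 - Z.q n) < a0 * κ := by
      have := Z.hlim.mul Z.tp
      rw [mul_zero] at this
      exact this.eventually (eventually_lt_nhds (mul_pos ha0 hκ0))
    have t3 : ∀ᶠ n : ℕ in atTop, s0 < ρ * κ * n :=
      (tendsto_natCast_atTop_atTop.const_mul_atTop (mul_pos hρ0 hκ0)).eventually_gt_atTop s0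
    filter_upwards [eventually_gt_atTop 0, t1, t2, t3] with n hn t1 t2 t3
    simp only [not_not]
    have hn' : (0 : ℝ) < n := by positivity
    have hp := Z.p0 n
    refine box_cond (Z.p0 n).le (Z.p1 n) he.le (sp (Z.cI γ0) n) (QB Z s1 s2 γ1 γ2 n) (QB_sub B n)
        (fun T => Ab n (Z.rI s1 n) (Z.rI s2 n) (Z.cI γ1 n) T) (fun T => Bb (Z.rI s1 n) (Z.cI γ1 n) (Z.cI γ2 n) T)
        (fun T => Ab_sdiff _ _ _ _ _ T) (fun T => Bb_sdiff _ _ _ _ T) (fun T => AB_sub _ _ _ _ _ T)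
        (fun A B => (A.card : ℝ) ≤ n ∧ ρ < (A.card : ℝ) / n ∧ κ < (1 - Z.q n) * B.card ∧ (1 - Z.q n) * B.card < κ2)
        (fun _ _ T' => L d T' < Real.sqrt n * t) ?_
    rintro A B' ⟨g0, g1, g2, g3⟩
    rw [lt_div_iff₀ hn'] at g1
    rw [Pr_L_std (1 - Z.q n) d A B' (fun k => (k : ℝ) < Real.sqrt n * t)]
    have hA0 : (0 : ℝ) < A.card := lt_trans (by positivity) g1
    have hB0 : (0 : ℝ) < B'.card := by
      by_contra hh
      have h9 : (B'.card : ℝ) = 0 := le_antisymm (not_lt.1 hh) (by positivity)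
      rw [h9, mul_zero] at g2; linarith
    have hl := hlow (1 - Z.q n) A.card B'.card hp (Z.p1 n) (by exact_mod_cast hA0) (by exact_mod_cast hB0)
      (by nlinarith) (by
        have h8 : (1 - Z.q n) * ((1 - Z.q n) * A.card) ≤ (1 - Z.q n) * (a0 * B'.card) := by
          have h81 : (1 - Z.q n) * A.card ≤ (1 - Z.q n) * n := by gcongr
          have h82 : (1 - Z.q n) * ((1 - Z.q n) * A.card) ≤ (1 - Z.q n) * ((1 - Z.q n) * n) := by gcongr
          have h83 : a0 * κ ≤ a0 * ((1 - Z.q n) * B'.card) := by gcongr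
          linarith
        exact le_of_mul_le_mul_left h8 hp) (by
        have : ρ * n * κ ≤ A.card * ((1 - Z.q n) * B'.card) := by gcongr
        linarith)
    refine (Pr_mono (Z.hP n _) fun T _ hT => ?_).trans (hl.trans (min_le_right _ _))
    refine lt_of_lt_of_le hT ?_
    have h10 : Real.sqrt n * Real.sqrt (ρ * κ) ≤ Real.sqrt ((1 - Z.q n) * A.card * B'.card) := by
      rw [← Real.sqrt_mul hn'.le]
      refine Real.sqrt_le_sqrt ?_
      have : ρ * n * κ ≤ A.card * ((1 - Z.q n) * B'.card) := by gcongr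
      linarith
    have hm : min δ e ≤ δ := min_le_left _ _
    calc Real.sqrt n * t ≤ Real.sqrt n * ((2 - δ) * Real.sqrt (ρ * κ)) := by gcongr
      _ = (2 - δ) * (Real.sqrt n * Real.sqrt (ρ * κ)) := by ring
      _ ≤ (2 - min δ e) * (Real.sqrt n * Real.sqrt (ρ * κ)) := by gcongr
      _ ≤ _ := by
        gcongr
        linarith
  filter_upwards [key, row_low B ρ (by linarith), col_low B κ (by linarith), col_up B κ2 (by linarith)] with w h1 h2 h3 h4
  by_contra h5
  refine h1 ⟨⟨?_, h2, h3, h4⟩, not_le.1 h5⟩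
  unfold rw'
  have h6 : (Ab w.1 (Z.rI s1 w.1) (Z.rI s2 w.1) (Z.cI γ1 w.1) w.2) ⊆ Finset.range w.1 :=
    (Finset.filter_subset _ _).trans (Rset_subset _ _ _)
  have := Finset.card_le_card h6
  rw [Finset.card_range] at this
  exact_mod_cast this

end Sq
end ML

open Filter
namespace ML
namespace Sq
variable {Z : Sq} {γ0 s1 s2 γ1 γ2 : ℝ}

theorem H_bd (B : Box Z γ0 s1 s2 γ1 γ2) (e : ℝ) (he : s2 - s1 < e) :
    ∀ᶠ n : ℕ in atTop, ((Finset.Ico (Z.rI s1 n) (Z.rI s2 n)).card : ℝ) ≤ e * n := by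
  have h1 := (Z.rI_tendsto (B.a1.trans B.a2.le)).sub (Z.rI_tendsto B.a1)
  filter_upwards [h1.eventually (eventually_lt_nhds he), eventually_gt_atTop 0] with n h2 hn
  have hn' : (0 : ℝ) < n := by positivity
  have hp := Z.p0 n
  rw [Nat.card_Ico]
  have h3 := (pow_bd (Z.h0 n) (Z.h1 n) (Z.rI s2 n - Z.rI s1 n)).2
  set m := Z.rI s2 n - Z.rI s1 n with hm
  have e1 : Z.rI s2 n = m + Z.rI s1 n := by have := B.i12 n; omega
  unfold sc at h2
  rw [← sub_div, div_lt_iff₀ (by positivity), e1, pow_add] at h2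
  have q1 : 0 < Z.q n ^ m := pow_pos (Z.h0 n) _
  have q2 : 0 < Z.q n ^ Z.rI s1 n := pow_pos (Z.h0 n) _
  have q3 : 1 ≤ (Z.q n ^ Z.rI s1 n)⁻¹ := by
    rw [one_le_inv₀ q2]; exact pow_le_one₀ (Z.h0 n).le (Z.h1 n).le
  rw [mul_inv] at h2
  have h4 : (Z.q n ^ m)⁻¹ - 1 ≤ ((Z.q n ^ m)⁻¹ - 1) * (Z.q n ^ Z.rI s1 n)⁻¹ := by
    refine le_mul_of_one_le_right ?_ q3
    have : 0 ≤ (1 - Z.q n) * m := by positivity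
    linarith
  have h5 : (1 - Z.q n) * m ≤ (1 - Z.q n) * (e * n) := by nlinarith
  exact le_of_mul_le_mul_left h5 hp

theorem W_bd (B : Box Z γ0 s1 s2 γ1 γ2) (e : ℝ) (he : (γ1 - γ2) / γ2 < e) :
    ∀ᶠ n : ℕ in atTop, (1 - Z.q n) * ((Finset.Ico (Z.cI γ1 n) (Z.cI γ2 n)).card : ℝ) ≤ e := by
  have h1 := ((Z.cI_tendsto B.c2 B.b3).div (Z.cI_tendsto B.c1 (B.b2.le.trans B.b3)) B.c1.ne').sub_const 1
  rw [div_sub_one B.c1.ne'] at h1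
  filter_upwards [h1.eventually (eventually_lt_nhds he)] with n h2
  rw [Nat.card_Ico]
  have h3 := (pow_bd (Z.h0 n) (Z.h1 n) (Z.cI γ2 n - Z.cI γ1 n)).2
  refine h3.trans (le_trans (le_of_eq ?_) h2.le)
  have e1 : Z.q n ^ Z.cI γ2 n = Z.q n ^ (Z.cI γ2 n - Z.cI γ1 n) * Z.q n ^ Z.cI γ1 n := by
    rw [← pow_add]; congr 1; have := B.j12 n; omega
  have q2 : 0 < Z.q n ^ Z.cI γ1 n := pow_pos (Z.h0 n) _
  have q1 : 0 < Z.q n ^ (Z.cI γ2 n - Z.cI γ1 n) := pow_pos (Z.h0 n) _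
  simp only [Pi.div_apply]
  rw [e1]; field_simp

theorem del_ev (B : Box Z γ0 s1 s2 γ1 γ2) (d : Bool) (u : ℝ) (hu : 0 < u)
    (D : Finset (ℕ × ℕ) → Finset (ℕ × ℕ))
    (h : ∀ᶠ n : ℕ in atTop, ∀ k : ℕ, 0 < k → n * u ^ 2 ≤ (k : ℝ) ^ 2 →
      Pr (fun _ => 1 - Z.q n) (QB Z s1 s2 γ1 γ2 n) (fun T => k ≤ L d (D T)) ≤ (1 / 4) ^ k) :
    ∀ᶠ w in Z.wF (Z.cI γ0), (L d (D (w.2 ∩ QB Z s1 s2 γ1 γ2 w.1)) : ℝ) < Real.sqrt w.1 * u := by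
  have ht : Tendsto (fun n : ℕ => ⌈Real.sqrt n * u⌉₊) atTop atTop :=
    tendsto_nat_ceil_atTop.comp (sqrt_nat_atTop.atTop_mul_const hu)
  refine ev_of_le (fun n => (1 / 4 : ℝ) ^ ⌈Real.sqrt n * u⌉₊)
    ((tendsto_pow_atTop_nhds_zero_of_lt_one (by norm_num) (by norm_num)).comp ht) ?_
  filter_upwards [h, eventually_gt_atTop 0] with n h1 hn
  have hn' : (0 : ℝ) < n := by positivity
  have hsn : 0 < Real.sqrt n := Real.sqrt_pos.2 hn'
  have h2 := h1 ⌈Real.sqrt n * u⌉₊ (Nat.ceil_pos.2 (by positivity)) (by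
    have h3 := Nat.le_ceil (Real.sqrt n * u)
    calc (n : ℝ) * u ^ 2 = (Real.sqrt n * u) ^ 2 := by rw [mul_pow, Real.sq_sqrt hn'.le]
      _ ≤ _ := by gcongr)
  rw [← Pr_inter _ _ _ (QB_sub B n)] at h2
  refine le_trans (Pr_mono (Z.hP n _) fun T _ hT => ?_) h2
  exact Nat.ceil_le.2 (not_lt.1 hT)

theorem del_row (B : Box Z γ0 s1 s2 γ1 γ2) (d : Bool) (u : ℝ)
    (hu : 6 * Real.sqrt (s2 - s1) * ((γ1 - γ2) / γ2) < u) :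
    ∀ᶠ w in Z.wF (Z.cI γ0), (L d (Drow (w.2 ∩ QB Z s1 s2 γ1 γ2 w.1)) : ℝ) < Real.sqrt w.1 * u := by
  have hs : 0 < s2 - s1 := by linarith [B.a2]
  have hg : 0 < (γ1 - γ2) / γ2 := div_pos (by linarith [B.b2]) B.c1
  have hu0 : 0 < u := lt_of_le_of_lt (by positivity) hu
  obtain ⟨e, he, hee⟩ : ∃ e > 0, 36 * (s2 - s1 + e) * ((γ1 - γ2) / γ2 + e) ^ 2 < u ^ 2 := by
    have hc : Continuous fun e : ℝ => 36 * (s2 - s1 + e) * ((γ1 - γ2) / γ2 + e) ^ 2 := by fun_prop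
    have h1 : ∀ᶠ e in nhdsWithin (0:ℝ) (Set.Ioi 0), 36 * (s2 - s1 + e) * ((γ1 - γ2) / γ2 + e) ^ 2 < u ^ 2 := by
      refine mem_nhdsWithin_of_mem_nhds (hc.continuousAt.eventually (eventually_lt_nhds ?_))
      simp only [add_zero]
      have : (6 * Real.sqrt (s2 - s1) * ((γ1 - γ2) / γ2)) ^ 2 < u ^ 2 := by gcongr
      rw [mul_pow, mul_pow, Real.sq_sqrt hs.le] at this
      linarith
    obtain ⟨e, h2, h3⟩ := (h1.and self_mem_nhdsWithin).exists
    exact ⟨e, h3, h2⟩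
  refine del_ev B d u hu0 _ ?_
  filter_upwards [H_bd B (s2 - s1 + e) (by linarith), W_bd B ((γ1 - γ2) / γ2 + e) (by linarith)] with n h1 h2 k hk hk2
  have hp := Z.p0 n
  refine deleted_row hp.le (Z.p1 n) d _ _ k hk (le_trans ?_ hk2)
  set a := ((Finset.Ico (Z.rI s1 n) (Z.rI s2 n)).card : ℝ)
  set b := ((Finset.Ico (Z.cI γ1 n) (Z.cI γ2 n)).card : ℝ)
  have hb0 : 0 ≤ b := by positivity
  calc 36 * (1 - Z.q n) ^ 2 * a * b * b = 36 * a * ((1 - Z.q n) * b) ^ 2 := by ring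
    _ ≤ 36 * ((s2 - s1 + e) * n) * ((γ1 - γ2) / γ2 + e) ^ 2 := by gcongr
    _ = n * (36 * (s2 - s1 + e) * ((γ1 - γ2) / γ2 + e) ^ 2) := by ring
    _ ≤ _ := by gcongr

theorem del_col (B : Box Z γ0 s1 s2 γ1 γ2) (d : Bool) (u : ℝ)
    (hu : 6 * (s2 - s1) * Real.sqrt (Z.β * ((γ1 - γ2) / γ2)) < u) :
    ∀ᶠ w in Z.wF (Z.cI γ0), (L d (Dcol (w.2 ∩ QB Z s1 s2 γ1 γ2 w.1)) : ℝ) < Real.sqrt w.1 * u := by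
  have hs : 0 < s2 - s1 := by linarith [B.a2]
  have hg : 0 < (γ1 - γ2) / γ2 := div_pos (by linarith [B.b2]) B.c1
  have hu0 : 0 < u := lt_of_le_of_lt (by positivity) hu
  have hβ := Z.hβ
  obtain ⟨e, he, hee⟩ : ∃ e > 0, 36 * (s2 - s1 + e) ^ 2 * ((γ1 - γ2) / γ2 + e) * (Z.β + e) < u ^ 2 := by
    have hc : Continuous fun e : ℝ => 36 * (s2 - s1 + e) ^ 2 * ((γ1 - γ2) / γ2 + e) * (Z.β + e) := by fun_prop
    have h1 : ∀ᶠ e in nhdsWithin (0:ℝ) (Set.Ioi 0), 36 * (s2 - s1 + e) ^ 2 * ((γ1 - γ2) / γ2 + e) * (Z.β + e) < u ^ 2 := by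
      refine mem_nhdsWithin_of_mem_nhds (hc.continuousAt.eventually (eventually_lt_nhds ?_))
      simp only [add_zero]
      have : (6 * (s2 - s1) * Real.sqrt (Z.β * ((γ1 - γ2) / γ2))) ^ 2 < u ^ 2 := by gcongr
      rw [mul_pow, mul_pow, Real.sq_sqrt (by positivity)] at this
      linarith
    obtain ⟨e, h2, h3⟩ := (h1.and self_mem_nhdsWithin).exists
    exact ⟨e, h3, h2⟩
  refine del_ev B d u hu0 _ ?_
  filter_upwards [H_bd B (s2 - s1 + e) (by linarith), W_bd B ((γ1 - γ2) / γ2 + e) (by linarith),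
    Z.hlim.eventually (eventually_lt_nhds (show Z.β < Z.β + e by linarith))] with n h1 h2 h3 k hk hk2
  have hp := Z.p0 n
  refine deleted_col hp.le (Z.p1 n) d _ _ k hk (le_trans ?_ hk2)
  set a := ((Finset.Ico (Z.rI s1 n) (Z.rI s2 n)).card : ℝ)
  set b := ((Finset.Ico (Z.cI γ1 n) (Z.cI γ2 n)).card : ℝ)
  have hb0 : 0 ≤ b := by positivity
  have ha0 : 0 ≤ a := by positivity
  calc 36 * (1 - Z.q n) ^ 2 * a * b * a = 36 * a ^ 2 * ((1 - Z.q n) * b) * (1 - Z.q n) := by ring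
    _ ≤ 36 * ((s2 - s1 + e) * n) ^ 2 * ((γ1 - γ2) / γ2 + e) * (1 - Z.q n) := by gcongr
    _ = n * (36 * (s2 - s1 + e) ^ 2 * ((γ1 - γ2) / γ2 + e) * (n * (1 - Z.q n))) := by ring
    _ ≤ n * (36 * (s2 - s1 + e) ^ 2 * ((γ1 - γ2) / γ2 + e) * (Z.β + e)) := by gcongr
    _ ≤ _ := by gcongr

theorem rect_low (B : Box Z γ0 s1 s2 γ1 γ2) (d : Bool) (t : ℝ)
    (h : t < 2 * Real.sqrt ((s2 - s1) * (γ1 - γ2)) / (1 + Z.β * (s2 * γ1)) -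
      6 * Real.sqrt (s2 - s1) * ((γ1 - γ2) / γ2) - 6 * (s2 - s1) * Real.sqrt (Z.β * ((γ1 - γ2) / γ2))) :
    ∀ᶠ w in Z.wF (Z.cI γ0), Real.sqrt w.1 * t ≤ (L d (KP Z γ0 w ∩ QB Z s1 s2 γ1 γ2 w.1) : ℝ) := by
  have hs : 0 < s2 - s1 := by linarith [B.a2]
  have hg : 0 < γ1 - γ2 := by linarith [B.b2]
  have hmain : 2 * Real.sqrt ((s2 - s1) * (γ1 - γ2)) / (1 + Z.β * (s2 * γ1)) ≤
    2 * Real.sqrt ((s2 - s1) * γ1 / (1 + Z.β * (s2 * γ1)) * ((γ1 - γ2) / (γ1 * (1 + Z.β * (s1 * γ2))))) := by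
    rw [mul_div_assoc]
    refine mul_le_mul_of_nonneg_left ?_ (by norm_num)
    refine Real.le_sqrt_of_sq_le ?_
    rw [div_pow, Real.sq_sqrt (by positivity)]
    have hD : 1 + Z.β * (s1 * γ2) ≤ 1 + Z.β * (s2 * γ1) := by
      have := Z.hβ
      have := B.a1; have := B.a2.le; have := B.b2.le; have := B.c1.le
      have : 0 ≤ s2 := B.a1.trans B.a2.le
      gcongr
    have e : (s2 - s1) * γ1 / (1 + Z.β * (s2 * γ1)) * ((γ1 - γ2) / (γ1 * (1 + Z.β * (s1 * γ2)))) =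
      (s2 - s1) * (γ1 - γ2) / ((1 + Z.β * (s2 * γ1)) * (1 + Z.β * (s1 * γ2))) := by
      have h1 := B.D21.ne'; have h2 := B.D12.ne'; have h3 := B.c2.ne'
      rw [div_mul_div_comm, div_eq_div_iff (by simp [h1, h2, h3]) (by simp [h1, h2])]; ring
    rw [e, sq (1 + Z.β * (s2 * γ1))]
    have := B.D12; have := B.D21
    gcongr
  set δ := (2 * Real.sqrt ((s2 - s1) * (γ1 - γ2)) / (1 + Z.β * (s2 * γ1)) -
      6 * Real.sqrt (s2 - s1) * ((γ1 - γ2) / γ2) - 6 * (s2 - s1) * Real.sqrt (Z.β * ((γ1 - γ2) / γ2)) - t) / 3 with hδ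
  have hδ0 : 0 < δ := by rw [hδ]; linarith
  filter_upwards [rect_low1 B d (2 * Real.sqrt ((s2 - s1) * (γ1 - γ2)) / (1 + Z.β * (s2 * γ1)) - δ) (by linarith),
    del_row B d (6 * Real.sqrt (s2 - s1) * ((γ1 - γ2) / γ2) + δ) (by linarith),
    del_col B d (6 * (s2 - s1) * Real.sqrt (Z.β * ((γ1 - γ2) / γ2)) + δ) (by linarith)] with w h1 h2 h3
  have h4 : L d (w.2 ∩ (Ab w.1 (Z.rI s1 w.1) (Z.rI s2 w.1) (Z.cI γ1 w.1) w.2 ×ˢ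
        Bb (Z.rI s1 w.1) (Z.cI γ1 w.1) (Z.cI γ2 w.1) w.2)) ≤ L d (KP Z γ0 w ∩ QB Z s1 s2 γ1 γ2 w.1) +
        (L d (Drow (w.2 ∩ QB Z s1 s2 γ1 γ2 w.1)) + L d (Dcol (w.2 ∩ QB Z s1 s2 γ1 γ2 w.1))) := by
    refine (L_mono (AB_sub_Kept (B.i1n w.1) (B.j2M w.1) w.2)).trans ?_
    refine (L_union _ _ _).trans (add_le_add le_rfl (L_union _ _ _))
  have h5 : (L d (w.2 ∩ (Ab w.1 (Z.rI s1 w.1) (Z.rI s2 w.1) (Z.cI γ1 w.1) w.2 ×ˢ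
        Bb (Z.rI s1 w.1) (Z.cI γ1 w.1) (Z.cI γ2 w.1) w.2)) : ℝ) ≤ L d (KP Z γ0 w ∩ QB Z s1 s2 γ1 γ2 w.1) +
        (L d (Drow (w.2 ∩ QB Z s1 s2 γ1 γ2 w.1)) + L d (Dcol (w.2 ∩ QB Z s1 s2 γ1 γ2 w.1))) := by exact_mod_cast h4
  have h6 : t = (2 * Real.sqrt ((s2 - s1) * (γ1 - γ2)) / (1 + Z.β * (s2 * γ1)) - δ) -
    (6 * Real.sqrt (s2 - s1) * ((γ1 - γ2) / γ2) + δ) - (6 * (s2 - s1) * Real.sqrt (Z.β * ((γ1 - γ2) / γ2)) + δ) := by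
    rw [hδ]; ring
  rw [h6, mul_sub, mul_sub]
  linarith

end Sq
end ML

open Filter
namespace ML
namespace Sq

theorem chain_sum {ι : Type*} [DecidableEq ι] (X0 : Finset ι) (k l : ι → ℕ)
    (hc : ∀ x ∈ X0, ∀ y ∈ X0, (k x ≤ k y ∧ l x ≤ l y) ∨ (k y ≤ k x ∧ l y ≤ l x)) (K' N : ℕ) (Ψ : ℕ → ℕ → ℝ)
    (hΨ : ∀ k1 k2 l1 l2, k1 ≤ k2 → k2 ≤ N → l1 ≤ l2 → l2 ≤ N → Ψ k1 l1 ≤ Ψ k2 l2) (e : ℝ) (he : 0 ≤ e)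
    (hY : ∀ Y ⊆ X0, ∀ k1 k2 l1 l2, (∀ y ∈ Y, k1 ≤ k y ∧ k y ≤ k2 ∧ l1 ≤ l y ∧ l y ≤ l2) →
      k1 ≤ k2 → l1 ≤ l2 → k2 < N → l2 < N →
      k1 / K' = k2 / K' → l1 / K' = l2 / K' → (Y.card : ℝ) ≤ Ψ k2 l2 - Ψ k1 l1 + e)
    (hN : ∀ x ∈ X0, k x < N ∧ l x < N) :
    ∀ m a b, ∀ X ⊆ X0, a ≤ N → b ≤ N → (∀ x ∈ X, k x ≤ a ∧ l x ≤ b ∧ k x / K' + l x / K' < m) →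
      (X.card : ℝ) ≤ Ψ a b - Ψ 0 0 + m * e := by
  intro m
  induction m with
  | zero =>
    intro a b X hX ha hb h
    have : X = ∅ := Finset.eq_empty_of_forall_notMem fun x hx => absurd (h x hx).2.2 (Nat.not_lt_zero _)
    subst this
    have := hΨ 0 a 0 b (Nat.zero_le _) ha (Nat.zero_le _) hb
    simp; linarith
  | succ m ih =>
    intro a b X hX ha hb h
    set Y := X.filter (fun x => k x / K' + l x / K' = m) with hYd
    set X' := X.filter (fun x => ¬ k x / K' + l x / K' = m) with hXd
    have hcard : X.card = Y.card + X'.card := (Finset.card_filter_add_card_filter_not _).symm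
    have hX'X : X' ⊆ X := Finset.filter_subset _ _
    have hYX : Y ⊆ X := Finset.filter_subset _ _
    have hlt : ∀ x ∈ X', k x / K' + l x / K' < m := by
      intro x hx
      have h1 := h x (hX'X hx)
      have h2 := (Finset.mem_filter.1 hx).2
      omega
    rcases Y.eq_empty_or_nonempty with hE | hne
    · have := ih a b X' (hX'X.trans hX) ha hb fun x hx => ⟨(h x (hX'X hx)).1, (h x (hX'X hx)).2.1, hlt x hx⟩
      rw [hcard, hE]; push_cast
      simp only [Finset.card_empty, Nat.cast_zero, zero_add]
      linarith
    · obtain ⟨p1, hp1, hp1'⟩ := Finset.exists_min_image Y k hne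
      obtain ⟨p2, hp2, hp2'⟩ := Finset.exists_max_image Y k hne
      obtain ⟨r1, hr1, hr1'⟩ := Finset.exists_min_image Y l hne
      obtain ⟨r2, hr2, hr2'⟩ := Finset.exists_max_image Y l hne
      have hco : ∀ x ∈ Y, ∀ y ∈ Y, k x / K' = k y / K' ∧ l x / K' = l y / K' := by
        intro x hx y hy
        have h1 := (Finset.mem_filter.1 hx).2
        have h2 := (Finset.mem_filter.1 hy).2
        rcases hc x (hX (hYX hx)) y (hX (hYX hy)) with ⟨h3, h4⟩ | ⟨h3, h4⟩
        · have := Nat.div_le_div_right (c := K') h3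
          have := Nat.div_le_div_right (c := K') h4
          omega
        · have := Nat.div_le_div_right (c := K') h3
          have := Nat.div_le_div_right (c := K') h4
          omega
      have hlow : ∀ x ∈ X', ∀ y ∈ Y, k x ≤ k y ∧ l x ≤ l y := by
        intro x hx y hy
        have h1 := hlt x hx
        have h2 := (Finset.mem_filter.1 hy).2
        rcases hc x (hX (hX'X hx)) y (hX (hYX hy)) with h3 | ⟨h3, h4⟩
        · exact h3
        · have := Nat.div_le_div_right (c := K') h3
          have := Nat.div_le_div_right (c := K') h4
          omega
      have hNp := hN _ (hX (hYX hp1))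
      have hNp2 := hN _ (hX (hYX hp2))
      have hNr := hN _ (hX (hYX hr1))
      have hNr2 := hN _ (hX (hYX hr2))
      have i1 := ih (k p1) (l r1) X' (hX'X.trans hX) hNp.1.le hNr.2.le
        fun x hx => ⟨(hlow x hx p1 hp1).1, (hlow x hx r1 hr1).2, hlt x hx⟩
      have i2 := hY Y (hYX.trans hX) (k p1) (k p2) (l r1) (l r2)
        (fun y hy => ⟨hp1' y hy, hp2' y hy, hr1' y hy, hr2' y hy⟩) (hp1' _ hp2) (hr1' _ hr2) hNp2.1 hNr2.2
        (hco _ hp1 _ hp2).1 (hco _ hr1 _ hr2).2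
      have i3 := hΨ (k p2) a (l r2) b (h _ (hYX hp2)).1 ha (h _ (hYX hr2)).2.1 hb
      rw [hcard]; push_cast
      linarith

/-- lower row coordinate -/
noncomputable def lo (Z : Sq) (d : Bool) (u1 u2 : ℝ) : ℝ := if d then u1 else Z.S - u2
/-- upper row coordinate -/
noncomputable def hi (Z : Sq) (d : Bool) (u1 u2 : ℝ) : ℝ := if d then u2 else Z.S - u1

/-- a potential -/
structure Pot (Z : Sq) (γ0 : ℝ) (d : Bool) (H hu hv : ℝ → ℝ → ℝ) : Prop where
  g0 : 0 < γ0
  g1 : γ0 < 1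
  du : ∀ u ∈ Set.Icc 0 Z.S, ∀ v ∈ Set.Icc 0 (1 - γ0), HasDerivAt (fun u => H u v) (hu u v) u
  dv : ∀ u ∈ Set.Icc 0 Z.S, ∀ v ∈ Set.Icc 0 (1 - γ0), HasDerivAt (fun v => H u v) (hv u v) v
  pu : ∀ u ∈ Set.Icc 0 Z.S, ∀ v ∈ Set.Icc 0 (1 - γ0), 0 < hu u v
  pv : ∀ u ∈ Set.Icc 0 Z.S, ∀ v ∈ Set.Icc 0 (1 - γ0), 0 < hv u v
  cu : ContinuousOn (fun p : ℝ × ℝ => hu p.1 p.2) (Set.Icc 0 Z.S ×ˢ Set.Icc 0 (1 - γ0))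
  cv : ContinuousOn (fun p : ℝ × ℝ => hv p.1 p.2) (Set.Icc 0 Z.S ×ˢ Set.Icc 0 (1 - γ0))
  pr : ∀ u ∈ Set.Icc 0 Z.S, ∀ v ∈ Set.Icc 0 (1 - γ0),
    hu u v * hv u v * (1 + Z.β * ((if d then u else Z.S - u) * (1 - v))) ^ 2 = 1

variable {Z : Sq} {γ0 : ℝ} {d : Bool} {H hu hv : ℝ → ℝ → ℝ}

theorem Pot.mvt (P : Pot Z γ0 d H hu hv) {u1 u2 v1 v2 : ℝ} (h1 : 0 ≤ u1) (h2 : u1 ≤ u2) (h3 : u2 ≤ Z.S)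
    (h4 : 0 ≤ v1) (h5 : v1 ≤ v2) (h6 : v2 ≤ 1 - γ0) :
    ∃ x ∈ Set.Icc u1 u2, ∃ y ∈ Set.Icc v1 v2,
      H u2 v2 - H u1 v1 = hu x v2 * (u2 - u1) + hv u1 y * (v2 - v1) := by
  have A : ∃ x ∈ Set.Icc u1 u2, H u2 v2 - H u1 v2 = hu x v2 * (u2 - u1) := by
    rcases h2.eq_or_lt with h | h
    · exact ⟨u1, ⟨le_rfl, h2⟩, by rw [h]; simp⟩
    · obtain ⟨x, hx, he⟩ := exists_hasDerivAt_eq_slope (fun u => H u v2) (fun u => hu u v2) h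
        (fun u hu' => (P.du u ⟨h1.trans hu'.1, hu'.2.trans h3⟩ v2 ⟨h4.trans h5, h6⟩).continuousAt.continuousWithinAt)
        (fun u hu' => P.du u ⟨h1.trans hu'.1.le, hu'.2.le.trans h3⟩ v2 ⟨h4.trans h5, h6⟩)
      refine ⟨x, ⟨hx.1.le, hx.2.le⟩, ?_⟩
      rw [he, div_mul_cancel₀ _ (by linarith)]
  have Bq : ∃ y ∈ Set.Icc v1 v2, H u1 v2 - H u1 v1 = hv u1 y * (v2 - v1) := by
    rcases h5.eq_or_lt with h | h
    · exact ⟨v1, ⟨le_rfl, h5⟩, by rw [h]; simp⟩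
    · obtain ⟨x, hx, he⟩ := exists_hasDerivAt_eq_slope (fun v => H u1 v) (fun v => hv u1 v) h
        (fun u hu' => (P.dv u1 ⟨h1, h2.trans h3⟩ u ⟨h4.trans hu'.1, hu'.2.trans h6⟩).continuousAt.continuousWithinAt)
        (fun u hu' => P.dv u1 ⟨h1, h2.trans h3⟩ u ⟨h4.trans hu'.1.le, hu'.2.le.trans h6⟩)
      refine ⟨x, ⟨hx.1.le, hx.2.le⟩, ?_⟩
      rw [he, div_mul_cancel₀ _ (by linarith)]
  obtain ⟨x, hx, ex⟩ := A
  obtain ⟨y, hy, ey⟩ := Bq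
  exact ⟨x, hx, y, hy, by linarith⟩

theorem Pot.mono (P : Pot Z γ0 d H hu hv) {u1 u2 v1 v2 : ℝ} (h1 : 0 ≤ u1) (h2 : u1 ≤ u2) (h3 : u2 ≤ Z.S)
    (h4 : 0 ≤ v1) (h5 : v1 ≤ v2) (h6 : v2 ≤ 1 - γ0) : H u1 v1 ≤ H u2 v2 := by
  obtain ⟨x, hx, y, hy, e⟩ := P.mvt h1 h2 h3 h4 h5 h6
  have a := P.pu x ⟨h1.trans hx.1, hx.2.trans h3⟩ v2 ⟨h4.trans h5, h6⟩
  have b := P.pv u1 ⟨h1, h2.trans h3⟩ y ⟨h4.trans hy.1, hy.2.trans h6⟩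
  have := mul_nonneg a.le (sub_nonneg.2 h2)
  have := mul_nonneg b.le (sub_nonneg.2 h5)
  linarith

theorem Pot.bd (P : Pot Z γ0 d H hu hv) : ∃ C > 0, ∀ u ∈ Set.Icc 0 Z.S, ∀ v ∈ Set.Icc 0 (1 - γ0),
    hu u v ≤ C ∧ hv u v ≤ C := by
  have hK : IsCompact (Set.Icc 0 Z.S ×ˢ Set.Icc 0 (1 - γ0)) := isCompact_Icc.prod isCompact_Icc
  obtain ⟨C1, h1⟩ := hK.bddAbove_image P.cu
  obtain ⟨C2, h2⟩ := hK.bddAbove_image P.cv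
  refine ⟨max (max C1 C2) 1, by positivity, fun u hu' v hv' => ⟨?_, ?_⟩⟩
  · exact (h1 (Set.mem_image_of_mem _ (Set.mk_mem_prod hu' hv'))).trans ((le_max_left _ _).trans (le_max_left _ _))
  · exact (h2 (Set.mem_image_of_mem _ (Set.mk_mem_prod hu' hv'))).trans ((le_max_right _ _).trans (le_max_left _ _))

theorem Pot.uc (P : Pot Z γ0 d H hu hv) {e : ℝ} (he : 0 < e) : ∃ δ > 0, ∀ u ∈ Set.Icc 0 Z.S, ∀ v ∈ Set.Icc 0 (1 - γ0),
    ∀ u' ∈ Set.Icc 0 Z.S, ∀ v' ∈ Set.Icc 0 (1 - γ0), |u - u'| < δ → |v - v'| < δ →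
    hu u v ≤ hu u' v' + e ∧ hv u v ≤ hv u' v' + e := by
  have hK : IsCompact (Set.Icc 0 Z.S ×ˢ Set.Icc 0 (1 - γ0)) := isCompact_Icc.prod isCompact_Icc
  obtain ⟨d1, hd1, h1⟩ := Metric.uniformContinuousOn_iff.1 (hK.uniformContinuousOn_of_continuous P.cu) e he
  obtain ⟨d2, hd2, h2⟩ := Metric.uniformContinuousOn_iff.1 (hK.uniformContinuousOn_of_continuous P.cv) e he
  refine ⟨min d1 d2, lt_min hd1 hd2, fun u hu' v hv' u' hu2 v' hv2 a b => ?_⟩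
  have hd : dist (u, v) (u', v') < min d1 d2 := by
    rw [Prod.dist_eq]; exact max_lt (by rwa [Real.dist_eq]) (by rwa [Real.dist_eq])
  have i1 := h1 (u, v) (Set.mk_mem_prod hu' hv') (u', v') (Set.mk_mem_prod hu2 hv2) (hd.trans_le (min_le_left _ _))
  have i2 := h2 (u, v) (Set.mk_mem_prod hu' hv') (u', v') (Set.mk_mem_prod hu2 hv2) (hd.trans_le (min_le_right _ _))
  rw [Real.dist_eq, abs_lt] at i1 i2
  exact ⟨by linarith [i1.2], by linarith [i2.2]⟩

theorem Pot.local_up (P : Pot Z γ0 d H hu hv) {e : ℝ} (he : 0 < e) : ∃ δ > 0, ∀ u1 u2 v1 v2,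
    0 ≤ u1 → u1 < u2 → u2 ≤ Z.S → 0 ≤ v1 → v1 < v2 → v2 ≤ 1 - γ0 → u2 - u1 < δ → v2 - v1 < δ →
    ∀ᶠ w in Z.wF (Z.cI γ0), (L d (KP Z γ0 w ∩ QB Z (lo Z d u1 u2) (hi Z d u1 u2) (1 - v1) (1 - v2) w.1) : ℝ) ≤
      Real.sqrt w.1 * (H u2 v2 - H u1 v1 + e * ((u2 - u1) + (v2 - v1))) := by
  obtain ⟨C, hC, hCb⟩ := P.bd
  obtain ⟨δ, hδ, hu'⟩ := P.uc (e := e / 4) (by positivity)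
  have hg0 := P.g0
  refine ⟨min δ (e * γ0 / (4 * C)), lt_min hδ (by positivity), ?_⟩
  intro u1 u2 v1 v2 h1 h2 h3 h4 h5 h6 h7 h8
  have B : Box Z γ0 (lo Z d u1 u2) (hi Z d u1 u2) (1 - v1) (1 - v2) := by
    refine ⟨?_, ?_, ?_, hg0, by linarith, by linarith, by linarith⟩ <;>
    · simp only [lo, hi]
      split_ifs <;> linarith
  set c : ℝ := if d then u1 else u2 with hc
  have hcI : c ∈ Set.Icc u1 u2 := by rw [hc]; split_ifs <;> constructor <;> linarith
  have hlo : (if d then c else Z.S - c) = lo Z d u1 u2 := by rw [hc, lo]; split_ifs <;> rfl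
  have hc1 : c ∈ Set.Icc 0 Z.S := ⟨h1.trans hcI.1, hcI.2.trans h3⟩
  have hv1 : v1 ∈ Set.Icc 0 (1 - γ0) := ⟨h4, by linarith⟩
  have hv2 : v2 ∈ Set.Icc 0 (1 - γ0) := ⟨by linarith, h6⟩
  have hD := B.D11
  have hpr := P.pr c hc1 v1 hv1
  rw [hlo] at hpr
  set D := 1 + Z.β * (lo Z d u1 u2 * (1 - v1)) with hDd
  have a0 := P.pu c hc1 v1 hv1
  have b0 := P.pv c hc1 v1 hv1
  have hsd : hi Z d u1 u2 - lo Z d u1 u2 = u2 - u1 := by unfold lo hi; split_ifs <;> ring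
  have hg2 : 0 < 1 - v2 := by linarith
  have hg1 : 0 < 1 - v1 := by linarith
  have hr := rect_up B d (hu c v1 * D / (1 - v1)) (H u2 v2 - H u1 v1 + e * ((u2 - u1) + (v2 - v1))) (by positivity) ?_
  · exact hr.mono fun w hw => hw.le
  · rw [hsd]
    have e1 : hu c v1 * D / (1 - v1) * ((u2 - u1) * (1 - v1) / D) = hu c v1 * (u2 - u1) := by field_simp
    have e2 : (1 - v1 - (1 - v2)) / ((1 - v2) * D) / (hu c v1 * D / (1 - v1)) =
        hv c v1 * ((v2 - v1) + (v2 - v1) * (v2 - v1) / (1 - v2)) := by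
      have : hv c v1 = 1 / (hu c v1 * D ^ 2) := by rw [eq_div_iff (by positivity)]; linarith
      rw [this]; field_simp; ring
    rw [← hDd, e1, e2]
    obtain ⟨x, hx, y, hy, em⟩ := P.mvt h1 h2.le h3 h4 h5.le h6
    have q1 : hu c v1 ≤ hu x v2 + e / 4 := by
      refine (hu' c hc1 v1 hv1 x ⟨h1.trans hx.1, hx.2.trans h3⟩ v2 hv2 ?_ ?_).1
      · rw [abs_lt]; have := lt_of_lt_of_le h7 (min_le_left _ _); constructor <;> linarith [hx.1, hx.2, hcI.1, hcI.2]
      · rw [abs_lt]; have := lt_of_lt_of_le h8 (min_le_left _ _); constructor <;> linarith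
    have q2 : hv c v1 ≤ hv u1 y + e / 4 := by
      refine (hu' c hc1 v1 hv1 u1 ⟨h1, by linarith⟩ y ⟨h4.trans hy.1, hy.2.trans h6⟩ ?_ ?_).2
      · rw [abs_lt]; have := lt_of_lt_of_le h7 (min_le_left _ _); constructor <;> linarith [hcI.1, hcI.2]
      · rw [abs_lt]; have := lt_of_lt_of_le h8 (min_le_left _ _); constructor <;> linarith [hy.1, hy.2]
    have q3 : hv c v1 * ((v2 - v1) * (v2 - v1) / (1 - v2)) ≤ e / 4 * (v2 - v1) := by
      have r1 := (hCb c hc1 v1 hv1).2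
      have r2 := lt_of_lt_of_le h8 (min_le_right _ _)
      have r3 : (v2 - v1) / (1 - v2) ≤ e / (4 * C) := by
        rw [div_le_iff₀ hg2]
        calc v2 - v1 ≤ e / (4 * C) * γ0 := by rw [div_mul_eq_mul_div]; exact r2.le
          _ ≤ _ := by gcongr; linarith
      have : 0 ≤ v2 - v1 := by linarith
      calc hv c v1 * ((v2 - v1) * (v2 - v1) / (1 - v2)) = hv c v1 * ((v2 - v1) / (1 - v2)) * (v2 - v1) := by ring
        _ ≤ C * (e / (4 * C)) * (v2 - v1) := by gcongr
        _ = _ := by field_simp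
    have q4 := mul_le_mul_of_nonneg_right q1 (show 0 ≤ u2 - u1 by linarith)
    have q5 := mul_le_mul_of_nonneg_right q2 (show 0 ≤ v2 - v1 by linarith)
    have q6 : 0 < e * (u2 - u1) := mul_pos he (by linarith)
    have q7 : 0 < e * (v2 - v1) := mul_pos he (by linarith)
    rw [em]
    nlinarith

end Sq
end ML

open Filter
namespace ML
namespace Sq

theorem exists_cell (b : ℕ → ℕ) (b0 : b 0 = 0) (N x : ℕ) (hx : x < b N) :
    ∃ k < N, b k ≤ x ∧ x < b (k + 1) := by
  have hN : N ≠ 0 := by rintro rfl; omega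
  have hex : ∃ k, x < b (k + 1) := ⟨N - 1, by rwa [Nat.sub_add_cancel (Nat.one_le_iff_ne_zero.2 hN)]⟩
  classical
  refine ⟨Nat.find hex, ?_, ?_, Nat.find_spec hex⟩
  · have : Nat.find hex ≤ N - 1 := Nat.find_min' hex (by rwa [Nat.sub_add_cancel (Nat.one_le_iff_ne_zero.2 hN)])
    omega
  · rcases Nat.eq_zero_or_pos (Nat.find hex) with h | h
    · rw [h, b0]; exact Nat.zero_le _
    · have := Nat.find_min hex (m := Nat.find hex - 1) (by omega)
      rw [Nat.sub_add_cancel h] at this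
      omega

variable {Z : Sq} {γ0 : ℝ} {d : Bool} {H hu hv : ℝ → ℝ → ℝ}

theorem lo_mem {u1 u2 : ℝ} (h1 : 0 ≤ u1) (h2 : u1 ≤ u2) (h3 : u2 ≤ Z.S) : 0 ≤ lo Z d u1 u2 ∧ lo Z d u1 u2 ≤ Z.S := by
  unfold lo; split_ifs <;> constructor <;> linarith

theorem lo_anti {u1 u2 u1' u2' : ℝ} (h1 : u1' ≤ u1) (h2 : u2 ≤ u2') : lo Z d u1' u2' ≤ lo Z d u1 u2 := by
  unfold lo; split_ifs <;> linarith

theorem hi_mono {u1 u2 u1' u2' : ℝ} (h1 : u1' ≤ u1) (h2 : u2 ≤ u2') : hi Z d u1 u2 ≤ hi Z d u1' u2' := by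
  unfold hi; split_ifs <;> linarith

theorem row_cell (Z : Sq) (d : Bool) (n N : ℕ) (hN : 0 < N) (x : ℕ) (hx : x < n) :
    ∃ k < N, Z.rI (lo Z d (Z.S * k / N) (Z.S * (k + 1) / N)) n ≤ x ∧
      x < Z.rI (hi Z d (Z.S * k / N) (Z.S * (k + 1) / N)) n := by
  have hN' : (N : ℝ) ≠ 0 := by positivity
  obtain ⟨k, hk, h1, h2⟩ := exists_cell (fun k => Z.rI (Z.S * k / N) n) (by simp [rI_zero]) N x
    (by simp only [mul_div_cancel_right₀ _ hN']; rwa [rI_S])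
  push_cast at h1 h2
  cases d with
  | true => exact ⟨k, hk, by simpa [lo] using h1, by simpa [hi] using h2⟩
  | false =>
    refine ⟨N - 1 - k, by omega, ?_⟩
    have e : ((N - 1 - k : ℕ) : ℝ) = N - 1 - k := by
      rw [Nat.cast_sub (by omega), Nat.cast_sub (by omega)]; simp
    have e1 : Z.S - Z.S * ((N - 1 - k : ℕ) + 1) / N = Z.S * k / N := by rw [e]; field_simp; ring
    have e2 : Z.S - Z.S * ((N - 1 - k : ℕ)) / N = Z.S * (k + 1) / N := by rw [e]; field_simp; ring
    simp only [lo, hi, Bool.false_eq_true, if_false, e1, e2]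
    exact ⟨h1, h2⟩

theorem col_cell (Z : Sq) (_ : 0 < γ0) (n N : ℕ) (hN : 0 < N) (x : ℕ) (hx : x < Z.cI γ0 n) :
    ∃ k < N, Z.cI (1 - (1 - γ0) * k / N) n ≤ x ∧ x < Z.cI (1 - (1 - γ0) * (k + 1) / N) n := by
  have hN' : (N : ℝ) ≠ 0 := by positivity
  obtain ⟨k, hk, h1, h2⟩ := exists_cell (fun k => Z.cI (1 - (1 - γ0) * k / N) n) (by simp [cI_one]) N x
    (by simp only [mul_div_cancel_right₀ _ hN']; simpa using hx)
  push_cast at h2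
  exact ⟨k, hk, h1, h2⟩

theorem Pot.upper (P : Pot Z γ0 d H hu hv) (t : ℝ) (ht : H Z.S (1 - γ0) - H 0 0 < t) :
    ∀ᶠ w in Z.wF (Z.cI γ0), (L d (KP Z γ0 w) : ℝ) ≤ Real.sqrt w.1 * t := by
  have hS := Z.Spos
  have hg0 := P.g0
  have hg1 := P.g1
  obtain ⟨C, hC, hCb⟩ := P.bd
  set e := (t - (H Z.S (1 - γ0) - H 0 0)) / (2 * (2 * Z.S + 2)) with he
  have he0 : 0 < e := div_pos (by linarith) (by positivity)
  obtain ⟨δ, hδ, hloc⟩ := P.local_up he0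
  obtain ⟨K, hK⟩ := exists_nat_gt ((Z.S + 1) / δ)
  have hK0 : 0 < K := by
    have : (0:ℝ) < K := lt_of_le_of_lt (by positivity) hK
    exact_mod_cast this
  have hK0' : (0:ℝ) < K := by exact_mod_cast hK0
  obtain ⟨K', hK'⟩ := exists_nat_gt (C / e)
  have hK'0 : 0 < K' := by
    have : (0:ℝ) < K' := lt_of_le_of_lt (by positivity) hK'
    exact_mod_cast this
  have hK'0' : (0:ℝ) < K' := by exact_mod_cast hK'0
  set N := K * K' with hN
  have hN0 : 0 < N := Nat.mul_pos hK0 hK'0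
  have hN0' : (0:ℝ) < N := by exact_mod_cast hN0
  have hNr : (N : ℝ) = K * K' := by rw [hN]; push_cast; ring
  set U : ℕ → ℝ := fun k => Z.S * k / N with hU
  set V : ℕ → ℝ := fun k => (1 - γ0) * k / N with hV
  have hg : 0 < 1 - γ0 := by linarith
  have U0 : ∀ k, 0 ≤ U k := fun k => by simp only [hU]; positivity
  have V0 : ∀ k, 0 ≤ V k := fun k => by simp only [hV]; positivity
  have Um : ∀ {k k'}, k ≤ k' → U k ≤ U k' := fun {k k'} h => by simp only [hU]; gcongr
  have Vm : ∀ {k k'}, k ≤ k' → V k ≤ V k' := fun {k k'} h => by simp only [hV]; gcongr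
  have Us : ∀ {k k'}, k < k' → U k < U k' := fun {k k'} h => by simp only [hU]; gcongr
  have Vs : ∀ {k k'}, k < k' → V k < V k' := fun {k k'} h => by simp only [hV]; gcongr
  have UN : U N = Z.S := by simp only [hU]; field_simp
  have VN : V N = 1 - γ0 := by simp only [hV]; field_simp
  have Ule : ∀ {k}, k ≤ N → U k ≤ Z.S := fun {k} h => by rw [← UN]; exact Um h
  have Vle : ∀ {k}, k ≤ N → V k ≤ 1 - γ0 := fun {k} h => by rw [← VN]; exact Vm h
  have blk : ∀ {k1 k2 : ℕ}, k1 ≤ k2 → k1 / K' = k2 / K' → ((k2 + 1 : ℕ) : ℝ) - k1 ≤ K' := by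
    intro k1 k2 h h'
    have h3 := Nat.div_add_mod k1 K'
    have h4 := Nat.div_add_mod k2 K'
    have h5 := Nat.mod_lt k2 hK'0
    rw [h'] at h3
    have : k2 + 1 ≤ k1 + K' := by omega
    have : ((k2 + 1 : ℕ) : ℝ) ≤ ((k1 + K' : ℕ) : ℝ) := by exact_mod_cast this
    push_cast at this ⊢; linarith
  have Ub : ∀ {k1 k2 : ℕ}, k1 ≤ k2 → k1 / K' = k2 / K' → U (k2 + 1) - U k1 ≤ Z.S / K := by
    intro k1 k2 h h'
    have := blk h h'
    calc U (k2 + 1) - U k1 = Z.S * (((k2 + 1 : ℕ) : ℝ) - k1) / N := by simp only [hU]; ring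
      _ ≤ Z.S * K' / N := by gcongr
      _ = _ := by rw [hNr]; field_simp
  have Vb : ∀ {k1 k2 : ℕ}, k1 ≤ k2 → k1 / K' = k2 / K' → V (k2 + 1) - V k1 ≤ 1 / K := by
    intro k1 k2 h h'
    have := blk h h'
    calc V (k2 + 1) - V k1 = (1 - γ0) * (((k2 + 1 : ℕ) : ℝ) - k1) / N := by simp only [hV]; ring
      _ ≤ 1 * K' / N := by
        have : (0 : ℝ) ≤ ((k2 + 1 : ℕ) : ℝ) - k1 := by
          have : (k1 : ℝ) ≤ k2 := by exact_mod_cast h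
          push_cast; linarith
        gcongr; linarith
      _ = _ := by rw [hNr]; field_simp
  have hKδ : (Z.S + 1) / K < δ := by
    rw [div_lt_iff₀ hδ] at hK
    rw [div_lt_iff₀ hK0']; linarith
  have all : ∀ᶠ w in Z.wF (Z.cI γ0), ∀ p ∈ (Finset.range N ×ˢ Finset.range N) ×ˢ (Finset.range N ×ˢ Finset.range N),
      p.1.1 ≤ p.1.2 → p.2.1 ≤ p.2.2 → p.1.1 / K' = p.1.2 / K' → p.2.1 / K' = p.2.2 / K' →
      (L d (KP Z γ0 w ∩ QB Z (lo Z d (U p.1.1) (U (p.1.2 + 1))) (hi Z d (U p.1.1) (U (p.1.2 + 1)))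
        (1 - V p.2.1) (1 - V (p.2.2 + 1)) w.1) : ℝ) ≤
      Real.sqrt w.1 * (H (U (p.1.2 + 1)) (V (p.2.2 + 1)) - H (U p.1.1) (V p.2.1) + e * ((Z.S + 1) / K)) := by
    rw [Filter.eventually_all_finset]
    rintro ⟨⟨k1, k2⟩, l1, l2⟩ hp
    simp only [Finset.mem_product, Finset.mem_range] at hp
    by_cases hh : k1 ≤ k2 ∧ l1 ≤ l2 ∧ k1 / K' = k2 / K' ∧ l1 / K' = l2 / K'
    · obtain ⟨a1, a2, a3, a4⟩ := hh
      have b1 := Ub a1 a3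
      have b2 := Vb a2 a4
      have b3 : Z.S / K + 1 / K = (Z.S + 1) / K := by ring
      have b4 : 0 < Z.S / K := by positivity
      have b5 : 0 < 1 / (K:ℝ) := by positivity
      have := hloc (U k1) (U (k2 + 1)) (V l1) (V (l2 + 1)) (U0 _) (Us (by omega)) (Ule (by omega)) (V0 _) (Vs (by omega))
        (Vle (by omega)) (by linarith) (by linarith)
      filter_upwards [this] with w hw _ _ _ _
      refine hw.trans ?_
      gcongr
      linarith
    · exact Eventually.of_forall fun w h1 h2 h3 h4 => absurd ⟨h1, h2, h3, h4⟩ hh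
  filter_upwards [all] with w hw
  obtain ⟨X, hX, hch, hcard⟩ := exists_L d (KP Z γ0 w)
  have hmem : ∀ x ∈ X, x.1 < w.1 ∧ x.2 < Z.cI γ0 w.1 := by
    intro x hx
    have := hX hx
    rw [KP, Kept, Finset.mem_filter, Finset.mem_product, Finset.mem_range, Finset.mem_range] at this
    exact this.1
  have hrow := fun x (hx : x ∈ X) => row_cell Z d w.1 N hN0 x.1 (hmem x hx).1
  have hcol := fun x (hx : x ∈ X) => col_cell Z hg0 w.1 N hN0 x.2 (hmem x hx).2
  have hrow' : ∀ x : ℕ × ℕ, ∃ k : ℕ, x ∈ X → k < N ∧ Z.rI (lo Z d (U k) (U (k + 1))) w.1 ≤ x.1 ∧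
      x.1 < Z.rI (hi Z d (U k) (U (k + 1))) w.1 := by
    intro x
    by_cases hx : x ∈ X
    · obtain ⟨k, h1, h2, h3⟩ := hrow x hx
      exact ⟨k, fun _ => ⟨h1, by simp only [hU]; push_cast; exact h2, by simp only [hU]; push_cast; exact h3⟩⟩
    · exact ⟨0, fun h => absurd h hx⟩
  have hcol' : ∀ x : ℕ × ℕ, ∃ k : ℕ, x ∈ X → k < N ∧ Z.cI (1 - V k) w.1 ≤ x.2 ∧
      x.2 < Z.cI (1 - V (k + 1)) w.1 := by
    intro x
    by_cases hx : x ∈ X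
    · obtain ⟨k, h1, h2, h3⟩ := hcol x hx
      exact ⟨k, fun _ => ⟨h1, by simp only [hV]; exact h2, by simp only [hV]; push_cast; exact h3⟩⟩
    · exact ⟨0, fun h => absurd h hx⟩
  choose k hk using hrow'
  choose l hl using hcol'
  have lmon : ∀ x ∈ X, ∀ y ∈ X, x.2 < y.2 → l x ≤ l y := by
    intro x hx y hy hxy
    by_contra hcon
    have h1 := (hl x hx).2.1
    have h2 := (hl y hy).2.2
    have h3 := Vm (show l y + 1 ≤ l x by omega)
    have h4 := Vle (hl x hx).1.le
    have := Z.cI_anti (s := 1 - V (l x)) (t := 1 - V (l y + 1)) (by linarith) (by linarith) w.1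
    omega
  have kmon : ∀ x ∈ X, ∀ y ∈ X, rel d x.1 y.1 → k x ≤ k y := by
    intro x hx y hy hxy
    by_contra hcon
    have h1 := (hk x hx).2
    have h2 := (hk y hy).2
    have h3 := Um (show k y + 1 ≤ k x by omega)
    have h4 := Ule (hk x hx).1.le
    cases d with
    | true =>
      simp only [rel, lo, hi, if_true] at hxy h1 h2
      have := Z.rI_mono (U0 _) h3 w.1
      omega
    | false =>
      simp only [rel, lo, hi, Bool.false_eq_true, if_false] at hxy h1 h2
      have := Z.rI_mono (s := Z.S - U (k x)) (t := Z.S - U (k y + 1)) (by linarith) (by linarith) w.1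
      omega
  have hcomp : ∀ x ∈ X, ∀ y ∈ X, (k x ≤ k y ∧ l x ≤ l y) ∨ (k y ≤ k x ∧ l y ≤ l x) := by
    intro x hx y hy
    by_cases hxy : x = y
    · subst hxy; exact Or.inl ⟨le_rfl, le_rfl⟩
    rcases hch x hx y hy hxy with h | h
    · exact Or.inl ⟨kmon x hx y hy h.2, lmon x hx y hy h.1⟩
    · exact Or.inr ⟨kmon y hy x hx h.2, lmon y hy x hx h.1⟩
  have hsq : 0 ≤ Real.sqrt (w.1 : ℝ) := Real.sqrt_nonneg _
  have key := chain_sum X k l hcomp K' N (fun a b => Real.sqrt w.1 * H (U a) (V b))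
    (fun k1 k2 l1 l2 h1 h2 h3 h4 => by
      have := P.mono (U0 k1) (Um h1) (Ule h2) (V0 l1) (Vm h3) (Vle h4)
      gcongr) (Real.sqrt w.1 * (e * ((2 * Z.S + 2) / K))) (by positivity)
    (by
      intro Y hYX k1 k2 l1 l2 hY h1 h2 h3 h4 h5 h6
      have a1 := hw ((k1, k2), (l1, l2)) (by simp; omega) h1 h2 h5 h6
      dsimp only at a1 ⊢
      have a2 : Y.card ≤ L d (KP Z γ0 w ∩ QB Z (lo Z d (U k1) (U (k2 + 1))) (hi Z d (U k1) (U (k2 + 1)))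
        (1 - V l1) (1 - V (l2 + 1)) w.1) := by
        refine le_L (fun y hy => ?_) (hch.subset hYX)
        rw [Finset.mem_inter]
        refine ⟨hX (hYX hy), ?_⟩
        obtain ⟨c1, c2, c3, c4⟩ := hY y hy
        obtain ⟨d1, d2, d3⟩ := hk y (hYX hy)
        obtain ⟨e1, e2, e3⟩ := hl y (hYX hy)
        rw [QB, mem_Qb]
        have lm := lo_mem (Z := Z) (d := d) (U0 k1) (Um (show k1 ≤ k2 + 1 by omega)) (Ule (show k2 + 1 ≤ N by omega))
        have lm2 := lo_mem (Z := Z) (d := d) (U0 (k y)) (Um (show k y ≤ k y + 1 by omega)) (Ule (show k y + 1 ≤ N by omega))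
        have f1 := Z.rI_mono lm.1 (lo_anti (Z := Z) (d := d) (Um c1) (Um (show k y + 1 ≤ k2 + 1 by omega))) w.1
        have lh : lo Z d (U (k y)) (U (k y + 1)) ≤ hi Z d (U (k y)) (U (k y + 1)) := by
          have := Um (show k y ≤ k y + 1 by omega)
          unfold lo hi; split_ifs <;> linarith
        have f2 := Z.rI_mono (lm2.1.trans lh) (hi_mono (Z := Z) (d := d) (Um c1) (Um (show k y + 1 ≤ k2 + 1 by omega))) w.1
        have g1 := Vm c3
        have g2 := Vm (show l y + 1 ≤ l2 + 1 by omega)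
        have g3 := Vle (show l2 + 1 ≤ N by omega)
        have g4 := Vle (show l y ≤ N by omega)
        have f3 := Z.cI_anti (s := 1 - V (l y)) (t := 1 - V l1) (by linarith) (by linarith) w.1
        have f4 := Z.cI_anti (s := 1 - V (l2 + 1)) (t := 1 - V (l y + 1)) (by linarith) (by linarith) w.1
        omega
      have a3 : (Y.card : ℝ) ≤ _ := (Nat.cast_le.2 a2).trans a1
      refine a3.trans ?_
      have a4 : H (U (k2 + 1)) (V (l2 + 1)) - H (U k2) (V l2) ≤ e * ((Z.S + 1) / K) := by
        obtain ⟨x, hx, y, hy, em⟩ := P.mvt (U0 k2) (Um (show k2 ≤ k2 + 1 by omega)) (Ule (show k2 + 1 ≤ N by omega))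
          (V0 l2) (Vm (show l2 ≤ l2 + 1 by omega)) (Vle (show l2 + 1 ≤ N by omega))
        rw [em]
        have b1 := (hCb x ⟨(U0 k2).trans hx.1, hx.2.trans (Ule (by omega))⟩ (V (l2 + 1)) ⟨V0 _, Vle (by omega)⟩).1
        have b2 := (hCb (U k2) ⟨U0 k2, Ule (by omega)⟩ y ⟨(V0 _).trans hy.1, hy.2.trans (Vle (by omega))⟩).2
        have b3 : U (k2 + 1) - U k2 = Z.S / N := by simp only [hU]; push_cast; ring
        have b4 : V (l2 + 1) - V l2 = (1 - γ0) / N := by simp only [hV]; push_cast; ring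
        rw [b3, b4]
        calc _ ≤ C * (Z.S / N) + C * ((1 - γ0) / N) := by gcongr
          _ = C * (Z.S + (1 - γ0)) / N := by ring
          _ ≤ C * (Z.S + 1) / N := by gcongr; linarith
          _ = C / K' * ((Z.S + 1) / K) := by rw [hNr]; field_simp
          _ ≤ _ := by
            gcongr
            rw [div_le_iff₀ hK'0']
            rw [div_lt_iff₀ he0] at hK'; linarith
      have a5 : e * ((2 * Z.S + 2) / K) = e * ((Z.S + 1) / K) + e * ((Z.S + 1) / K) := by ring
      rw [a5]
      nlinarith)
    (fun x hx => ⟨(hk x hx).1, (hl x hx).1⟩) (2 * K) N N X subset_rfl le_rfl le_rfl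
    (fun x hx => ⟨(hk x hx).1.le, (hl x hx).1.le, by
      have h1 : k x / K' < K := Nat.div_lt_of_lt_mul (by rw [mul_comm]; exact (hk x hx).1)
      have h2 : l x / K' < K := Nat.div_lt_of_lt_mul (by rw [mul_comm]; exact (hl x hx).1)
      omega⟩)
  rw [hcard] at key
  refine key.trans (le_of_eq ?_)
  have z1 : U 0 = 0 := by simp [hU]
  have z2 : V 0 = 0 := by simp [hV]
  rw [UN, VN, z1, z2]
  have : (↑(2 * K) : ℝ) * (Real.sqrt w.1 * (e * ((2 * Z.S + 2) / K))) = Real.sqrt w.1 * (e * (2 * (2 * Z.S + 2))) := by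
    push_cast; field_simp
  rw [this, he, div_mul_cancel₀ _ (by positivity)]
  ring

end Sq
end ML

open Filter
namespace ML
namespace Sq

/-- the one dimensional potential -/
noncomputable def FF (κ z : ℝ) : ℝ :=
  if 0 < κ then 2 / Real.sqrt κ * Real.arsinh (Real.sqrt (κ * z))
  else if κ < 0 then 2 / Real.sqrt (-κ) * Real.arcsin (Real.sqrt (-κ * z)) else 2 * Real.sqrt z

theorem FF_deriv {κ z : ℝ} (hz : 0 < z) (h : 0 < 1 + κ * z) :
    HasDerivAt (FF κ) (1 / Real.sqrt (z * (1 + κ * z))) z := by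
  unfold FF
  rw [Real.sqrt_mul hz.le]
  have s1 : 0 < Real.sqrt z := Real.sqrt_pos.2 hz
  have s2 : 0 < Real.sqrt (1 + κ * z) := Real.sqrt_pos.2 h
  rcases lt_trichotomy κ 0 with hk | hk | hk
  · simp only [hk, not_lt.2 hk.le, if_true, if_false]
    have hk' : 0 < -κ := by linarith
    have s3 : 0 < Real.sqrt (-κ) := Real.sqrt_pos.2 hk'
    have h1 : HasDerivAt (fun z => -κ * z) (-κ) z := by simpa using (hasDerivAt_id z).const_mul (-κ)
    have h2 := h1.sqrt (by positivity)
    have h3 : Real.sqrt (-κ * z) < 1 := by rw [Real.sqrt_lt' one_pos]; linarith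
    have h4 := (Real.hasDerivAt_arcsin (x := Real.sqrt (-κ * z)) (by have := Real.sqrt_nonneg (-κ * z); linarith) h3.ne).comp z h2
    have h5 := h4.const_mul (2 / Real.sqrt (-κ))
    refine h5.congr_deriv ?_
    rw [Real.sq_sqrt (by positivity), Real.sqrt_mul hk'.le, show 1 - -κ * z = 1 + κ * z by ring]
    have : -κ = Real.sqrt (-κ) * Real.sqrt (-κ) := (Real.mul_self_sqrt hk'.le).symm
    field_simp
    linarith
  · subst hk
    simp only [lt_irrefl, if_false]
    have h5 := ((hasDerivAt_id z).sqrt hz.ne').const_mul 2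
    refine h5.congr_deriv ?_
    simp; field_simp
  · simp only [hk, if_true]
    have s3 : 0 < Real.sqrt κ := Real.sqrt_pos.2 hk
    have h1 : HasDerivAt (fun z => κ * z) κ z := by simpa using (hasDerivAt_id z).const_mul κ
    have h2 := h1.sqrt (by positivity)
    have h4 := (Real.hasDerivAt_arsinh (Real.sqrt (κ * z))).comp z h2
    have h5 := h4.const_mul (2 / Real.sqrt κ)
    refine h5.congr_deriv ?_
    rw [Real.sq_sqrt (by positivity), Real.sqrt_mul hk.le]
    have : κ = Real.sqrt κ * Real.sqrt κ := (Real.mul_self_sqrt hk.le).symm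
    field_simp
    linarith

theorem FF_cont (κ : ℝ) : Continuous (FF κ) := by
  unfold FF
  split_ifs
  · exact continuous_const.mul (Real.continuous_arsinh.comp (by fun_prop))
  · exact continuous_const.mul (Real.continuous_arcsin.comp (by fun_prop))
  · fun_prop

theorem FF_mono (κ : ℝ) {z z' : ℝ} (h : z ≤ z') : FF κ z ≤ FF κ z' := by
  unfold FF
  split_ifs with h1 h2
  · refine mul_le_mul_of_nonneg_left (Real.arsinh_strictMono.monotone ?_) (by positivity)
    gcongr
  · refine mul_le_mul_of_nonneg_left (Real.monotone_arcsin ?_) (by positivity)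
    have : 0 ≤ -κ := by linarith
    gcongr
  · gcongr

theorem FF_zero (κ : ℝ) : FF κ 0 = 0 := by unfold FF; simp

theorem FF_nonneg (κ : ℝ) {z : ℝ} (h : 0 ≤ z) : 0 ≤ FF κ z := by
  rw [← FF_zero κ]; exact FF_mono κ h

/-- the weight -/
noncomputable def DD (a b s g : ℝ) : ℝ := 1 + a * s + b * s * g
/-- the inner variable -/
noncomputable def zz (a b ε s g : ℝ) : ℝ := (s + ε) * (g + ε) / (DD a b (-ε) (-ε) * DD a b s g)
/-- the first partial derivative -/
noncomputable def hS (a b ε s g : ℝ) : ℝ := 1 / Real.sqrt (zz a b ε s g * (1 + -b * zz a b ε s g)) *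
  ((g + ε) * DD a b (-ε) g / (DD a b (-ε) (-ε) * DD a b s g ^ 2))
/-- the second partial derivative -/
noncomputable def hG (a b ε s g : ℝ) : ℝ := 1 / Real.sqrt (zz a b ε s g * (1 + -b * zz a b ε s g)) *
  ((s + ε) * DD a b s (-ε) / (DD a b (-ε) (-ε) * DD a b s g ^ 2))

/-- admissible parameters -/
structure Adm (a b ε S : ℝ) : Prop where
  e0 : 0 < ε
  a0 : 0 ≤ a
  ab : 0 ≤ a + b
  d0 : 0 < DD a b (-ε) (-ε)
  d1 : ∀ g ∈ Set.Icc (0:ℝ) 1, 0 < DD a b (-ε) g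
  d2 : ∀ s ∈ Set.Icc (0:ℝ) S, 0 < DD a b s (-ε)

variable {a b ε S s g : ℝ}

theorem Adm.D (A : Adm a b ε S) (hs : s ∈ Set.Icc (0:ℝ) S) (hg : g ∈ Set.Icc (0:ℝ) 1) : 0 < DD a b s g := by
  have h1 : 0 ≤ a + b * g := by nlinarith [A.a0, A.ab, hg.1, hg.2]
  have := mul_nonneg hs.1 h1
  unfold DD; nlinarith

theorem Adm.z (A : Adm a b ε S) (hs : s ∈ Set.Icc (0:ℝ) S) (hg : g ∈ Set.Icc (0:ℝ) 1) : 0 < zz a b ε s g := by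
  have := A.D hs hg
  have := A.d0
  have := A.e0
  have := hs.1
  have := hg.1
  unfold zz; positivity

theorem Adm.kz (A : Adm a b ε S) (hs : s ∈ Set.Icc (0:ℝ) S) (hg : g ∈ Set.Icc (0:ℝ) 1) :
    1 + -b * zz a b ε s g = DD a b (-ε) g * DD a b s (-ε) / (DD a b (-ε) (-ε) * DD a b s g) := by
  have h1 := (A.D hs hg).ne'
  have h2 := A.d0.ne'
  unfold zz
  rw [eq_div_iff (mul_ne_zero h2 h1), add_mul, mul_assoc (-b), div_mul_cancel₀ _ (mul_ne_zero h2 h1)]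
  unfold DD; ring

theorem Adm.kz0 (A : Adm a b ε S) (hs : s ∈ Set.Icc (0:ℝ) S) (hg : g ∈ Set.Icc (0:ℝ) 1) :
    0 < 1 + -b * zz a b ε s g := by
  rw [A.kz hs hg]
  have := A.D hs hg
  have := A.d0
  have := A.d1 g hg
  have := A.d2 s hs
  positivity

theorem Adm.ds (A : Adm a b ε S) (hs : s ∈ Set.Icc (0:ℝ) S) (hg : g ∈ Set.Icc (0:ℝ) 1) :
    HasDerivAt (fun s => FF (-b) (zz a b ε s g)) (hS a b ε s g) s := by
  have h1 := (A.D hs hg).ne'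
  have h2 := A.d0.ne'
  refine HasDerivAt.comp (h := fun s => zz a b ε s g) s (FF_deriv (A.z hs hg) (A.kz0 hs hg)) ?_
  have i1 : HasDerivAt (fun s => (s + ε) * (g + ε)) (1 * (g + ε)) s := ((hasDerivAt_id s).add_const ε).mul_const _
  have i2 : HasDerivAt (fun s => DD a b (-ε) (-ε) * DD a b s g) (DD a b (-ε) (-ε) * (a + b * g)) s := by
    have : HasDerivAt (fun s => DD a b s g) (a + b * g) s := by
      have := (((hasDerivAt_id s).const_mul a).const_add 1).add (((hasDerivAt_id s).const_mul b).mul_const g)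
      exact this.congr_deriv (by simp)
    exact this.const_mul _
  have i3 := i1.div i2 (mul_ne_zero h2 h1)
  refine i3.congr_deriv (Eq.symm ?_)
  rw [div_eq_div_iff (mul_ne_zero h2 (pow_ne_zero 2 h1)) (pow_ne_zero 2 (mul_ne_zero h2 h1))]
  simp only [DD]; ring

theorem Adm.dg (A : Adm a b ε S) (hs : s ∈ Set.Icc (0:ℝ) S) (hg : g ∈ Set.Icc (0:ℝ) 1) :
    HasDerivAt (fun g => FF (-b) (zz a b ε s g)) (hG a b ε s g) g := by
  have h1 := (A.D hs hg).ne'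
  have h2 := A.d0.ne'
  refine HasDerivAt.comp (h := fun g => zz a b ε s g) g (FF_deriv (A.z hs hg) (A.kz0 hs hg)) ?_
  have i1 : HasDerivAt (fun g => (s + ε) * (g + ε)) ((s + ε) * 1) g := ((hasDerivAt_id g).add_const ε).const_mul _
  have i2 : HasDerivAt (fun g => DD a b (-ε) (-ε) * DD a b s g) (DD a b (-ε) (-ε) * (b * s)) g := by
    have : HasDerivAt (fun g => DD a b s g) (b * s) g := by
      have := ((hasDerivAt_id g).const_mul (b * s)).const_add (1 + a * s)
      simpa [DD] using this
    exact this.const_mul _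
  have i3 := i1.div i2 (mul_ne_zero h2 h1)
  refine i3.congr_deriv (Eq.symm ?_)
  rw [div_eq_div_iff (mul_ne_zero h2 (pow_ne_zero 2 h1)) (pow_ne_zero 2 (mul_ne_zero h2 h1))]
  simp only [DD]; ring

theorem Adm.ps (A : Adm a b ε S) (hs : s ∈ Set.Icc (0:ℝ) S) (hg : g ∈ Set.Icc (0:ℝ) 1) : 0 < hS a b ε s g := by
  have := A.D hs hg
  have := A.d0
  have := A.d1 g hg
  have := A.z hs hg
  have := A.kz0 hs hg
  have := A.e0
  have := hg.1
  unfold hS; positivity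

theorem Adm.pg (A : Adm a b ε S) (hs : s ∈ Set.Icc (0:ℝ) S) (hg : g ∈ Set.Icc (0:ℝ) 1) : 0 < hG a b ε s g := by
  have := A.D hs hg
  have := A.d0
  have := A.d2 s hs
  have := A.z hs hg
  have := A.kz0 hs hg
  have := A.e0
  have := hs.1
  unfold hG; positivity

theorem Adm.pr (A : Adm a b ε S) (hs : s ∈ Set.Icc (0:ℝ) S) (hg : g ∈ Set.Icc (0:ℝ) 1) :
    hS a b ε s g * hG a b ε s g * DD a b s g ^ 2 = 1 := by
  have h1 := A.D hs hg
  have h2 := A.d0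
  have h3 := A.d1 g hg
  have h4 := A.d2 s hs
  have h5 := A.z hs hg
  have h6 := A.kz0 hs hg
  have h7 := A.e0
  have h8 : 0 < s + ε := by linarith [hs.1]
  have h9 : 0 < g + ε := by linarith [hg.1]
  unfold hS hG
  set r := Real.sqrt (zz a b ε s g * (1 + -b * zz a b ε s g)) with hr
  have hr2 : r * r = zz a b ε s g * (1 + -b * zz a b ε s g) := Real.mul_self_sqrt (by positivity)
  have hr0 : 0 < r := Real.sqrt_pos.2 (by positivity)
  rw [A.kz hs hg] at hr2
  unfold zz at hr2
  have : 1 / r * ((g + ε) * DD a b (-ε) g / (DD a b (-ε) (-ε) * DD a b s g ^ 2)) *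
    (1 / r * ((s + ε) * DD a b s (-ε) / (DD a b (-ε) (-ε) * DD a b s g ^ 2))) * DD a b s g ^ 2 =
     ((s + ε) * (g + ε) / (DD a b (-ε) (-ε) * DD a b s g) *
      (DD a b (-ε) g * DD a b s (-ε) / (DD a b (-ε) (-ε) * DD a b s g))) / (r * r) := by
    generalize DD a b (-ε) (-ε) = X at *
    generalize DD a b s g = Y at *
    generalize DD a b (-ε) g = W at *
    generalize DD a b s (-ε) = V at *
    field_simp
  rw [this, ← hr2, div_self (by positivity)]

theorem Adm.cont (A : Adm a b ε S) {f k : ℝ × ℝ → ℝ} (hf : Continuous f) (hk : Continuous k) {K : Set (ℝ × ℝ)}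
    (hK : ∀ p ∈ K, f p ∈ Set.Icc (0:ℝ) S ∧ k p ∈ Set.Icc (0:ℝ) 1) :
    ContinuousOn (fun p => hS a b ε (f p) (k p)) K ∧ ContinuousOn (fun p => hG a b ε (f p) (k p)) K := by
  have cD : Continuous fun p => DD a b (f p) (k p) := by unfold DD; fun_prop
  have cz : ContinuousOn (fun p => zz a b ε (f p) (k p)) K := by
    unfold zz
    refine ContinuousOn.div (by fun_prop) (cD.const_mul _).continuousOn fun p hp => ?_
    exact mul_ne_zero A.d0.ne' (A.D (hK p hp).1 (hK p hp).2).ne'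
  have cr : ContinuousOn (fun p => 1 / Real.sqrt (zz a b ε (f p) (k p) * (1 + -b * zz a b ε (f p) (k p)))) K := by
    refine ContinuousOn.div (by fun_prop) (ContinuousOn.sqrt (by fun_prop)) fun p hp => ?_
    exact (Real.sqrt_pos.2 (mul_pos (A.z (hK p hp).1 (hK p hp).2) (A.kz0 (hK p hp).1 (hK p hp).2))).ne'
  constructor
  · refine cr.mul (ContinuousOn.div ?_ ((cD.pow 2).const_mul _).continuousOn fun p hp => ?_)
    · unfold DD; fun_prop
    · exact mul_ne_zero A.d0.ne' (pow_ne_zero _ (A.D (hK p hp).1 (hK p hp).2).ne')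
  · refine cr.mul (ContinuousOn.div ?_ ((cD.pow 2).const_mul _).continuousOn fun p hp => ?_)
    · unfold DD; fun_prop
    · exact mul_ne_zero A.d0.ne' (pow_ne_zero _ (A.D (hK p hp).1 (hK p hp).2).ne')

theorem pot_true (Z : Sq) {γ0 : ℝ} (h0 : 0 < γ0) (h1 : γ0 < 1) (A : Adm Z.β (-Z.β) ε Z.S) :
    Pot Z γ0 true (fun u v => FF (-(-Z.β)) (zz Z.β (-Z.β) ε u v)) (hS Z.β (-Z.β) ε) (hG Z.β (-Z.β) ε) := by
  have hv : ∀ v ∈ Set.Icc 0 (1 - γ0), v ∈ Set.Icc (0:ℝ) 1 := fun v hv => ⟨hv.1, by linarith [hv.2]⟩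
  refine ⟨h0, h1, fun u hu v h => A.ds hu (hv v h), fun u hu v h => A.dg hu (hv v h), fun u hu v h => A.ps hu (hv v h),
    fun u hu v h => A.pg hu (hv v h), ?_, ?_, fun u hu v h => ?_⟩
  · exact (A.cont continuous_fst continuous_snd fun p hp => ⟨hp.1, hv _ hp.2⟩).1
  · exact (A.cont continuous_fst continuous_snd fun p hp => ⟨hp.1, hv _ hp.2⟩).2
  · have := A.pr hu (hv v h)
    refine Eq.trans ?_ this
    rw [if_pos rfl]
    congr 2
    unfold DD; ring

theorem pot_false (Z : Sq) {γ0 : ℝ} (h0 : 0 < γ0) (h1 : γ0 < 1) (A : Adm 0 Z.β ε Z.S) :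
    Pot Z γ0 false (fun u v => -FF (-Z.β) (zz 0 Z.β ε (Z.S - u) (1 - v)))
      (fun u v => hS 0 Z.β ε (Z.S - u) (1 - v)) (fun u v => hG 0 Z.β ε (Z.S - u) (1 - v)) := by
  have hv : ∀ v ∈ Set.Icc 0 (1 - γ0), 1 - v ∈ Set.Icc (0:ℝ) 1 := fun v hv => ⟨by linarith [hv.2], by linarith [hv.1]⟩
  have hu' : ∀ u ∈ Set.Icc 0 Z.S, Z.S - u ∈ Set.Icc 0 Z.S := fun u hu => ⟨by linarith [hu.2], by linarith [hu.1]⟩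
  refine ⟨h0, h1, fun u hu v h => ?_, fun u hu v h => ?_, fun u hu v h => A.ps (hu' u hu) (hv v h),
    fun u hu v h => A.pg (hu' u hu) (hv v h), ?_, ?_, fun u hu v h => ?_⟩
  · have := ((A.ds (hu' u hu) (hv v h)).comp u ((hasDerivAt_id u).const_sub Z.S)).neg
    refine this.congr_deriv ?_
    simp
  · have := ((A.dg (hu' u hu) (hv v h)).comp v ((hasDerivAt_id v).const_sub 1)).neg
    refine this.congr_deriv ?_
    simp
  · exact (A.cont (f := fun p => Z.S - p.1) (k := fun p => 1 - p.2) (by fun_prop) (by fun_prop)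
      fun p hp => ⟨hu' _ hp.1, hv _ hp.2⟩).1
  · exact (A.cont (f := fun p => Z.S - p.1) (k := fun p => 1 - p.2) (by fun_prop) (by fun_prop)
      fun p hp => ⟨hu' _ hp.1, hv _ hp.2⟩).2
  · refine Eq.trans ?_ (A.pr (hu' u hu) (hv v h))
    rw [if_neg (by simp)]
    congr 2
    unfold DD; ring

/-- the limit constant -/
noncomputable def cL (Z : Sq) (d : Bool) : ℝ := if d then calL Z.β else calL (-Z.β)

theorem cL_true (Z : Sq) : FF Z.β Z.S = cL Z true := by
  simp only [cL, if_true, FF, calL, S]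
  rcases Z.hβ.eq_or_lt with h | h
  · simp [← h]
  · simp only [h, h.ne', if_true, if_false]
    rw [mul_div_cancel₀ _ h.ne']

theorem cL_false (Z : Sq) : FF (-Z.β) (Z.S / (1 + Z.β * Z.S)) = cL Z false := by
  simp only [cL, Bool.false_eq_true, if_false, FF, calL, S]
  rcases Z.hβ.eq_or_lt with h | h
  · simp [← h]
  · have h1 : ¬ 0 < -Z.β := by linarith
    have h2 : -Z.β < 0 := by linarith
    simp only [h1, h2, h.ne', if_true, if_false, abs_neg, abs_of_pos h, neg_neg]
    congr 3
    rw [mul_div_cancel₀ _ h.ne', Real.exp_neg]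
    have := Real.exp_ne_zero Z.β
    field_simp
    rw [show 1 + (Real.exp Z.β - 1) = Real.exp Z.β by ring]; ring

theorem adm_ev (Z : Sq) (a b : ℝ) (ha : 0 ≤ a) (hab : 0 ≤ a + b) (hb : |a| + |b| ≤ 2 * Z.β) :
    ∀ᶠ ε in nhdsWithin (0:ℝ) (Set.Ioi 0), Adm a b ε Z.S := by
  have hS := Z.Spos
  have hβ := Z.hβ
  have c1 : ∀ᶠ ε in nhdsWithin (0:ℝ) (Set.Ioi 0), 2 * Z.β * (1 + Z.S + ε) * ε < 1 := by
    refine mem_nhdsWithin_of_mem_nhds ((show Continuous fun ε : ℝ => 2 * Z.β * (1 + Z.S + ε) * ε by fun_prop).continuousAt.eventually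
      (eventually_lt_nhds ?_))
    simp
  filter_upwards [c1, self_mem_nhdsWithin] with ε h1 h2
  have h2 : 0 < ε := h2
  have A1 : 2 * Z.β * ε ≤ 2 * Z.β * (1 + Z.S + ε) * ε := by
    have : 2 * Z.β * ε * 1 ≤ 2 * Z.β * ε * (1 + Z.S + ε) := by gcongr; linarith
    linarith
  have ba := abs_nonneg b
  refine ⟨h2, ha, hab, ?_, ?_, ?_⟩
  · have h4 : |a * ε - b * ε * ε| ≤ 2 * Z.β * (1 + Z.S + ε) * ε := by
      calc |a * ε - b * ε * ε| ≤ |a * ε| + |b * ε * ε| := abs_sub _ _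
        _ = |a| * ε * 1 + |b| * ε * ε := by rw [abs_mul, abs_mul, abs_mul, abs_of_pos h2]; ring
        _ ≤ |a| * ε * (1 + Z.S + ε) + |b| * ε * (1 + Z.S + ε) := by gcongr <;> linarith
        _ = (|a| + |b|) * ((1 + Z.S + ε) * ε) := by ring
        _ ≤ 2 * Z.β * ((1 + Z.S + ε) * ε) := by gcongr
        _ = _ := by ring
    have := le_abs_self (a * ε - b * ε * ε)
    unfold DD; nlinarith
  · intro g hg
    have h4 : |a * ε + b * ε * g| ≤ 2 * Z.β * (1 + Z.S + ε) * ε := by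
      calc |a * ε + b * ε * g| ≤ |a * ε| + |b * ε * g| := abs_add_le _ _
        _ = |a| * ε * 1 + |b| * ε * g := by rw [abs_mul, abs_mul, abs_mul, abs_of_pos h2, abs_of_nonneg hg.1]; ring
        _ ≤ |a| * ε * 1 + |b| * ε * 1 := by gcongr; exact hg.2
        _ = (|a| + |b|) * ε := by ring
        _ ≤ 2 * Z.β * ε := by gcongr
        _ ≤ _ := A1
    have := le_abs_self (a * ε + b * ε * g)
    unfold DD; nlinarith
  · intro s hs
    have h4 : |b * s * ε| ≤ 2 * Z.β * (1 + Z.S + ε) * ε := by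
      have hb' : |b| ≤ 2 * Z.β := by linarith [abs_nonneg a]
      have hs0 := hs.1
      have hs1 := hs.2
      calc |b * s * ε| = |b| * s * ε := by rw [abs_mul, abs_mul, abs_of_pos h2, abs_of_nonneg hs.1]
        _ ≤ 2 * Z.β * (1 + Z.S + ε) * ε := by gcongr; linarith
    have := le_abs_self (b * s * ε)
    have := mul_nonneg ha hs.1
    unfold DD; nlinarith

theorem zz_tendsto (Z : Sq) (a b : ℝ) (h : DD a b Z.S 1 ≠ 0) :
    Tendsto (fun ε => FF (-b) (zz a b ε Z.S 1)) (nhdsWithin (0:ℝ) (Set.Ioi 0)) (nhds (FF (-b) (Z.S / DD a b Z.S 1))) := by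
  refine Tendsto.mono_left ?_ nhdsWithin_le_nhds
  have : ContinuousAt (fun ε => FF (-b) (zz a b ε Z.S 1)) 0 := by
    refine (FF_cont _).continuousAt.comp ?_
    unfold zz
    refine ContinuousAt.div (by fun_prop) (by unfold DD; fun_prop) ?_
    simpa [DD] using h
  have := this.tendsto
  simpa [zz, DD] using this

theorem upper_KP (Z : Sq) (d : Bool) {γ0 : ℝ} (h0 : 0 < γ0) (h1 : γ0 < 1) (t : ℝ) (ht : cL Z d < t) :
    ∀ᶠ w in Z.wF (Z.cI γ0), (L d (KP Z γ0 w) : ℝ) ≤ Real.sqrt w.1 * t := by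
  have hS := Z.Spos
  have hβ := Z.hβ
  cases d with
  | true =>
    have l1 := zz_tendsto Z Z.β (-Z.β) (by simp [DD])
    rw [show DD Z.β (-Z.β) Z.S 1 = 1 by simp [DD], div_one, neg_neg, cL_true] at l1
    obtain ⟨ε, e1, A⟩ := ((l1.eventually (eventually_lt_nhds ht)).and
      (adm_ev Z Z.β (-Z.β) hβ (by simp) (by rw [abs_neg, abs_of_nonneg hβ]; linarith))).exists
    have P := pot_true Z h0 h1 A
    refine P.upper t ?_
    simp only [neg_neg]
    have e2 : 0 ≤ FF Z.β (zz Z.β (-Z.β) ε 0 0) := FF_nonneg _ (A.z ⟨le_rfl, hS.le⟩ ⟨le_rfl, zero_le_one⟩).le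
    have e3 : FF Z.β (zz Z.β (-Z.β) ε Z.S (1 - γ0)) ≤ FF Z.β (zz Z.β (-Z.β) ε Z.S 1) := by
      refine FF_mono _ ?_
      unfold zz
      have q1 := A.D (s := Z.S) (g := 1) ⟨hS.le, le_rfl⟩ ⟨zero_le_one, le_rfl⟩
      have q2 := A.d0
      have q3 := A.e0
      have q4 : DD Z.β (-Z.β) Z.S 1 ≤ DD Z.β (-Z.β) Z.S (1 - γ0) := by
        have : 0 ≤ Z.β * Z.S * γ0 := by positivity
        unfold DD; linarith
      have : 0 ≤ 1 - γ0 := by linarith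
      gcongr
      linarith
    linarith
  | false =>
    have hp : 0 < DD 0 Z.β Z.S 1 := by unfold DD; positivity
    have l1 := zz_tendsto Z 0 Z.β hp.ne'
    rw [show DD 0 Z.β Z.S 1 = 1 + Z.β * Z.S by simp [DD], cL_false] at l1
    obtain ⟨ε, e1, A⟩ := ((l1.eventually (eventually_lt_nhds ht)).and
      (adm_ev Z 0 Z.β le_rfl (by simpa using hβ) (by rw [abs_of_nonneg hβ]; simp; linarith))).exists
    have P := pot_false Z h0 h1 A
    refine P.upper t ?_
    have e2 : 0 ≤ FF (-Z.β) (zz 0 Z.β ε 0 γ0) := FF_nonneg _ (A.z ⟨le_rfl, hS.le⟩ ⟨h0.le, h1.le⟩).le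
    simp only [sub_self, sub_zero, sub_sub_cancel]
    linarith

end Sq
end ML

open Filter
namespace ML
namespace Sq

theorem L_concat (d : Bool) (P : Finset (ℕ × ℕ)) (Q : ℕ → Finset (ℕ × ℕ)) (m : ℕ)
    (h : ∀ i j, i < j → j < m → ∀ x ∈ Q i, ∀ y ∈ Q j, clt d x y) :
    ∑ i ∈ Finset.range m, L d (P ∩ Q i) ≤ L d P := by
  have hX := fun i => exists_L d (P ∩ Q i)
  choose X h1 h2 h3 using hX
  have hsub : ∀ i, X i ⊆ Q i := fun i => (h1 i).trans Finset.inter_subset_right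
  have hcl : ∀ i < m, ∀ j < m, i ≠ j → ∀ x ∈ X i, ∀ y ∈ X j, clt d x y ∨ clt d y x := by
    intro i hi j hj hij x hx y hy
    rcases lt_or_gt_of_ne hij with hl | hl
    · exact Or.inl (h i j hl hj x (hsub i hx) y (hsub j hy))
    · exact Or.inr (h j i hl hi y (hsub j hy) x (hsub i hx))
  have hcard : ((Finset.range m).biUnion X).card = ∑ i ∈ Finset.range m, L d (P ∩ Q i) := by
    rw [Finset.card_biUnion]
    · exact Finset.sum_congr rfl fun i _ => h3 i
    · intro i hi j hj hij
      refine Finset.disjoint_left.2 ?_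
      intro x hx hx'
      rcases hcl i (Finset.mem_range.1 hi) j (Finset.mem_range.1 hj) hij x hx x hx' with h | h <;>
        exact clt_irrefl d x h
  rw [← hcard]
  refine le_L ?_ ?_
  · intro x hx
    obtain ⟨i, _, hi⟩ := Finset.mem_biUnion.1 hx
    exact (Finset.mem_inter.1 (h1 i hi)).1
  · intro x hx y hy hxy
    obtain ⟨i, hi, hxi⟩ := Finset.mem_biUnion.1 hx
    obtain ⟨j, hj, hyj⟩ := Finset.mem_biUnion.1 hy
    by_cases hij : i = j
    · subst hij; exact h2 i x hxi y hyj hxy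
    · exact hcl i (Finset.mem_range.1 hi) j (Finset.mem_range.1 hj) hij x hxi y hyj

/-- a near optimal path -/
structure Geo (Z : Sq) (γ0 : ℝ) (d : Bool) (a0 : ℝ) (σ ρ G : ℝ → ℝ) : Prop where
  g0 : 0 < γ0
  an : 0 ≤ a0
  ab : a0 < 1 - γ0
  r : ∀ x ∈ Set.Icc a0 (1 - γ0), σ x ∈ Set.Icc 0 Z.S
  p : ∀ x ∈ Set.Icc a0 (1 - γ0), 0 < ρ x
  c : ContinuousOn ρ (Set.Icc a0 (1 - γ0))
  ds : ∀ x ∈ Set.Icc a0 (1 - γ0), HasDerivAt σ (if d then ρ x else -ρ x) x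
  dG : ∀ x ∈ Set.Icc a0 (1 - γ0), HasDerivAt G (2 * Real.sqrt (ρ x) / (1 + Z.β * (σ x * (1 - x)))) x

variable {Z : Sq} {γ0 : ℝ} {d : Bool} {a0 : ℝ} {σ ρ G : ℝ → ℝ}

/-- lower row end -/
noncomputable def pl (d : Bool) (σ : ℝ → ℝ) (x y : ℝ) : ℝ := if d then σ x else σ y
/-- upper row end -/
noncomputable def ph (d : Bool) (σ : ℝ → ℝ) (x y : ℝ) : ℝ := if d then σ y else σ x

theorem Geo.mvt (P : Geo Z γ0 d a0 σ ρ G) {x y : ℝ} (h1 : a0 ≤ x) (h2 : x < y) (h3 : y ≤ 1 - γ0) :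
    ∃ t ∈ Set.Icc x y, ph d σ x y - pl d σ x y = ρ t * (y - x) := by
  obtain ⟨t, ht, he⟩ := exists_hasDerivAt_eq_slope σ (fun x => if d then ρ x else -ρ x) h2
    (fun u hu => (P.ds u ⟨h1.trans hu.1, hu.2.trans h3⟩).continuousAt.continuousWithinAt)
    (fun u hu => P.ds u ⟨h1.trans hu.1.le, hu.2.le.trans h3⟩)
  refine ⟨t, ⟨ht.1.le, ht.2.le⟩, ?_⟩
  rw [eq_div_iff (by linarith)] at he
  unfold ph pl
  cases d
  · simp only [Bool.false_eq_true, if_false] at he ⊢; linarith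
  · simp only [if_true] at he ⊢; linarith

theorem Geo.pl_lt (P : Geo Z γ0 d a0 σ ρ G) {x y : ℝ} (h1 : a0 ≤ x) (h2 : x < y) (h3 : y ≤ 1 - γ0) :
    pl d σ x y < ph d σ x y := by
  obtain ⟨t, ht, he⟩ := P.mvt h1 h2 h3
  have := mul_pos (P.p t ⟨h1.trans ht.1, ht.2.trans h3⟩) (sub_pos.2 h2)
  linarith

theorem Geo.local_low (P : Geo Z γ0 d a0 σ ρ G) {e : ℝ} (he : 0 < e) : ∃ δ > 0, ∀ x y,
    a0 ≤ x → x < y → y ≤ 1 - γ0 → y - x < δ →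
    ∀ᶠ w in Z.wF (Z.cI γ0), Real.sqrt w.1 * (G y - G x - e * (y - x)) ≤
      (L d (KP Z γ0 w ∩ QB Z (pl d σ x y) (ph d σ x y) (1 - x) (1 - y) w.1) : ℝ) := by
  have hβ := Z.hβ
  have hg0 := P.g0
  have ha0 := P.an
  set I := Set.Icc a0 (1 - γ0) with hI
  have hIc : IsCompact I := isCompact_Icc
  obtain ⟨C0, hC0⟩ := hIc.bddAbove_image P.c
  have hC0' : ∀ x ∈ I, ρ x ≤ C0 := fun x hx => hC0 (Set.mem_image_of_mem _ hx)
  have hσc : ContinuousOn σ I := fun x hx => (P.ds x hx).continuousAt.continuousWithinAt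
  have hDp : ∀ y ∈ I, ∀ z ∈ I, 0 < 1 + Z.β * (σ y * (1 - z)) := by
    intro y hy z hz
    have := (P.r y hy).1
    have : 0 ≤ 1 - z := by linarith [hz.2]
    positivity
  set Φ : ℝ × ℝ × ℝ → ℝ := fun p => 2 * Real.sqrt (ρ p.1) / (1 + Z.β * (σ p.2.1 * (1 - p.2.2))) with hΦ
  have hΦc : ContinuousOn Φ (I ×ˢ I ×ˢ I) := by
    have k1 : ContinuousOn (fun p : ℝ × ℝ × ℝ => ρ p.1) (I ×ˢ I ×ˢ I) :=
      P.c.comp continuous_fst.continuousOn fun p hp => hp.1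
    have k2 : ContinuousOn (fun p : ℝ × ℝ × ℝ => σ p.2.1) (I ×ˢ I ×ˢ I) :=
      hσc.comp (by fun_prop) fun p hp => hp.2.1
    refine ContinuousOn.div (continuousOn_const.mul k1.sqrt) ?_ fun p hp => (hDp _ hp.2.1 _ hp.2.2).ne'
    exact continuousOn_const.add (continuousOn_const.mul (k2.mul (by fun_prop)))
  obtain ⟨δ1, hδ1, hu⟩ := Metric.uniformContinuousOn_iff.1
    ((hIc.prod (hIc.prod hIc)).uniformContinuousOn_of_continuous hΦc) (e / 4) (by positivity)
  have sm : ∀ f : ℝ → ℝ, Continuous f → f 0 = 0 → ∃ δ > 0, ∀ x, 0 < x → x < δ → f x < e / 4 := by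
    intro f hf hf0
    obtain ⟨δ, hδ, h⟩ := Metric.continuousAt_iff.1 (hf.continuousAt (x := 0)) (e / 4) (by positivity)
    refine ⟨δ, hδ, fun x hx hxd => ?_⟩
    have := h (x := x) (by rw [Real.dist_0_eq_abs, abs_of_pos hx]; exact hxd)
    rw [hf0, Real.dist_0_eq_abs] at this
    exact (le_abs_self _).trans_lt this
  obtain ⟨δ2, hδ2, hm2⟩ := sm (fun x => 6 * Real.sqrt (C0 * x) / γ0) (by fun_prop) (by simp)
  obtain ⟨δ3, hδ3, hm3⟩ := sm (fun x => 6 * C0 * Real.sqrt (Z.β * (x / γ0))) (by fun_prop) (by simp)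
  refine ⟨min δ1 (min δ2 δ3), by positivity, ?_⟩
  intro x y h1 h2 h3 h4
  have l1 : y - x < δ1 := h4.trans_le (min_le_left _ _)
  have l2 : y - x < δ2 := h4.trans_le ((min_le_right _ _).trans (min_le_left _ _))
  have l3 : y - x < δ3 := h4.trans_le ((min_le_right _ _).trans (min_le_right _ _))
  have hxI : x ∈ I := ⟨h1, by linarith⟩
  have hyI : y ∈ I := ⟨by linarith, h3⟩
  have B : Box Z γ0 (pl d σ x y) (ph d σ x y) (1 - x) (1 - y) := by
    refine ⟨?_, P.pl_lt h1 h2 h3, ?_, hg0, by linarith, by linarith, by linarith⟩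
    · unfold pl; split_ifs
      · exact (P.r x hxI).1
      · exact (P.r y hyI).1
    · unfold ph; split_ifs
      · exact (P.r y hyI).2
      · exact (P.r x hxI).2
  refine rect_low B d _ ?_
  obtain ⟨t, ht, e1⟩ := P.mvt h1 h2 h3
  have htI : t ∈ I := ⟨h1.trans ht.1, ht.2.trans h3⟩
  obtain ⟨v, hv, e2⟩ := exists_hasDerivAt_eq_slope G (fun x => 2 * Real.sqrt (ρ x) / (1 + Z.β * (σ x * (1 - x)))) h2
    (fun u hu => (P.dG u ⟨h1.trans hu.1, hu.2.trans h3⟩).continuousAt.continuousWithinAt)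
    (fun u hu => P.dG u ⟨h1.trans hu.1.le, hu.2.le.trans h3⟩)
  have hvI : v ∈ I := ⟨h1.trans hv.1.le, hv.2.le.trans h3⟩
  have hxy : 0 < y - x := by linarith
  rw [eq_div_iff hxy.ne'] at e2
  set c := if d then y else x with hc
  have hcc : c ∈ Set.Icc x y := by rw [hc]; split_ifs <;> constructor <;> linarith
  have hcI : c ∈ I := ⟨h1.trans hcc.1, hcc.2.trans h3⟩
  have hph : ph d σ x y = σ c := by rw [ph, hc]; split_ifs <;> rfl
  have q1 : Φ (v, v, v) < Φ (t, c, x) + e / 4 := by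
    have := hu (v, v, v) ⟨hvI, hvI, hvI⟩ (t, c, x) ⟨htI, hcI, hxI⟩ (by
      rw [Prod.dist_eq, Prod.dist_eq]
      refine max_lt ?_ (max_lt ?_ ?_) <;>
      · rw [Real.dist_eq, abs_lt]
        constructor <;> linarith [hv.1, hv.2, ht.1, ht.2, hcc.1, hcc.2])
    rw [Real.dist_eq, abs_lt] at this
    linarith [this.2]
  have hρt := P.p t htI
  have hρC := hC0' t htI
  have hgy : γ0 ≤ 1 - y := by linarith
  have hgy0 : 0 < 1 - y := by linarith
  have w1 : 2 * Real.sqrt (ρ t * (y - x) * (1 - x - (1 - y))) / (1 + Z.β * (σ c * (1 - x))) = Φ (t, c, x) * (y - x) := by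
    rw [show ρ t * (y - x) * (1 - x - (1 - y)) = ρ t * (y - x) ^ 2 by ring, Real.sqrt_mul hρt.le, Real.sqrt_sq hxy.le]
    simp only [hΦ]; ring
  have w2 : 6 * Real.sqrt (ρ t * (y - x)) * ((1 - x - (1 - y)) / (1 - y)) ≤ e / 4 * (y - x) := by
    calc 6 * Real.sqrt (ρ t * (y - x)) * ((1 - x - (1 - y)) / (1 - y))
        = 6 * Real.sqrt (ρ t * (y - x)) / (1 - y) * (y - x) := by ring
      _ ≤ 6 * Real.sqrt (C0 * (y - x)) / γ0 * (y - x) := by gcongr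
      _ ≤ _ := mul_le_mul_of_nonneg_right (hm2 _ hxy l2).le hxy.le
  have w3 : 6 * (ρ t * (y - x)) * Real.sqrt (Z.β * ((1 - x - (1 - y)) / (1 - y))) ≤ e / 4 * (y - x) := by
    calc 6 * (ρ t * (y - x)) * Real.sqrt (Z.β * ((1 - x - (1 - y)) / (1 - y)))
        = 6 * ρ t * Real.sqrt (Z.β * ((y - x) / (1 - y))) * (y - x) := by
          rw [show 1 - x - (1 - y) = y - x by ring]; ring
      _ ≤ 6 * C0 * Real.sqrt (Z.β * ((y - x) / γ0)) * (y - x) := by gcongr; linarith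
      _ ≤ _ := mul_le_mul_of_nonneg_right (hm3 _ hxy l3).le hxy.le
  rw [e1, hph, w1]
  have w4 : Φ (v, v, v) * (y - x) = G y - G x := e2
  have w5 := mul_lt_mul_of_pos_right q1 hxy
  nlinarith

theorem Geo.lower (P : Geo Z γ0 d a0 σ ρ G) (t : ℝ) (ht : t < G (1 - γ0) - G a0) :
    ∀ᶠ w in Z.wF (Z.cI γ0), Real.sqrt w.1 * t ≤ (L d (KP Z γ0 w) : ℝ) := by
  have hg0 := P.g0
  have ha0 := P.an
  have hab := P.ab
  set e := G (1 - γ0) - G a0 - t with he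
  obtain ⟨δ, hδ, hloc⟩ := P.local_low (e := e) (by linarith)
  obtain ⟨K, hK⟩ := exists_nat_gt (1 / δ)
  have hK0' : (0:ℝ) < K := lt_of_le_of_lt (by positivity) hK
  have hK0 : 0 < K := by exact_mod_cast hK0'
  set U : ℕ → ℝ := fun k => a0 + (1 - γ0 - a0) * k / K with hU
  have hl : 0 < 1 - γ0 - a0 := by linarith
  have Um : ∀ {k k'}, k ≤ k' → U k ≤ U k' := fun {k k'} h => by simp only [hU]; gcongr
  have Us : ∀ {k k'}, k < k' → U k < U k' := fun {k k'} h => by simp only [hU]; gcongr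
  have U0 : U 0 = a0 := by simp [hU]
  have UN : U K = 1 - γ0 := by simp only [hU]; field_simp; ring
  have Uge : ∀ k, a0 ≤ U k := fun k => by rw [← U0]; exact Um (Nat.zero_le _)
  have Ule : ∀ {k}, k ≤ K → U k ≤ 1 - γ0 := fun {k} h => by rw [← UN]; exact Um h
  have Ud : ∀ k, U (k + 1) - U k < δ := by
    intro k
    have : U (k + 1) - U k = (1 - γ0 - a0) / K := by simp only [hU]; push_cast; ring
    rw [this, div_lt_iff₀ hK0']
    rw [div_lt_iff₀ hδ] at hK
    linarith
  have all : ∀ᶠ w in Z.wF (Z.cI γ0), ∀ i ∈ Finset.range K,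
      Real.sqrt w.1 * (G (U (i + 1)) - G (U i) - e * (U (i + 1) - U i)) ≤
      (L d (KP Z γ0 w ∩ QB Z (pl d σ (U i) (U (i + 1))) (ph d σ (U i) (U (i + 1))) (1 - U i) (1 - U (i + 1)) w.1) : ℝ) := by
    rw [Filter.eventually_all_finset]
    intro i hi
    rw [Finset.mem_range] at hi
    exact hloc _ _ (Uge _) (Us (by omega)) (Ule (by omega)) (Ud i)
  filter_upwards [all] with w hw
  have hcon := L_concat d (KP Z γ0 w) (fun i => QB Z (pl d σ (U i) (U (i + 1))) (ph d σ (U i) (U (i + 1)))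
    (1 - U i) (1 - U (i + 1)) w.1) K (by
      intro i j hij hj x hx y hy
      rw [QB, mem_Qb] at hx hy
      have f1 := Um (show i + 1 ≤ j by omega)
      have f2 := Ule (show j ≤ K by omega)
      have f3 := Z.cI_anti (s := 1 - U j) (t := 1 - U (i + 1)) (by linarith) (by linarith) w.1
      refine ⟨by omega, ?_⟩
      have mI : ∀ k ≤ K, U k ∈ Set.Icc a0 (1 - γ0) := fun k hk => ⟨Uge k, Ule hk⟩
      have mon : pl d σ (U (i + 1)) (U j) ≤ ph d σ (U (i + 1)) (U j) := by
        rcases f1.eq_or_lt with h | h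
        · rw [h, pl, ph]
        · exact (P.pl_lt (Uge _) h f2).le
      cases d with
      | true =>
        simp only [pl, ph, rel, if_true] at *
        have := Z.rI_mono (P.r _ (mI (i + 1) (by omega))).1 mon w.1
        omega
      | false =>
        simp only [pl, ph, rel, Bool.false_eq_true, if_false] at *
        have := Z.rI_mono (P.r _ (mI j (by omega))).1 mon w.1
        omega)
  have hcon' : ((∑ i ∈ Finset.range K, L d (KP Z γ0 w ∩ QB Z (pl d σ (U i) (U (i + 1))) (ph d σ (U i) (U (i + 1)))
    (1 - U i) (1 - U (i + 1)) w.1) : ℕ) : ℝ) ≤ L d (KP Z γ0 w) := Nat.cast_le.2 hcon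
  refine le_trans ?_ hcon'
  push_cast
  refine le_trans ?_ (Finset.sum_le_sum hw)
  rw [← Finset.mul_sum]
  gcongr
  rw [Finset.sum_sub_distrib, ← Finset.mul_sum, Finset.sum_range_sub (fun i => G (U i)), Finset.sum_range_sub, U0, UN]
  nlinarith

end Sq
end ML

open Filter
namespace ML
namespace Sq

/-- inner variable along the optimal path -/
noncomputable def zt (Z : Sq) (x : ℝ) : ℝ := Z.S * x ^ 2 / (1 + Z.β * Z.S * (1 - x ^ 2))
/-- inner variable along the optimal decreasing path -/
noncomputable def zf (Z : Sq) (x : ℝ) : ℝ := Z.S * x ^ 2 / (1 + Z.β * Z.S * x ^ 2)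

theorem zt_deriv (Z : Sq) {x : ℝ} (h0 : 0 < x) (h1 : x < 1) :
    HasDerivAt (fun x => FF Z.β (zt Z x))
      (2 * Real.sqrt (Z.S * (1 + Z.β * Z.S)) / (1 + Z.β * Z.S * (1 - x ^ 2))) x := by
  have hS := Z.Spos
  have hβ := Z.hβ
  have hx2 : 0 < 1 - x ^ 2 := by nlinarith
  set b := Z.β * Z.S with hb
  have hb0 : 0 ≤ b := by positivity
  set r := Real.sqrt (Z.S * (1 + b)) with hr
  have hr0 : 0 < r := Real.sqrt_pos.2 (by positivity)
  have hr2 : r * r = Z.S * (1 + b) := Real.mul_self_sqrt (by positivity)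
  have hE : 0 < 1 + b * (1 - x ^ 2) := by positivity
  have i1 : HasDerivAt (fun x : ℝ => Z.S * x ^ 2) (Z.S * (2 * x)) x := by
    have := (hasDerivAt_pow 2 x).const_mul Z.S
    simpa using this
  have i2 : HasDerivAt (fun x : ℝ => 1 + b * (1 - x ^ 2)) (b * (-(2 * x))) x := by
    have := (((hasDerivAt_pow 2 x).const_sub 1).const_mul b).const_add 1
    simpa using this
  have i3 : HasDerivAt (zt Z) (2 * (r * r) * x / (1 + b * (1 - x ^ 2)) ^ 2) x := by
    refine (i1.div i2 hE.ne').congr_deriv ?_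
    rw [hr2]; ring
  have e1 : 1 + Z.β * zt Z x = (1 + b) / (1 + b * (1 - x ^ 2)) := by
    unfold zt; rw [← hb, eq_div_iff hE.ne', add_mul, mul_assoc Z.β (_ / _), div_mul_cancel₀ _ hE.ne', hb]; ring
  have z0 : 0 < zt Z x := by unfold zt; rw [← hb]; positivity
  have e2 : Real.sqrt (zt Z x * (1 + Z.β * zt Z x)) = r * x / (1 + b * (1 - x ^ 2)) := by
    rw [e1]
    rw [show zt Z x * ((1 + b) / (1 + b * (1 - x ^ 2))) = (r * x / (1 + b * (1 - x ^ 2))) ^ 2 by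
      unfold zt; rw [← hb, div_pow, mul_pow, pow_two r, hr2]; field_simp]
    exact Real.sqrt_sq (by positivity)
  have h := HasDerivAt.comp (h := zt Z) x (FF_deriv (κ := Z.β) z0 (by rw [e1]; positivity)) i3
  refine h.congr_deriv ?_
  rw [e2]
  generalize 1 + b * (1 - x ^ 2) = E at *
  field_simp

theorem zf_deriv (Z : Sq) {x : ℝ} (h0 : 0 < x) :
    HasDerivAt (fun x => FF (-Z.β) (zf Z x))
      (2 * Real.sqrt Z.S / (1 + Z.β * Z.S * x ^ 2)) x := by
  have hS := Z.Spos
  have hβ := Z.hβ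
  set b := Z.β * Z.S with hb
  have hb0 : 0 ≤ b := by positivity
  set r := Real.sqrt Z.S with hr
  have hr0 : 0 < r := Real.sqrt_pos.2 (by positivity)
  have hr2 : r * r = Z.S := Real.mul_self_sqrt (by positivity)
  have hE : 0 < 1 + b * x ^ 2 := by positivity
  have i1 : HasDerivAt (fun x : ℝ => Z.S * x ^ 2) (Z.S * (2 * x)) x := by
    have := (hasDerivAt_pow 2 x).const_mul Z.S
    simpa using this
  have i2 : HasDerivAt (fun x : ℝ => 1 + b * x ^ 2) (b * (2 * x)) x := by
    have := ((hasDerivAt_pow 2 x).const_mul b).const_add 1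
    simpa using this
  have i3 : HasDerivAt (zf Z) (2 * (r * r) * x / (1 + b * x ^ 2) ^ 2) x := by
    refine (i1.div i2 hE.ne').congr_deriv ?_
    rw [hr2]; ring
  have e1 : 1 + -Z.β * zf Z x = 1 / (1 + b * x ^ 2) := by
    unfold zf; rw [← hb, eq_div_iff hE.ne', add_mul, mul_assoc (-Z.β) (_ / _), div_mul_cancel₀ _ hE.ne', hb]; ring
  have z0 : 0 < zf Z x := by unfold zf; rw [← hb]; positivity
  have e2 : Real.sqrt (zf Z x * (1 + -Z.β * zf Z x)) = r * x / (1 + b * x ^ 2) := by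
    rw [e1]
    rw [show zf Z x * (1 / (1 + b * x ^ 2)) = (r * x / (1 + b * x ^ 2)) ^ 2 by
      unfold zf; rw [← hb, div_pow, mul_pow, pow_two r, hr2]; field_simp]
    exact Real.sqrt_sq (by positivity)
  have h := HasDerivAt.comp (h := zf Z) x (FF_deriv (κ := -Z.β) z0 (by rw [e1]; positivity)) i3
  refine h.congr_deriv ?_
  rw [e2]
  generalize 1 + b * x ^ 2 = E at *
  field_simp

theorem geo_true (Z : Sq) {g : ℝ} (h0 : 0 < g) (h1 : g < 1 / 2) :
    Geo Z g true g (fun x => Z.S * x / (1 + Z.β * Z.S * (1 - x)))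
      (fun x => Z.S * (1 + Z.β * Z.S) / (1 + Z.β * Z.S * (1 - x)) ^ 2) (fun x => FF Z.β (zt Z x)) := by
  have hS := Z.Spos
  have hβ := Z.hβ
  set b := Z.β * Z.S with hb
  have hb0 : 0 ≤ b := by positivity
  have hE : ∀ x ∈ Set.Icc g (1 - g), 0 < 1 + b * (1 - x) := by
    intro x hx
    have : 0 ≤ 1 - x := by linarith [hx.2]
    positivity
  refine ⟨h0, h0.le, by linarith, ?_, ?_, ?_, ?_, ?_⟩
  · intro x hx
    have := hE x hx
    have hx0 : 0 < x := h0.trans_le hx.1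
    refine ⟨by positivity, ?_⟩
    rw [div_le_iff₀ this]
    have k : 0 ≤ 1 - x := by linarith [hx.2]
    have : 0 ≤ Z.S * (b * (1 - x)) := by positivity
    have : 0 ≤ Z.S * (1 - x) := by positivity
    nlinarith
  · intro x hx
    have := hE x hx
    positivity
  · exact ContinuousOn.div continuousOn_const (by fun_prop) fun x hx => (pow_pos (hE x hx) 2).ne'
  · intro x hx
    have i1 : HasDerivAt (fun x : ℝ => Z.S * x) Z.S x := by
      simpa using (hasDerivAt_id x).const_mul Z.S
    have i2 : HasDerivAt (fun x : ℝ => 1 + b * (1 - x)) (-b) x := by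
      have := (((hasDerivAt_id x).const_sub 1).const_mul b).const_add 1
      simpa using this
    refine (i1.div i2 (hE x hx).ne').congr_deriv ?_
    rw [if_pos rfl]; ring
  · intro x hx
    have hx0 : 0 < x := h0.trans_le hx.1
    have hx1 : x < 1 := by linarith [hx.2]
    refine (zt_deriv Z hx0 hx1).congr_deriv ?_
    have e := hE x hx
    have hx2 : 0 < 1 - x ^ 2 := by nlinarith
    rw [← hb, Real.sqrt_div (by positivity), Real.sqrt_sq e.le]
    have e2 : 1 + Z.β * (Z.S * x / (1 + b * (1 - x)) * (1 - x)) = (1 + b * (1 - x ^ 2)) / (1 + b * (1 - x)) := by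
      rw [eq_div_iff e.ne', add_mul, show Z.β * (Z.S * x / (1 + b * (1 - x)) * (1 - x)) * (1 + b * (1 - x))
        = Z.S * x / (1 + b * (1 - x)) * (1 + b * (1 - x)) * (Z.β * (1 - x)) by ring, div_mul_cancel₀ _ e.ne', hb]; ring
    rw [e2]
    have : 0 < 1 + b * (1 - x ^ 2) := by positivity
    generalize 1 + b * (1 - x ^ 2) = E at *
    generalize 1 + b * (1 - x) = F at *
    field_simp

theorem geo_false (Z : Sq) {g : ℝ} (h0 : 0 < g) (h1 : g < 1 / 2) :
    Geo Z g false g (fun x => Z.S * (1 - x))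
      (fun _ => Z.S) (fun x => -FF (-Z.β) (zf Z (1 - x))) := by
  have hS := Z.Spos
  have hβ := Z.hβ
  refine ⟨h0, h0.le, by linarith, ?_, fun x hx => hS, continuousOn_const, ?_, ?_⟩
  · intro x hx
    have k : 0 ≤ 1 - x := by linarith [hx.2]
    have hx0 : 0 < x := h0.trans_le hx.1
    exact ⟨by positivity, by nlinarith⟩
  · intro x hx
    have := ((hasDerivAt_id x).const_sub 1).const_mul Z.S
    refine this.congr_deriv ?_
    simp
  · intro x hx
    have k : 0 < 1 - x := by linarith [hx.2]
    have := (HasDerivAt.comp (h := fun x => 1 - x) x (zf_deriv Z k) ((hasDerivAt_id x).const_sub 1)).neg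
    refine this.congr_deriv ?_
    rw [show Z.β * (Z.S * (1 - x) * (1 - x)) = Z.β * Z.S * (1 - x) ^ 2 by ring]
    simp

theorem lower_KP (Z : Sq) (d : Bool) (t : ℝ) (ht : t < cL Z d) :
    ∃ γ0 : ℝ, 0 < γ0 ∧ γ0 < 1 ∧ ∀ᶠ w in Z.wF (Z.cI γ0), Real.sqrt w.1 * t ≤ (L d (KP Z γ0 w) : ℝ) := by
  have hS := Z.Spos
  have hβ := Z.hβ
  have sm : ∀ f : ℝ → ℝ, ContinuousAt f 0 → t < f 0 → ∃ g, 0 < g ∧ g < 1 / 2 ∧ t < f g := by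
    intro f hf hf0
    have h1 : ∀ᶠ g in nhdsWithin (0:ℝ) (Set.Ioi 0), t < f g :=
      mem_nhdsWithin_of_mem_nhds (hf.eventually (eventually_gt_nhds hf0))
    have h2 : ∀ᶠ g in nhdsWithin (0:ℝ) (Set.Ioi 0), g < 1 / 2 :=
      mem_nhdsWithin_of_mem_nhds (eventually_lt_nhds (by norm_num))
    obtain ⟨g, a, b, c⟩ := (h1.and (h2.and self_mem_nhdsWithin)).exists
    exact ⟨g, c, b, a⟩
  have cf : ∀ x, ContinuousAt (fun x => FF (-Z.β) (zf Z x)) x := by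
    intro x
    refine (FF_cont _).continuousAt.comp ?_
    unfold zf
    refine ContinuousAt.div (by fun_prop) (by fun_prop) ?_
    positivity
  have ct : ∀ x, 0 < 1 + Z.β * Z.S * (1 - x ^ 2) → ContinuousAt (fun x => FF Z.β (zt Z x)) x := by
    intro x hx
    refine (FF_cont _).continuousAt.comp ?_
    unfold zt
    exact ContinuousAt.div (by fun_prop) (by fun_prop) hx.ne'
  cases d with
  | true =>
    obtain ⟨g, a, b, h⟩ := sm (fun g => FF Z.β (zt Z (1 - g)) - FF Z.β (zt Z g)) (by
      refine ContinuousAt.sub ?_ (ct 0 (by have : 0 ≤ Z.β * Z.S := by positivity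
                                           simp; linarith))
      refine ContinuousAt.comp (f := fun g : ℝ => 1 - g) (g := fun x => FF Z.β (zt Z x)) ?_ (by fun_prop)
      refine ct _ ?_
      simp) (by simpa [zt, FF_zero, cL_true] using ht)
    exact ⟨g, a, by linarith, (geo_true Z a b).lower t h⟩
  | false =>
    obtain ⟨g, a, b, h⟩ := sm (fun g => -FF (-Z.β) (zf Z (1 - (1 - g))) - -FF (-Z.β) (zf Z (1 - g))) (by
      refine ContinuousAt.sub (ContinuousAt.neg ?_) (ContinuousAt.neg ?_)
      · refine ContinuousAt.comp (f := fun g : ℝ => 1 - (1 - g)) (g := fun x => FF (-Z.β) (zf Z x)) (cf _) (by fun_prop)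
      · refine ContinuousAt.comp (f := fun g : ℝ => 1 - g) (g := fun x => FF (-Z.β) (zf Z x)) (cf _) (by fun_prop))
      (by simpa [zf, FF_zero, cL_false] using ht)
    exact ⟨g, a, by linarith, (geo_false Z a b).lower t h⟩

end Sq
end ML

open Filter
namespace ML
namespace Sq

theorem core_up (Z : Sq) (d : Bool) {ε : ℝ} (hε : 0 < ε) :
    Tendsto (fun n : ℕ => MW (Z.q n) n (Finset.range n)
      (fun w => if Real.sqrt n * (cL Z d + ε / 2) + Real.sqrt n * (ε / 2) ≤ (Lw d w : ℝ) then 1 else 0)) atTop (nhds 0) := by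
  have hβ := Z.hβ
  set c0 := Real.exp (-Z.β) / 2 with hc0
  have he := Real.exp_pos (-Z.β)
  have he1 : Real.exp (-Z.β) ≤ 1 := Real.exp_le_one_iff.2 (by linarith)
  obtain ⟨B, hB, hup⟩ := upper_MW c0 (by positivity) (by linarith)
  rw [Metric.tendsto_nhds]
  intro η hη
  obtain ⟨γ0, g0, g1, g2⟩ : ∃ g : ℝ, 0 < g ∧ g < 1 ∧ B * Real.sqrt (2 * g) * (2 / ε) < η / 2 := by
    have hf : Continuous fun g : ℝ => B * Real.sqrt (2 * g) * (2 / ε) := by fun_prop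
    have h1 : ∀ᶠ g in nhdsWithin (0:ℝ) (Set.Ioi 0), B * Real.sqrt (2 * g) * (2 / ε) < η / 2 :=
      mem_nhdsWithin_of_mem_nhds (hf.continuousAt.eventually (eventually_lt_nhds (by simp; positivity)))
    have h2 : ∀ᶠ g in nhdsWithin (0:ℝ) (Set.Ioi 0), g < 1 :=
      mem_nhdsWithin_of_mem_nhds (eventually_lt_nhds (by norm_num))
    obtain ⟨g, a, b, c⟩ := (h1.and (h2.and self_mem_nhdsWithin)).exists
    exact ⟨g, c, b, a⟩
  have e1 : ∀ᶠ n in atTop, c0 ≤ Z.q n ^ n :=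
    (Z.qpow_tendsto (fun n => n) Z.β Z.hlim).eventually (eventually_ge_nhds (by rw [hc0]; linarith))
  have e2 : ∀ᶠ n in atTop, Z.q n ^ Z.cI γ0 n ≤ 2 * γ0 :=
    (Z.cI_tendsto g0 g1.le).eventually (eventually_le_nhds (by linarith))
  have e3 := (ev_wF.1 (upper_KP Z d g0 g1 (cL Z d + ε / 4) (by linarith))).eventually
    (eventually_lt_nhds (show 0 < η / 2 by positivity))
  filter_upwards [e1, e2, e3, eventually_gt_atTop 0] with n h1 h2 h3 hn
  have hn' : (0:ℝ) < n := by exact_mod_cast hn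
  have hs : 0 < Real.sqrt n := Real.sqrt_pos.2 hn'
  have h4 := hup (Z.q n) n (Z.cI γ0 n) d (2 * γ0) (Real.sqrt n * (cL Z d + ε / 2)) (Real.sqrt n * (ε / 2))
    (Z.h0 n) (Z.h1 n) hn h1 (by positivity) h2 (by positivity)
  have h5 : 0 ≤ MW (Z.q n) n (Finset.range n)
      (fun w => if Real.sqrt n * (cL Z d + ε / 2) + Real.sqrt n * (ε / 2) ≤ (Lw d w : ℝ) then (1:ℝ) else 0) := by
    refine le_of_eq_of_le (MW_const (Z.h0 n) (Z.h1 n) n (Finset.range n) (Finset.card_range n) 0).symm ?_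
    refine MW_mono (Z.h0 n).le _ _ fun w => ?_
    split_ifs <;> norm_num
  rw [Real.dist_0_eq_abs, abs_of_nonneg h5]
  have h6 : B * Real.sqrt (n * (2 * γ0)) / (Real.sqrt n * (ε / 2)) = B * Real.sqrt (2 * γ0) * (2 / ε) := by
    rw [Real.sqrt_mul hn'.le]; field_simp
  rw [h6] at h4
  have h7 : Pr (fun _ => 1 - Z.q n) (Finset.range n ×ˢ Finset.range (Z.cI γ0 n))
        (fun T => Real.sqrt n * (cL Z d + ε / 2) ≤ (L d (Kept (Finset.range n) T (Z.cI γ0 n)) : ℝ)) ≤ 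
        Pr (fun _ => 1 - Z.q n) (sp (Z.cI γ0) n) (fun T => ¬ (L d (KP Z γ0 (n, T)) : ℝ) ≤ Real.sqrt (n, T).1 * (cL Z d + ε / 4)) := by
    refine Pr_mono (Z.hP n _) fun T _ h => ?_
    rw [not_le]
    refine lt_of_lt_of_le ?_ h
    simp only
    gcongr
    linarith
  linarith

theorem core_low (Z : Sq) (d : Bool) {ε : ℝ} (hε : 0 < ε) :
    Tendsto (fun n : ℕ => MW (Z.q n) n (Finset.range n)
      (fun w => if (Lw d w : ℝ) < Real.sqrt n * (cL Z d - ε / 2) then 1 else 0)) atTop (nhds 0) := by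
  obtain ⟨γ0, g0, g1, g2⟩ := lower_KP Z d (cL Z d - ε / 2) (by linarith)
  refine squeeze_zero (fun n => ?_) (fun n => ?_) (ev_wF.1 g2)
  · refine le_of_eq_of_le (MW_const (Z.h0 n) (Z.h1 n) n (Finset.range n) (Finset.card_range n) 0).symm ?_
    refine MW_mono (Z.h0 n).le _ _ fun w => ?_
    split_ifs <;> norm_num
  · refine (lower_MW (Z.h0 n) (Z.h1 n) n (Z.cI γ0 n) d _).trans ?_
    refine Pr_mono (Z.hP n _) fun T _ h => ?_
    rw [not_le]
    exact h

open Classical in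
theorem core (Z : Sq) (d : Bool) {ε : ℝ} (hε : 0 < ε) :
    Tendsto (fun n : ℕ => MW (Z.q n) n (Finset.range n)
      (fun w => if |(Lw d w : ℝ) / Real.sqrt n - cL Z d| < ε then 1 else 0)) atTop (nhds 1) := by
  have h1 := ((core_up Z d hε).add (core_low Z d hε)).const_sub 1
  rw [add_zero, sub_zero] at h1
  refine tendsto_of_tendsto_of_tendsto_of_le_of_le' h1 tendsto_const_nhds ?_ (Eventually.of_forall fun n => ?_)
  · filter_upwards [eventually_gt_atTop 0] with n hn
    have hn' : (0:ℝ) < n := by exact_mod_cast hn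
    have hs : 0 < Real.sqrt n := Real.sqrt_pos.2 hn'
    rw [sub_le_iff_le_add, ← MW_add, ← MW_add]
    refine le_of_eq_of_le (MW_const (Z.h0 n) (Z.h1 n) n (Finset.range n) (Finset.card_range n) 1).symm ?_
    refine MW_mono (Z.h0 n).le _ _ fun w => ?_
    by_cases h : |(Lw d w : ℝ) / Real.sqrt n - cL Z d| < ε
    · rw [if_pos h]; split_ifs <;> norm_num
    · rw [if_neg h]
      rw [not_lt, le_abs] at h
      rcases h with h | h
      · rw [if_pos]
        · split_ifs <;> norm_num
        · have : cL Z d + ε ≤ (Lw d w : ℝ) / Real.sqrt n := by linarith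
          rw [le_div_iff₀ hs] at this
          linarith
      · rw [if_pos (c := (Lw d w : ℝ) < Real.sqrt n * (cL Z d - ε / 2))]
        · split_ifs <;> norm_num
        · have : (Lw d w : ℝ) / Real.sqrt n < cL Z d - ε / 2 := by linarith
          rw [div_lt_iff₀ hs] at this
          linarith
  · refine le_of_le_of_eq ?_ (MW_const (Z.h0 n) (Z.h1 n) n (Finset.range n) (Finset.card_range n) 1)
    refine MW_mono (Z.h0 n).le _ _ fun w => ?_
    split_ifs <;> norm_num

end Sq
end ML

open Filter
namespace ML
open Sq

/-- the probability of a good permutation -/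
noncomputable def gp (β ε : ℝ) (n : ℕ) (q : ℝ) : ℝ :=
  mallowsProb n q {π | |(lisLength π : ℝ) / Real.sqrt n - calL β| < ε}

theorem gp_lt (q : ℕ → ℝ) (h0 : ∀ n, 0 < q n) (h1 : ∀ n, q n < 1) (β : ℝ)
    (hβ : Tendsto (fun n : ℕ => (n : ℝ) * (1 - q n)) atTop (nhds β)) {ε : ℝ} (hε : 0 < ε) :
    Tendsto (fun n => gp β ε n (q n)) atTop (nhds 1) := by
  classical
  have hb : 0 ≤ β := ge_of_tendsto' hβ fun n => mul_nonneg n.cast_nonneg (by linarith [h1 n])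
  have := Sq.core ⟨q, β, h0, h1, hb, hβ⟩ true hε
  refine this.congr fun n => ?_
  have := mallows_MW (h0 n) n (fun k => |(k : ℝ) / Real.sqrt n - calL β| < ε)
  rw [gp, this]
  rfl

theorem gp_gt (q : ℕ → ℝ) (h1 : ∀ n, 1 < q n) (β : ℝ)
    (hβ : Tendsto (fun n : ℕ => (n : ℝ) * (1 - q n)) atTop (nhds β)) {ε : ℝ} (hε : 0 < ε) :
    Tendsto (fun n => gp β ε n (q n)) atTop (nhds 1) := by
  classical
  have h0 : ∀ n, 0 < q n := fun n => one_pos.trans (h1 n)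
  have hb : β ≤ 0 := le_of_tendsto' hβ fun n => mul_nonpos_of_nonneg_of_nonpos n.cast_nonneg (by linarith [h1 n])
  have tq : Tendsto q atTop (nhds 1) := by
    have h := hβ.mul (tendsto_inv_atTop_nhds_zero_nat (𝕜 := ℝ))
    rw [mul_zero] at h
    have h2 := h.const_sub 1
    rw [sub_zero] at h2
    refine h2.congr' ?_
    filter_upwards [eventually_gt_atTop 0] with n hn
    have : (n : ℝ) ≠ 0 := by positivity
    field_simp
    ring
  have hl : Tendsto (fun n : ℕ => (n : ℝ) * (1 - (q n)⁻¹)) atTop (nhds (-β)) := by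
    have h := hβ.neg.mul (tq.inv₀ one_ne_zero)
    rw [inv_one, mul_one] at h
    refine h.congr fun n => ?_
    have := (h0 n).ne'
    field_simp
    ring
  have := Sq.core ⟨fun n => (q n)⁻¹, -β, fun n => inv_pos.2 (h0 n), fun n => inv_lt_one_of_one_lt₀ (h1 n), by linarith, hl⟩ false hε
  refine this.congr fun n => ?_
  have := mallows_MW_rev (h0 n) n (fun k => |(k : ℝ) / Real.sqrt n - calL β| < ε)
  rw [gp, this]
  simp [cL]

theorem gp_cont (β ε : ℝ) (n : ℕ) : ContinuousAt (gp β ε n) 1 := by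
  unfold gp mallowsProb
  refine ContinuousAt.div ?_ (by fun_prop) ?_
  · refine tendsto_finsetSum _ fun π _ => ?_
    simp only [Set.indicator_apply]
    split_ifs
    · exact (continuous_id.pow _).continuousAt
    · exact tendsto_const_nhds
  · simp only [one_pow, Finset.sum_const, nsmul_eq_mul, mul_one]
    rw [Nat.cast_ne_zero]
    exact (Finset.card_pos.2 Finset.univ_nonempty).ne'

theorem filler (β ε : ℝ) (n : ℕ) : ∃ r : ℝ, 0 < r ∧ r < 1 ∧ 1 - r ≤ 1 / ((n : ℝ) + 1) ^ 2 ∧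
    |gp β ε n r - gp β ε n 1| ≤ 1 / ((n : ℝ) + 1) := by
  obtain ⟨δ, hδ, h⟩ := Metric.continuousAt_iff.1 (gp_cont β ε n) (1 / ((n : ℝ) + 1)) (by positivity)
  have k0 : (0:ℝ) < 1 / ((n : ℝ) + 1) ^ 2 := by positivity
  set m := min (δ / 2) (min (1 / 2) (1 / ((n : ℝ) + 1) ^ 2)) with hm
  have m0 : 0 < m := by rw [hm]; positivity
  have m1 : m ≤ δ / 2 := min_le_left _ _
  have m2 : m ≤ 1 / 2 := (min_le_right _ _).trans (min_le_left _ _)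
  have m3 : m ≤ 1 / ((n : ℝ) + 1) ^ 2 := (min_le_right _ _).trans (min_le_right _ _)
  refine ⟨1 - m, by linarith, by linarith, by linarith, ?_⟩
  have := h (x := 1 - m) (by rw [Real.dist_eq, abs_lt]; constructor <;> linarith)
  rw [Real.dist_eq] at this
  exact this.le

theorem nsq_tendsto : Tendsto (fun n : ℕ => (n : ℝ) * (1 / ((n : ℝ) + 1) ^ 2)) atTop (nhds 0) := by
  refine squeeze_zero (fun n => by positivity) (fun n => ?_) (tendsto_one_div_add_atTop_nhds_zero_nat (𝕜 := ℝ))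
  rw [mul_one_div, div_le_div_iff₀ (by positivity) (by positivity)]
  nlinarith [(Nat.cast_nonneg n : (0:ℝ) ≤ n)]

theorem part_le (q : ℕ → ℝ) (h0 : ∀ n, 0 < q n) (β : ℝ) (hb : 0 ≤ β)
    (hβ : Tendsto (fun n : ℕ => (n : ℝ) * (1 - q n)) atTop (nhds β)) {ε : ℝ} (hε : 0 < ε) :
    ∃ e : ℕ → ℝ, Tendsto e atTop (nhds 0) ∧ ∀ n, q n ≤ 1 → |gp β ε n (q n) - 1| ≤ e n := by
  classical
  choose r r0 r1 r2 r3 using filler β ε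
  set q1 : ℕ → ℝ := fun n => if q n < 1 then q n else r n with hq1
  have a0 : ∀ n, 0 < q1 n := fun n => by simp only [hq1]; split_ifs <;> [exact h0 n; exact r0 n]
  have a1 : ∀ n, q1 n < 1 := fun n => by simp only [hq1]; split_ifs with h <;> [exact h; exact r1 n]
  have hr : Tendsto (fun n : ℕ => (n : ℝ) * (1 - r n)) atTop (nhds 0) :=
    squeeze_zero (fun n => mul_nonneg n.cast_nonneg (by linarith [r1 n]))
      (fun n => mul_le_mul_of_nonneg_left (r2 n) n.cast_nonneg) nsq_tendsto
  have a2 : Tendsto (fun n : ℕ => (n : ℝ) * (1 - q1 n)) atTop (nhds β) := by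
    rcases hb.eq_or_lt with h | h
    · subst h
      refine (Tendsto.if' (p := fun n => q n < 1) (f := fun n : ℕ => (n : ℝ) * (1 - q n)) (g := fun n : ℕ => (n : ℝ) * (1 - r n))
        hβ hr).congr fun n => ?_
      simp only [hq1]; split_ifs <;> rfl
    · refine hβ.congr' ?_
      filter_upwards [hβ.eventually (eventually_gt_nhds h)] with n hn
      have : q n < 1 := by
        by_contra hc
        push Not at hc
        have := mul_nonpos_of_nonneg_of_nonpos (n.cast_nonneg : (0:ℝ) ≤ n) (show 1 - q n ≤ 0 by linarith)
        linarith
      simp only [hq1, if_pos this]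
  have key := gp_lt q1 a0 a1 β a2 hε
  refine ⟨fun n => |gp β ε n (q1 n) - 1| + 1 / ((n : ℝ) + 1), ?_, ?_⟩
  · have h1 := (key.sub_const 1).abs.add (tendsto_one_div_add_atTop_nhds_zero_nat (𝕜 := ℝ))
    simpa using h1
  · intro n hn
    rcases hn.eq_or_lt with h | h
    · have e : q1 n = r n := by simp [hq1, h]
      simp only [e]
      rw [h]
      have := abs_sub_le (gp β ε n 1) (gp β ε n (r n)) 1
      have h3 := r3 n
      rw [abs_sub_comm] at h3
      linarith
    · simp only [hq1, if_pos h]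
      have : (0:ℝ) ≤ 1 / ((n : ℝ) + 1) := by positivity
      linarith

theorem part_ge (q : ℕ → ℝ) (β : ℝ) (hb : β ≤ 0)
    (hβ : Tendsto (fun n : ℕ => (n : ℝ) * (1 - q n)) atTop (nhds β)) {ε : ℝ} (hε : 0 < ε) :
    ∃ e : ℕ → ℝ, Tendsto e atTop (nhds 0) ∧ ∀ n, 1 < q n → |gp β ε n (q n) - 1| ≤ e n := by
  classical
  set r : ℕ → ℝ := fun n => 1 + 1 / ((n : ℝ) + 1) ^ 2 with hrd
  set q1 : ℕ → ℝ := fun n => if 1 < q n then q n else r n with hq1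
  have a1 : ∀ n, 1 < q1 n := fun n => by
    simp only [hq1]; split_ifs with h
    · exact h
    · simp only [hrd]; have : (0:ℝ) < 1 / ((n : ℝ) + 1) ^ 2 := by positivity
      linarith
  have hr : Tendsto (fun n : ℕ => (n : ℝ) * (1 - r n)) atTop (nhds 0) := by
    have := nsq_tendsto.neg
    rw [neg_zero] at this
    refine this.congr fun n => ?_
    simp only [hrd]; ring
  have a2 : Tendsto (fun n : ℕ => (n : ℝ) * (1 - q1 n)) atTop (nhds β) := by
    rcases hb.eq_or_lt with h | h
    · subst h
      refine (Tendsto.if' (p := fun n => 1 < q n) (f := fun n : ℕ => (n : ℝ) * (1 - q n)) (g := fun n : ℕ => (n : ℝ) * (1 - r n))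
        hβ hr).congr fun n => ?_
      simp only [hq1]; split_ifs <;> rfl
    · refine hβ.congr' ?_
      filter_upwards [hβ.eventually (eventually_lt_nhds h)] with n hn
      have : 1 < q n := by
        by_contra hc
        push Not at hc
        have := mul_nonneg (n.cast_nonneg : (0:ℝ) ≤ n) (show 0 ≤ 1 - q n by linarith)
        linarith
      simp only [hq1, if_pos this]
  have key := gp_gt q1 a1 β a2 hε
  refine ⟨fun n => |gp β ε n (q1 n) - 1|, ?_, ?_⟩
  · have h1 := (key.sub_const 1).abs
    simpa using h1
  · intro n hn
    simp only [hq1, if_pos hn, le_refl]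

theorem final (q : ℕ → ℝ) (hq : ∀ n, 0 < q n) (β : ℝ)
    (hβ : Tendsto (fun n : ℕ => (n : ℝ) * (1 - q n)) atTop (nhds β)) {ε : ℝ} (hε : 0 < ε) :
    Tendsto (fun n => gp β ε n (q n)) atTop (nhds 1) := by
  obtain ⟨e1, t1, b1⟩ : ∃ e : ℕ → ℝ, Tendsto e atTop (nhds 0) ∧
      ∀ᶠ n in atTop, q n ≤ 1 → |gp β ε n (q n) - 1| ≤ e n := by
    rcases le_or_gt 0 β with h | h
    · obtain ⟨e, a, b⟩ := part_le q hq β h hβ hε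
      exact ⟨e, a, Eventually.of_forall b⟩
    · refine ⟨fun _ => 0, tendsto_const_nhds, ?_⟩
      filter_upwards [hβ.eventually (eventually_lt_nhds h)] with n hn hc
      have := mul_nonneg (n.cast_nonneg : (0:ℝ) ≤ n) (show 0 ≤ 1 - q n by linarith)
      linarith
  obtain ⟨e2, t2, b2⟩ : ∃ e : ℕ → ℝ, Tendsto e atTop (nhds 0) ∧
      ∀ᶠ n in atTop, 1 < q n → |gp β ε n (q n) - 1| ≤ e n := by
    rcases le_or_gt β 0 with h | h
    · obtain ⟨e, a, b⟩ := part_ge q β h hβ hε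
      exact ⟨e, a, Eventually.of_forall b⟩
    · refine ⟨fun _ => 0, tendsto_const_nhds, ?_⟩
      filter_upwards [hβ.eventually (eventually_gt_nhds h)] with n hn hc
      have := mul_nonpos_of_nonneg_of_nonpos (n.cast_nonneg : (0:ℝ) ≤ n) (show 1 - q n ≤ 0 by linarith)
      linarith
  rw [tendsto_iff_dist_tendsto_zero]
  have t3 := t1.abs.add t2.abs
  simp only [abs_zero, add_zero] at t3
  refine squeeze_zero' (Eventually.of_forall fun n => dist_nonneg) ?_ t3
  filter_upwards [b1, b2] with n h1 h2
  rw [Real.dist_eq]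
  rcases le_or_gt (q n) 1 with h | h
  · exact (h1 h).trans (by have := le_abs_self (e1 n); have := abs_nonneg (e2 n); linarith)
  · exact (h2 h).trans (by have := le_abs_self (e2 n); have := abs_nonneg (e1 n); linarith)

end ML

/-- Weak law of large numbers for the length of the longest increasing subsequence of
Mallows distributed random permutations. -/
theorem mallows_lis_wlln (q : ℕ → ℝ) (hq : ∀ n, 0 < q n) (β : ℝ)
    (hβ : Tendsto (fun n : ℕ => (n : ℝ) * (1 - q n)) atTop (nhds β)) :
    ∀ ε > 0, Tendsto (fun n : ℕ =>
        mallowsProb n (q n)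
          {π | |(lisLength π : ℝ) / Real.sqrt n - calL β| < ε})
      atTop (nhds 1) := by
  intro ε hε
  exact ML.final q hq β hβ hε
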